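/- arXiv:2102.00370 — 10 statements merged into one kernel-verified Lean document; each statement's English description precedes it below -/
import Mathlib

section
/- Let A and B be odd integers with A > 1 and B > 1. If the Jacobi symbol (-B(1-B) / A) equals -1, then there are infinitely many primes p, not dividing A·B, such that the multiplicative order of A modulo p is strictly greater than the multiplicative order of B modulo p. -/
open scoped NumberTheorySymbols

/-- A nonsquare unit of a finite field has larger order than any even power of it. -/
theorem orderOf_even_pow_lt_of_not_isSquare {F : Type*} [Field F] [Finite F] {x : F}
    (hx : ¬ IsSquare x) (k : ℕ) : orderOf (x ^ (2 * k)) < orderOf x := by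
  have hx0 : x ≠ 0 := by
    rintro rfl
    exact hx IsSquare.zero
  have hpos : 0 < orderOf x := by
    rw [← Units.val_mk0 hx0, orderOf_units]
    exact orderOf_pos _
  rcases Nat.even_or_odd' (orderOf x) with ⟨d, hd | hd⟩
  · have h1 : (x ^ (2 * k)) ^ d = 1 := by
      rw [← pow_mul, show 2 * k * d = (2 * d) * k by ring, ← hd, pow_mul, pow_orderOf_eq_one,
        one_pow]
    have := orderOf_le_of_pow_eq_one (by omega) h1
    omega
  · refine absurd ⟨x ^ (d + 1), ?_⟩ hx
    rw [← pow_add, show d + 1 + (d + 1) = (2 * d + 1) + 1 by ring, ← hd, pow_succ,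
      pow_orderOf_eq_one, one_mul]

/-- Quadratic reciprocity when the lower argument is `3` modulo `4`. -/
theorem jacobiSym_eq_neg_of_three_mod_four {a q : ℕ} (ha : Odd a) (hq : q % 4 = 3) :
    J(a | q) = J(-q | a) := by
  rw [jacobiSym.neg _ ha]
  rcases Nat.odd_mod_four_iff.mp (Nat.odd_iff.mp ha) with h | h
  · rw [jacobiSym.quadratic_reciprocity_one_mod_four h (by rw [Nat.odd_iff]; omega),
      ZMod.χ₄_nat_one_mod_four h, one_mul]
  · rw [jacobiSym.quadratic_reciprocity_three_mod_four h hq, ZMod.χ₄_nat_three_mod_four h,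
      neg_one_mul]

/-- Theorem 1.1(i), first case: if `A, B` are odd integers exceeding 1 and the Jacobi
symbol `(-B(1-B) / A)` is `-1`, then there are infinitely many primes `p` (not dividing
`A*B`) with `ord_p(A) > ord_p(B)`. -/
theorem order_dominant_of_jacobi_neg_one
    (A B : ℤ) (hAodd : Odd A) (hBodd : Odd B) (hA : 1 < A) (hB : 1 < B)
    (hJ : jacobiSym (-B * (1 - B)) A.toNat = -1) :
    {p : ℕ | p.Prime ∧ ¬ (p : ℤ) ∣ A * B ∧
      orderOf ((B : ZMod p)) < orderOf ((A : ZMod p))}.Infinite := by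
  lift A to ℕ using by omega with a
  simp only [Int.toNat_natCast] at hJ
  have ha : 1 < a := by exact_mod_cast hA
  have haodd : Odd a := by exact_mod_cast hAodd
  have : NeZero a := ⟨by omega⟩
  have hgcd : (1 - B).gcd a = 1 := by
    by_contra h
    rw [jacobiSym.mul_left, jacobiSym.eq_zero_iff_not_coprime.mpr h, mul_zero] at hJ
    norm_num at hJ
  have hsq : J(1 - B | a) ^ 2 = 1 := jacobiSym.sq_one hgcd
  refine Set.infinite_of_forall_exists_gt fun n => ?_
  set P : ℕ := ∏ r ∈ (Finset.range (n + 1)).filter (fun r => r.Coprime a), r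
  obtain ⟨c, hc⟩ : ∃ c : ℕ, B - 1 = c := ⟨(B - 1).toNat, by omega⟩
  have hca : c.Coprime a := by
    rwa [show 1 - B = -(c : ℤ) by omega, Int.neg_gcd, Int.gcd_natCast_natCast] at hgcd
  have hPa : P.Coprime a := Nat.Coprime.prod_left fun r hr => (Finset.mem_filter.mp hr).2
  have h4a : Nat.Coprime 4 a :=
    Nat.Coprime.pow_left 2 ((Nat.coprime_two_left).mpr haodd)
  set m := c * (4 * P) with hm
  have hma : m.Coprime a := hca.mul_left (h4a.mul_left hPa)
  have hm0 : 0 < m := Nat.pos_of_ne_zero fun h => by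
    rw [h, Nat.coprime_zero_left] at hma
    omega
  set k := m.totient
  have hk0 : 0 < k := Nat.totient_pos.mpr hm0
  have hmod : a ^ (2 * k) ≡ 1 [MOD m] := by
    rw [mul_comm, pow_mul]
    simpa using (Nat.ModEq.pow_totient hma.symm).pow 2
  have hgt : 1 < a ^ (2 * k) := Nat.one_lt_pow (by omega) ha
  obtain ⟨t, ht⟩ := (Nat.modEq_iff_dvd' hgt.le).mp hmod.symm
  have hs : 0 < P * t := Nat.pos_of_ne_zero fun h => by
    have : m * t = 0 := by rw [hm, mul_assoc, mul_assoc, h]; simp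
    omega
  obtain ⟨q, hq⟩ : ∃ q, q + 1 = 4 * (P * t) := ⟨4 * (P * t) - 1, by omega⟩
  have hpow : (a : ℤ) ^ (2 * k) - B = -q * (1 - B) := by
    have h1 : a ^ (2 * k) = c * (q + 1) + 1 := by
      rw [hq, show c * (4 * (P * t)) = m * t by rw [hm]; ring]
      omega
    have h2 : (a : ℤ) ^ (2 * k) = c * (q + 1) + 1 := by exact_mod_cast h1
    rw [h2, ← hc]
    ring
  have hJq : J(a | q) = -1 := by
    rw [jacobiSym_eq_neg_of_three_mod_four haodd (by omega), ← hJ, jacobiSym.mul_left (-B),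
      jacobiSym.mod_left' (a₁ := -B) (a₂ := -q * (1 - B)), jacobiSym.mul_left, mul_assoc, ← sq,
      hsq, mul_one]
    rw [← hpow]
    refine Int.ModEq.symm ((Int.modEq_iff_dvd).mpr ?_)
    rw [show -B - ((a : ℤ) ^ (2 * k) - B) = -(a : ℤ) ^ (2 * k) by ring]
    exact (dvd_pow_self _ (by omega)).neg_right
  obtain ⟨p, hp, hpq, hJp⟩ := jacobiSym.eq_neg_one_at_prime_divisor_of_eq_neg_one hJq
  have := Fact.mk hp
  have hnsq : ¬ IsSquare ((a : ℤ) : ZMod p) :=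
    ZMod.nonsquare_iff_jacobiSym_eq_neg_one.mp hJp
  have ha0 : ((a : ℤ) : ZMod p) ≠ 0 := fun h => hnsq (h ▸ IsSquare.zero)
  have hBpow : (B : ZMod p) = ((a : ℤ) : ZMod p) ^ (2 * k) := by
    have hq0 : (q : ZMod p) = 0 := (ZMod.natCast_eq_zero_iff q p).mpr hpq
    have := congrArg (Int.cast : ℤ → ZMod p) hpow
    push_cast at this ⊢
    rw [hq0] at this
    linear_combination -this
  refine ⟨p, ⟨hp, ?_, ?_⟩, ?_⟩
  · rw [← ZMod.intCast_zmod_eq_zero_iff_dvd, Int.cast_mul, hBpow]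
    exact mul_ne_zero ha0 (pow_ne_zero _ ha0)
  · rw [hBpow]
    exact orderOf_even_pow_lt_of_not_isSquare hnsq k
  · by_contra! hle
    have hpa : p.Coprime a := by
      refine (Nat.Prime.coprime_iff_not_dvd hp).mpr fun h => ha0 ?_
      exact_mod_cast (ZMod.natCast_eq_zero_iff a p).mpr h
    have hpP : p ∣ P := Finset.dvd_prod_of_mem _
      (Finset.mem_filter.mpr ⟨Finset.mem_range.mpr (by omega), hpa⟩)
    have : p ∣ q + 1 := hq ▸ (hpP.mul_right t).mul_left 4
    exact hp.one_lt.ne' (Nat.dvd_one.mp ((Nat.dvd_add_right hpq).mp this))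
end

section
/- Let A and B be odd integers with A > 1 and B > 1. If the Jacobi symbol ((1-B) / A) equals -1, then there are infinitely many primes p, not dividing A·B, such that the multiplicative order of A modulo p is strictly greater than the multiplicative order of B modulo p. -/
/-- In a finite commutative group, the inverse of an even power of a nonsquare `a` has smaller
order than `a`. -/
theorem orderOf_lt_of_mul_pow_two_mul_eq_one {G : Type*} [CommGroup G] [Finite G] {a b : G}
    (ha : ¬ IsSquare a) {k : ℕ} (h : b * a ^ (2 * k) = 1) : orderOf b < orderOf a := by
  have hpos : 0 < orderOf a := orderOf_pos a
  obtain ⟨c, hc⟩ | ⟨c, hc⟩ := Nat.even_or_odd (orderOf a)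
  · have hb : b ^ c = 1 := by
      rw [eq_inv_of_mul_eq_one_left h, inv_pow, ← pow_mul, inv_eq_one,
        show 2 * k * c = orderOf a * k by rw [hc]; ring, pow_mul, pow_orderOf_eq_one, one_pow]
    have hle : orderOf b ≤ c := orderOf_le_of_pow_eq_one (by omega) hb
    omega
  · refine absurd ⟨a ^ (c + 1), ?_⟩ ha
    rw [← pow_add, show c + 1 + (c + 1) = orderOf a + 1 by omega, pow_succ, pow_orderOf_eq_one,
      one_mul]

/-- The version of `orderOf_lt_of_mul_pow_two_mul_eq_one` for integers modulo a prime. -/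
theorem orderOf_intCast_zmod_lt {p : ℕ} [Fact p.Prime] {A B : ℤ} (hA : jacobiSym A p = -1)
    {k : ℕ} (h : (p : ℤ) ∣ B * A ^ (2 * k) - 1) :
    orderOf (B : ZMod p) < orderOf (A : ZMod p) := by
  have hns : ¬ IsSquare (A : ZMod p) := ZMod.nonsquare_of_jacobiSym_eq_neg_one hA
  have hmul : (B : ZMod p) * (A : ZMod p) ^ (2 * k) = 1 := by
    have := (ZMod.intCast_zmod_eq_zero_iff_dvd _ p).2 h
    push_cast at this
    exact sub_eq_zero.1 this
  have hA0 : (A : ZMod p) ≠ 0 := fun h0 => hns (h0 ▸ IsSquare.zero)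
  have hB0 : (B : ZMod p) ≠ 0 := by
    intro h0
    simp [h0] at hmul
  have key := orderOf_lt_of_mul_pow_two_mul_eq_one (a := Units.mk0 _ hA0) (b := Units.mk0 _ hB0)
    (k := k) ?_ (Units.ext (by simpa using hmul))
  · rwa [← orderOf_units, ← orderOf_units] at key
  · rintro ⟨c, hc⟩
    exact hns ⟨c, by simpa using congrArg Units.val hc⟩

/-- Theorem 1.1(i), second case: if `A, B` are odd integers exceeding 1 and the Jacobi
symbol `((1-B) / A)` is `-1`, then there are infinitely many primes `p` (not dividing
`A*B`) with `ord_p(A) > ord_p(B)`. -/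
theorem order_dominant_of_jacobi_one_sub_neg_one
    (A B : ℤ) (hAodd : Odd A) (hBodd : Odd B) (hA : 1 < A) (hB : 1 < B)
    (hJ : jacobiSym (1 - B) A.toNat = -1) :
    {p : ℕ | p.Prime ∧ ¬ (p : ℤ) ∣ A * B ∧
      orderOf ((B : ZMod p)) < orderOf ((A : ZMod p))}.Infinite := by
  intro hfin
  lift A to ℕ using by omega
  lift B to ℕ using by omega
  rw [Int.toNat_natCast] at hJ
  have hA' : Odd A := by exact_mod_cast hAodd
  have hA1 : 1 < A := by exact_mod_cast hA
  have hB1 : 1 < B := by exact_mod_cast hB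
  set P := ∏ p ∈ hfin.toFinset, p with hP
  set M := 8 * (B - 1) * P with hM
  have hcop : A.Coprime M := by
    refine Nat.Coprime.mul_right (Nat.Coprime.mul_right ?_ ?_) ?_
    · exact Nat.Coprime.pow_right 3 (Nat.coprime_two_right.2 hA')
    · have : NeZero A := ⟨by omega⟩
      have hg : (1 - (B : ℤ)).gcd A = 1 := by
        by_contra hg
        rw [jacobiSym.eq_zero_iff_not_coprime.2 hg] at hJ
        omega
      rw [Int.gcd_eq_natAbs, Int.natAbs_natCast, show (1 - (B : ℤ)).natAbs = B - 1 by omega] at hg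
      exact Nat.Coprime.symm hg
    · refine Nat.Coprime.prod_right fun p hp => ?_
      obtain ⟨hp1, hp2, -⟩ := hfin.mem_toFinset.1 hp
      refine ((Nat.Prime.coprime_iff_not_dvd hp1).2 fun hd => hp2 ?_).symm
      exact (Int.natCast_dvd_natCast.2 hd).mul_right _
  obtain ⟨t, ht⟩ : ∃ t, A ^ (2 * M.totient) = 1 + M * t := by
    have h1 : 1 ≡ A ^ (2 * M.totient) [MOD M] := by
      rw [mul_comm, pow_mul]
      simpa using ((Nat.ModEq.pow_totient hcop).pow 2).symm
    obtain ⟨t, ht⟩ := (Nat.modEq_iff_dvd' (Nat.one_le_pow _ _ (by omega))).1 h1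
    have : 1 ≤ A ^ (2 * M.totient) := Nat.one_le_pow _ _ (by omega)
    exact ⟨t, by omega⟩
  set N := 1 + 8 * B * P * t with hN
  have hfac : ((B : ℤ) - 1) * N = B * (A : ℤ) ^ (2 * M.totient) - 1 := by
    have ht' : (A : ℤ) ^ (2 * M.totient) = 1 + M * t := by exact_mod_cast ht
    rw [ht', hN, hM]
    push_cast [Nat.cast_sub hB1.le]
    ring
  have hMpos : M.totient ≠ 0 := by
    intro h0
    rw [Nat.totient_eq_zero] at h0
    rw [h0] at hcop
    simp at hcop
    omega
  have hNA : jacobiSym N A = -1 := by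
    have h1 : jacobiSym ((1 - B) * N) A = 1 := by
      rw [show (1 - (B : ℤ)) * N = 1 - B * (A : ℤ) ^ (2 * M.totient) by linear_combination -hfac,
        jacobiSym.mod_left, Int.sub_emod, Int.emod_eq_zero_of_dvd
          ((dvd_pow_self (A : ℤ) (by omega)).mul_left B), sub_zero, Int.emod_emod,
        ← jacobiSym.mod_left, jacobiSym.one_left]
    rw [jacobiSym.mul_left, hJ] at h1
    linarith
  have hAN : jacobiSym A N = -1 := by
    rw [← hNA]
    refine (jacobiSym.quadratic_reciprocity_one_mod_four ?_ hA').symm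
    rw [hN, show 8 * B * P * t = 4 * (2 * B * P * t) by ring]
    omega
  obtain ⟨p, hp, hpN, hAp⟩ := jacobiSym.eq_neg_one_at_prime_divisor_of_eq_neg_one hAN
  have : Fact p.Prime := ⟨hp⟩
  have hnot : ∀ x, x ∣ 8 * B * P * t → ¬ p ∣ x := fun x hx hpx =>
    hp.one_lt.ne' (Nat.dvd_one.1 ((Nat.dvd_add_left (hpx.trans hx)).1 hpN))
  have hpA : ¬ p ∣ A := by
    intro hd
    have hns : ¬ IsSquare ((A : ℤ) : ZMod p) := ZMod.nonsquare_of_jacobiSym_eq_neg_one hAp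
    rw [Int.cast_natCast, (ZMod.natCast_eq_zero_iff A p).2 hd] at hns
    exact hns IsSquare.zero
  have hpB : ¬ p ∣ B := hnot B ⟨8 * P * t, by ring⟩
  refine hnot p (Dvd.dvd.trans (Finset.dvd_prod_of_mem (fun p => p) (hfin.mem_toFinset.2 ?_))
    ⟨8 * B * t, by rw [hP]; ring⟩) dvd_rfl
  refine ⟨hp, ?_, orderOf_intCast_zmod_lt hAp (k := M.totient) ?_⟩
  · exact_mod_cast fun h => (hp.dvd_mul.1 h).elim hpA hpB
  · rw [← hfac]
    exact (Int.natCast_dvd_natCast.2 hpN).mul_left _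
end

section
/- For every odd positive integer B there are infinitely many odd primes p not dividing B such that the multiplicative order of 2 modulo p is strictly greater than the multiplicative order of B modulo p. -/
/-- If `2` is not a square modulo `p`, then every even power of `2` has smaller order than `2`. -/
lemma orderOf_four_pow_lt_orderOf_two {p : ℕ} [Fact p.Prime]
    (h : ¬ IsSquare (2 : ZMod p)) (m : ℕ) :
    orderOf ((4 : ZMod p) ^ m) < orderOf (2 : ZMod p) := by
  have h2 : (2 : ZMod p) ≠ 0 := fun h0 => h (h0 ▸ IsSquare.zero)
  have hpos : 0 < orderOf (2 : ZMod p) :=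
    orderOf_pos_iff.2 <| isOfFinOrder_iff_pow_eq_one.2
      ⟨p - 1, by have := (Fact.out : p.Prime).two_le; omega, ZMod.pow_card_sub_one_eq_one h2⟩
  have heven : Even (orderOf (2 : ZMod p)) := by
    by_contra hodd
    obtain ⟨k, hk⟩ := Nat.not_even_iff_odd.1 hodd
    refine h ⟨2 ^ (k + 1), ?_⟩
    have := pow_orderOf_eq_one (2 : ZMod p)
    rw [hk] at this
    linear_combination (-2 : ZMod p) * this
  obtain ⟨k, hk⟩ := heven
  have hdvd : orderOf ((4 : ZMod p) ^ m) ∣ k := by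
    apply orderOf_dvd_of_pow_eq_one
    have h4 : (4 : ZMod p) ^ k = 1 := by
      rw [show (4 : ZMod p) = 2 ^ 2 by norm_num, ← pow_mul, two_mul, ← hk, pow_orderOf_eq_one]
    rw [← pow_mul, mul_comm, pow_mul, h4, one_pow]
  have := Nat.le_of_dvd (by omega) hdvd
  omega

/-- An integer congruent to `5` modulo `8` has an odd prime factor modulo which `2` is not a
square. -/
lemma exists_prime_dvd_not_isSquare_two {u : ℤ} (hu : u % 8 = 5) :
    ∃ p : ℕ, p.Prime ∧ p ≠ 2 ∧ (p : ℤ) ∣ u ∧ ¬ IsSquare (2 : ZMod p) := by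
  have hodd : Odd u.natAbs := by rw [Nat.odd_iff]; omega
  have hJ : jacobiSym 2 u.natAbs = -1 := by
    rw [jacobiSym.at_two hodd, ZMod.χ₈_nat_mod_eight]
    have : u.natAbs % 8 = 3 ∨ u.natAbs % 8 = 5 := by omega
    rcases this with h | h <;> rw [h] <;> decide
  obtain ⟨p, hp, hpu, hpJ⟩ := jacobiSym.eq_neg_one_at_prime_divisor_of_eq_neg_one hJ
  refine ⟨p, hp, ?_, Int.natCast_dvd.2 hpu, ?_⟩
  · rintro rfl
    rw [Nat.odd_iff] at hodd
    omega
  · simpa using ZMod.nonsquare_of_jacobiSym_eq_neg_one hpJ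

/-- Theorem 1.1(ii): for every odd positive integer `B`, there are infinitely many odd
primes `p` not dividing `B` with `ord_p(2) > ord_p(B)`. -/
theorem order_dominant_two_B (B : ℕ) (hBodd : Odd B) (hBpos : 0 < B) :
    {p : ℕ | p.Prime ∧ p ≠ 2 ∧ ¬ p ∣ B ∧
      orderOf ((B : ZMod p)) < orderOf ((2 : ZMod p))}.Infinite := by
  refine Set.infinite_of_forall_exists_gt fun n => ?_
  obtain ⟨k, Q, hQ, hnQ⟩ := Nat.exists_eq_two_pow_mul_odd n.factorial_ne_zero
  set D : ℕ := (4 - B : ℤ).natAbs * Q with hD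
  have hDodd : Odd D := by
    refine Nat.odd_mul.2 ⟨?_, hQ⟩
    rw [Nat.odd_iff] at hBodd ⊢
    omega
  set t := D.totient with ht
  have htpos : 0 < t := Nat.totient_pos.2 hDodd.pos
  have hcop : Nat.Coprime 4 D := (Nat.coprime_two_left.2 hDodd).pow_left 2
  have hdvd : ((4 - B : ℤ) * Q) ∣ 4 ^ t - 1 := by
    have h := (Nat.modEq_iff_dvd.1 (Nat.ModEq.pow_totient hcop).symm)
    rw [← Int.natAbs_dvd, Int.natAbs_mul, Int.natAbs_natCast, ← hD]
    simpa using h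
  obtain ⟨z, hz⟩ := hdvd
  -- The cofactor of `4 - B` in `4 ^ (t + 1) - B`.
  have hu : (1 + 4 * (Q * z) : ℤ) % 8 = 5 := by
    have hodd : Odd ((4 - B : ℤ) * (Q * z)) := by
      rw [← mul_assoc, ← hz]
      exact (Even.pow_of_ne_zero (by decide) htpos.ne').sub_odd odd_one
    have := Int.odd_iff.1 (Int.odd_mul.1 hodd).2
    omega
  obtain ⟨p, hp, hp2, hpu, hsq⟩ := exists_prime_dvd_not_isSquare_two hu
  have := Fact.mk hp
  have hB : (B : ZMod p) = 4 ^ (t + 1) := by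
    have h : (p : ℤ) ∣ 4 ^ (t + 1) - B := by
      refine hpu.trans ⟨4 - B, ?_⟩
      linear_combination 4 * hz
    have := (ZMod.intCast_zmod_eq_zero_iff_dvd _ p).2 h
    push_cast at this
    exact (sub_eq_zero.1 this).symm
  refine ⟨p, ⟨hp, hp2, fun hpB => ?_, ?_⟩, ?_⟩
  · rw [(ZMod.natCast_eq_zero_iff B p).2 hpB, show (4 : ZMod p) = 2 * 2 by norm_num] at hB
    have h4 := eq_zero_of_pow_eq_zero hB.symm
    exact hsq (by rw [mul_self_eq_zero.1 h4]; exact IsSquare.zero)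
  · rw [hB]
    exact orderOf_four_pow_lt_orderOf_two hsq _
  · by_contra! hpn
    have hpQ : p ∣ Q := by
      have h := (hp.dvd_factorial).2 hpn
      rw [hnQ] at h
      refine (hp.dvd_mul.1 h).resolve_left fun h2 => hp2 ?_
      exact (Nat.prime_dvd_prime_iff_eq hp Nat.prime_two).1 (hp.dvd_of_dvd_pow h2)
    have h1 : (p : ℤ) ∣ 1 := by
      refine (Int.dvd_add_left ?_).1 hpu
      exact (((Int.natCast_dvd_natCast.2 hpQ).mul_right z).mul_left 4)
    exact hp.one_lt.ne' (by exact_mod_cast Int.eq_one_of_dvd_one (by positivity) h1)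
end

section
/- For every odd positive integer A with A ≢ 1 (mod 8), there are infinitely many odd primes p not dividing A such that the multiplicative order of A modulo p is strictly greater than the multiplicative order of 2 modulo p. -/
open scoped NumberTheorySymbols in
/-- If `A` is a quadratic nonresidue modulo the prime `p` and `2 * A ^ (2 * k) = 1` or `A ^ (2 * k) = 2`,
then the order of `2` is at most half the order of `A`. -/
theorem orderOf_two_lt_of_jacobiSym_eq_neg_one {A p k : ℕ} [Fact p.Prime]
    (hA : J(A | p) = -1)
    (h : 2 * (A : ZMod p) ^ (2 * k) = 1 ∨ (A : ZMod p) ^ (2 * k) = 2) :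
    orderOf (2 : ZMod p) < orderOf (A : ZMod p) := by
  have hsq : ¬ IsSquare (A : ZMod p) := by
    simpa using ZMod.nonsquare_of_jacobiSym_eq_neg_one hA
  have hA0 : (A : ZMod p) ≠ 0 := fun h0 => hsq (h0 ▸ IsSquare.zero)
  have hpos : 0 < orderOf (A : ZMod p) :=
    orderOf_pos_iff.mpr <| isOfFinOrder_iff_pow_eq_one.mpr
      ⟨p - 1, Nat.sub_pos_of_lt (Fact.out : p.Prime).one_lt, ZMod.pow_card_sub_one_eq_one hA0⟩
  have heven : Even (orderOf (A : ZMod p)) := by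
    by_contra hodd
    obtain ⟨m, hm⟩ := Nat.not_even_iff_odd.mp hodd
    refine hsq ⟨(A : ZMod p) ^ (m + 1), ?_⟩
    calc (A : ZMod p) = A ^ orderOf (A : ZMod p) * A := by rw [pow_orderOf_eq_one, one_mul]
      _ = A ^ (m + 1) * A ^ (m + 1) := by rw [hm]; ring
  obtain ⟨m, hm⟩ := heven
  have hpow : ((A : ZMod p) ^ (2 * k)) ^ m = 1 := by
    rw [← pow_mul, show 2 * k * m = (m + m) * k by ring, ← hm, pow_mul, pow_orderOf_eq_one,
      one_pow]
  have htwo : (2 : ZMod p) ^ m = 1 := by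
    rcases h with h | h
    · rw [← mul_one ((2 : ZMod p) ^ m), ← hpow, ← mul_pow, h, one_pow, hpow]
    · rw [← h, hpow]
  have := orderOf_le_of_pow_eq_one (by lia) htwo
  lia

open scoped NumberTheorySymbols in
theorem jacobiSym_two_mul_pow_sub_one {A k : ℕ} (hA : A % 4 = 3) (hk : k ≠ 0) :
    J(A | 2 * A ^ (2 * k) - 1) = -1 := by
  have hodd : Odd A := Nat.odd_iff.mpr (by lia)
  have hpos : 1 ≤ 2 * A ^ (2 * k) := by
    have : 0 < A ^ (2 * k) := pow_pos (by lia) _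
    lia
  have hmod : (2 * A ^ (2 * k) - 1) % 4 = 1 := by
    have : Odd (A ^ (2 * k)) := hodd.pow
    obtain ⟨m, hm⟩ := this
    lia
  rw [jacobiSym.quadratic_reciprocity_one_mod_four' hodd hmod]
  have hneg : J((2 * A ^ (2 * k) - 1 : ℕ) | A) = J(-1 | A) := by
    apply jacobiSym.mod_left'
    apply Int.ModEq.symm
    rw [Int.modEq_iff_dvd, Nat.cast_sub hpos]
    push_cast
    rw [sub_neg_eq_add, sub_add_cancel]
    exact (dvd_pow_self _ (by lia)).mul_left _
  rw [hneg, jacobiSym.at_neg_one hodd, ZMod.χ₄_nat_three_mod_four hA]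

open scoped NumberTheorySymbols in
theorem jacobiSym_pow_sub_two {A k : ℕ} (hA : A % 8 = 5) (hk : k ≠ 0) :
    J(A | A ^ (2 * k) - 2) = -1 := by
  have hodd : Odd A := Nat.odd_iff.mpr (by lia)
  have hle : 2 ≤ A ^ (2 * k) :=
    le_trans (by lia : 2 ≤ A) (Nat.le_self_pow (by lia) A)
  have hN : Odd (A ^ (2 * k) - 2) := by
    have : Odd (A ^ (2 * k)) := hodd.pow
    rw [Nat.odd_iff] at this ⊢
    lia
  rw [jacobiSym.quadratic_reciprocity_one_mod_four (by lia) hN]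
  have hneg : J((A ^ (2 * k) - 2 : ℕ) | A) = J(-2 | A) := by
    apply jacobiSym.mod_left'
    apply Int.ModEq.symm
    rw [Int.modEq_iff_dvd, Nat.cast_sub hle]
    push_cast
    rw [sub_neg_eq_add, sub_add_cancel]
    exact dvd_pow_self _ (by lia)
  rw [hneg, jacobiSym.at_neg_two hodd, ZMod.χ₈'_nat_eq_if_mod_eight, hA]
  have : A % 2 = 1 := by lia
  simp [this]

open scoped NumberTheorySymbols in
theorem exists_prime_jacobiSym_eq_neg_one {A k : ℕ} (hAodd : Odd A)
    (hA8 : ¬ A ≡ 1 [MOD 8]) (hk : k ≠ 0) :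
    ∃ p : ℕ, p.Prime ∧ J(A | p) = -1 ∧
      (2 * (A : ZMod p) ^ (2 * k) = 1 ∨ (A : ZMod p) ^ (2 * k) = 2) := by
  have hcases : A % 4 = 3 ∨ A % 8 = 5 := by
    rw [Nat.odd_iff] at hAodd
    unfold Nat.ModEq at hA8
    lia
  rcases hcases with hA | hA
  · obtain ⟨p, hp, hdvd, hJ⟩ :=
      jacobiSym.eq_neg_one_at_prime_divisor_of_eq_neg_one (jacobiSym_two_mul_pow_sub_one hA hk)
    refine ⟨p, hp, hJ, Or.inl ?_⟩
    have hpos : 1 ≤ 2 * A ^ (2 * k) := by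
      have : 0 < A ^ (2 * k) := pow_pos (by lia) _
      lia
    rw [← ZMod.natCast_eq_zero_iff, Nat.cast_sub hpos] at hdvd
    push_cast at hdvd
    exact sub_eq_zero.mp hdvd
  · obtain ⟨p, hp, hdvd, hJ⟩ :=
      jacobiSym.eq_neg_one_at_prime_divisor_of_eq_neg_one (jacobiSym_pow_sub_two hA hk)
    refine ⟨p, hp, hJ, Or.inr ?_⟩
    have hle : 2 ≤ A ^ (2 * k) :=
      le_trans (by lia : 2 ≤ A) (Nat.le_self_pow (by lia) A)
    rw [← ZMod.natCast_eq_zero_iff, Nat.cast_sub hle] at hdvd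
    push_cast at hdvd
    exact sub_eq_zero.mp hdvd

/-- Theorem 1.1(iii): for every odd positive integer `A` with `A ≢ 1 (mod 8)`, there are
infinitely many odd primes `p` not dividing `A` with `ord_p(A) > ord_p(2)`. -/
theorem order_dominant_A_two (A : ℕ) (hAodd : Odd A) (hApos : 0 < A)
    (hA8 : ¬ A ≡ 1 [MOD 8]) :
    {p : ℕ | p.Prime ∧ p ≠ 2 ∧ ¬ p ∣ A ∧
      orderOf ((2 : ZMod p)) < orderOf ((A : ZMod p))}.Infinite := by
  intro hfin
  have hk : ∏ q ∈ hfin.toFinset, (q - 1) ≠ 0 := by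
    refine Finset.prod_ne_zero_iff.mpr fun q hq => ?_
    have := (hfin.mem_toFinset.mp hq).1.two_le
    lia
  obtain ⟨p, hp, hJ, h⟩ := exists_prime_jacobiSym_eq_neg_one hAodd hA8 hk
  have : Fact p.Prime := ⟨hp⟩
  have hsq : ¬ IsSquare (A : ZMod p) := by
    simpa using ZMod.nonsquare_of_jacobiSym_eq_neg_one hJ
  have hA0 : (A : ZMod p) ≠ 0 := fun h0 => hsq (h0 ▸ IsSquare.zero)
  have hp2 : p ≠ 2 := by
    rintro rfl
    exact hsq (FiniteField.isSquare_of_char_two (ZMod.ringChar_zmod_n 2) _)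
  have hmem : p ∈ hfin.toFinset := hfin.mem_toFinset.mpr
    ⟨hp, hp2, fun hdvd => hA0 ((ZMod.natCast_eq_zero_iff _ _).mpr hdvd),
      orderOf_two_lt_of_jacobiSym_eq_neg_one hJ h⟩
  have hpow : (A : ZMod p) ^ (2 * ∏ q ∈ hfin.toFinset, (q - 1)) = 1 := by
    obtain ⟨m, hm⟩ := (Finset.dvd_prod_of_mem (fun q => q - 1) hmem).mul_left 2
    rw [hm, pow_mul, ZMod.pow_card_sub_one_eq_one hA0, one_pow]
  have htwo : (2 : ZMod p) = 1 := by
    rcases h with h | h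
    · simpa [hpow] using h
    · rw [← h, hpow]
  exact one_ne_zero (α := ZMod p) (by linear_combination htwo)
end

section
/- Let A and B be coprime integers with A > 1 and B > A⁴. Then there are infinitely many primes p, not dividing A·B, such that the multiplicative order of -A modulo p is strictly greater than the multiplicative order of B modulo p. -/
open scoped NumberTheorySymbols in
/-- If `4 * a` divides `q + 1`, then `J(-a | q) = -1`. -/
theorem jacobiSym_neg_eq_neg_one_of_four_mul_dvd_succ {a q : ℕ} (ha : 0 < a)
    (h : 4 * a ∣ q + 1) : J(-(a : ℤ) | q) = -1 := by
  have aux : ∀ n : ℕ, n % (4 * a) = 4 * a - 1 → n % 4 = 3 := by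
    intro n hn
    rw [← Nat.mod_mul_right_mod n 4 a, hn]
    omega
  have hq : q % (4 * a) = 4 * a - 1 := by
    obtain ⟨k, hk⟩ := h
    obtain ⟨k, rfl⟩ : ∃ l, k = l + 1 := Nat.exists_eq_succ_of_ne_zero (by rintro rfl; simp at hk)
    have : q = (4 * a - 1) + 4 * a * k := by rw [mul_add] at hk; omega
    rw [this, Nat.add_mul_mod_self_left, Nat.mod_eq_of_lt (by omega)]
  have hq4 := aux q hq
  have hr4 := aux (4 * a - 1) (Nat.mod_eq_of_lt (by omega))
  have hqodd : Odd q := Nat.odd_iff.2 (by omega)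
  have hrodd : Odd (4 * a - 1) := Nat.odd_iff.2 (by omega)
  have hone : J(((4 * a : ℕ) : ℤ) | 4 * a - 1) = 1 := by
    rw [jacobiSym.mod_left' (a₂ := 1), jacobiSym.one_left]
    have : ((4 * a : ℕ) : ℤ) = 1 + ((4 * a - 1 : ℕ) : ℤ) := by omega
    rw [this]
    simp
  rw [jacobiSym.neg _ hqodd, ZMod.χ₄_nat_three_mod_four hq4, jacobiSym.mod_right' a hqodd, hq]
  push_cast at hone
  rw [jacobiSym.mul_left, jacobiSym.at_four hrodd, one_mul] at hone
  rw [hone]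
  rfl

open scoped NumberTheorySymbols in
/-- If `b > a ^ 4` and `a, b` are coprime, then for every `m` coprime to `a` some even power of `a`
is congruent to `b` modulo a prime not dividing `m` for which `-a` is a quadratic nonresidue. -/
theorem exists_prime_even_pow_eq_and_nonresidue {a b m : ℕ} (ha : 1 < a) (hb : a ^ 4 < b)
    (hab : a.Coprime b) (hm : 0 < m) (ham : a.Coprime m) :
    ∃ p : ℕ, p.Prime ∧ ¬ p ∣ m ∧ J(-(a : ℤ) | p) = -1 ∧
      ∃ j : ℕ, (a : ZMod p) ^ (2 * j) = (b : ZMod p) := by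
  obtain ⟨c, hc0, hac, h4⟩ : ∃ c : ℕ, 0 < c ∧ a.Coprime c ∧ 4 * a ∣ a ^ 4 * c := by
    rcases Nat.even_or_odd a with he | ho
    · refine ⟨1, one_pos, Nat.coprime_one_right a, ?_⟩
      obtain ⟨k, rfl⟩ := he
      exact ⟨2 * k ^ 3, by ring⟩
    · refine ⟨4, by norm_num, ?_, ⟨a ^ 3, by ring⟩⟩
      exact (Nat.coprime_two_right.2 ho).pow_right 2
  obtain ⟨d, rfl⟩ := Nat.exists_eq_add_of_lt hb
  set n := d + 1 with hn
  have had : a.Coprime n := by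
    rw [add_assoc] at hab
    rwa [show a ^ 4 + n = n + a * a ^ 3 by ring, Nat.coprime_add_mul_left_right] at hab
  have hcop : a.Coprime (n * m * c) := (had.mul_right ham).mul_right hac
  have hM : 0 < n * m * c := by positivity
  set f := (n * m * c).totient with hf
  have hf0 : 0 < f := Nat.totient_pos.2 hM
  have hpow : 1 < a ^ (2 * f) := Nat.one_lt_pow (by omega) ha
  have hmod : 1 ≡ a ^ (2 * f) [MOD n * m * c] := by
    have := (Nat.ModEq.pow_totient hcop).pow 2
    rw [← pow_mul, one_pow, mul_comm _ 2] at this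
    exact this.symm
  obtain ⟨t, ht⟩ := (Nat.modEq_iff_dvd' hpow.le).1 hmod
  have ht' : a ^ (2 * f) = n * m * c * t + 1 := by omega
  have ht0 : 0 < t := Nat.pos_of_ne_zero (by rintro rfl; simp at ht'; omega)
  obtain ⟨q, hq⟩ : ∃ q, a ^ 4 * c * m * t = q + 1 :=
    Nat.exists_eq_succ_of_ne_zero (by positivity)
  have hkey : a ^ (2 * (f + 2)) = n * q + (a ^ 4 + n) := by
    calc a ^ (2 * (f + 2)) = a ^ (2 * f) * a ^ 4 := by ring
      _ = n * (a ^ 4 * c * m * t) + a ^ 4 := by rw [ht']; ring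
      _ = n * q + (a ^ 4 + n) := by rw [hq]; ring
  have hJ : J(-(a : ℤ) | q) = -1 := by
    refine jacobiSym_neg_eq_neg_one_of_four_mul_dvd_succ (by omega) ?_
    rw [← hq, mul_assoc _ m t]
    exact h4.mul_right _
  obtain ⟨p, hp, hpq, hpJ⟩ := jacobiSym.eq_neg_one_at_prime_divisor_of_eq_neg_one hJ
  refine ⟨p, hp, fun hpm => hp.one_lt.ne' (Nat.dvd_one.1 ?_), hpJ, f + 2, ?_⟩
  · refine (Nat.dvd_add_right hpq).1 ?_
    rw [← hq]
    exact (hpm.mul_left _).mul_right _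
  · rw [← Nat.cast_pow, hkey, add_assoc, ← hn, Nat.cast_add, Nat.cast_mul,
      (ZMod.natCast_eq_zero_iff q p).2 hpq, mul_zero, zero_add]

/-- An even power of a nonsquare of finite order has strictly smaller order. -/
theorem orderOf_pow_two_mul_lt {G : Type*} [Monoid G] {g : G} (hg : ¬ IsSquare g)
    (hfin : IsOfFinOrder g) (j : ℕ) : orderOf (g ^ (2 * j)) < orderOf g := by
  have hpos := hfin.orderOf_pos
  rcases Nat.even_or_odd' (orderOf g) with ⟨c, hc | hc⟩
  · have : orderOf (g ^ (2 * j)) ≤ c := by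
      refine orderOf_le_of_pow_eq_one (by omega) ?_
      rw [← pow_mul, mul_right_comm, ← hc, pow_mul, pow_orderOf_eq_one, one_pow]
    omega
  · refine absurd ⟨g ^ (c + 1), ?_⟩ hg
    rw [← pow_add, show c + 1 + (c + 1) = (2 * c + 1) + 1 by ring, ← hc, pow_succ,
      pow_orderOf_eq_one, one_mul]

/-- Theorem 1.1(iv): if `A, B` are coprime integers with `A > 1` and `B > A^4`, then
there are infinitely many primes `p` (not dividing `A*B`) with `ord_p(-A) > ord_p(B)`. -/
theorem order_dominant_negA_B (A B : ℤ) (hcop : IsCoprime A B) (hA : 1 < A)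
    (hB : A ^ 4 < B) :
    {p : ℕ | p.Prime ∧ ¬ (p : ℤ) ∣ A * B ∧
      orderOf ((B : ZMod p)) < orderOf ((-A : ZMod p))}.Infinite := by
  lift A to ℕ using by omega with a
  lift B to ℕ using (by positivity : (0 : ℤ) ≤ (a : ℤ) ^ 4).trans hB.le with b
  norm_cast at hA hB
  rw [Nat.isCoprime_iff_coprime] at hcop
  intro hS
  obtain ⟨p, hp, hpm, hJ, j, hj⟩ :=
    exists_prime_even_pow_eq_and_nonresidue (m := ∏ p ∈ hS.toFinset, p) hA hB hcop
      (Finset.prod_pos fun p hp => (hS.mem_toFinset.1 hp).1.pos)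
      (Nat.Coprime.prod_right fun p hp => by
        obtain ⟨hp, hpd, -⟩ := hS.mem_toFinset.1 hp
        refine ((Nat.Prime.coprime_iff_not_dvd hp).2 fun h => hpd ?_).symm
        exact (Int.natCast_dvd_natCast.2 h).mul_right _)
  have := Fact.mk hp
  have hns : ¬ IsSquare (-(a : ZMod p)) := by
    simpa using ZMod.nonsquare_of_jacobiSym_eq_neg_one hJ
  have ha0 : (a : ZMod p) ≠ 0 := fun h => hns (by simp [h])
  have hb0 : (b : ZMod p) ≠ 0 := hj ▸ pow_ne_zero _ ha0
  refine hpm (Finset.dvd_prod_of_mem (fun p => p) (hS.mem_toFinset.2 ⟨hp, ?_, ?_⟩))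
  · rw [← ZMod.intCast_zmod_eq_zero_iff_dvd]
    simpa using ⟨ha0, hb0⟩
  · have hfin : IsOfFinOrder (-(a : ZMod p)) :=
      isOfFinOrder_iff_pow_eq_one.2
        ⟨p - 1, by have := hp.two_le; omega, ZMod.pow_card_sub_one_eq_one (neg_ne_zero.2 ha0)⟩
    have := orderOf_pow_two_mul_lt hns hfin j
    rw [(even_two_mul j).neg_pow, hj] at this
    simpa using this
end

section
/- The set of positive integers A for which there exist infinitely many primes p, not dividing 2A, with the multiplicative order of A modulo p strictly greater than the multiplicative order of 2 modulo p, has asymptotic (natural) density 1 in the positive integers; equivalently, the set of exceptional positive integers A has asymptotic density 0. -/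
section Arithmetic

open NumberTheorySymbols

theorem zmod_pow_eq_one_iff_dvd {A : ℕ} (hA : A ≠ 0) (m d : ℕ) :
    (A : ZMod m) ^ d = 1 ↔ m ∣ A ^ d - 1 := by
  rw [← ZMod.natCast_eq_zero_iff, Nat.cast_sub (Nat.one_le_pow _ _ (Nat.pos_of_ne_zero hA)),
    sub_eq_zero]
  push_cast
  rfl

theorem Nat.factorization_eq_of_modEq {p e m n : ℕ} (hp : p.Prime)
    (h : n ≡ m [MOD p ^ e]) (hn : ¬ p ^ e ∣ n) : n.factorization p = m.factorization p := by
  have hm : ¬ p ^ e ∣ m := fun hm => hn ((h.dvd_iff dvd_rfl).2 hm)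
  have hn0 : n ≠ 0 := by rintro rfl; simp at hn
  have hm0 : m ≠ 0 := by rintro rfl; simp at hm
  refine eq_of_forall_le_iff fun k => ?_
  rw [← hp.pow_dvd_iff_le_factorization hn0, ← hp.pow_dvd_iff_le_factorization hm0]
  rcases le_total k e with hk | hk
  · exact (h.of_dvd (pow_dvd_pow p hk)).dvd_iff dvd_rfl
  · exact iff_of_false (fun hd => hn ((pow_dvd_pow p hk).trans hd))
      (fun hd => hm ((pow_dvd_pow p hk).trans hd))

theorem jacobiSym_eq_factorization_prod (a : ℤ) {b : ℕ} (hb : b ≠ 0) :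
    J(a | b) = b.factorization.prod fun p k => J(a | p) ^ k := by
  induction b using Nat.recOnMul with
  | zero => exact absurd rfl hb
  | one => simp
  | prime p hp => simp [hp.factorization]
  | mul m n hm hn =>
    obtain ⟨hm0, hn0⟩ := mul_ne_zero_iff.1 hb
    rw [jacobiSym.mul_right' a hm0 hn0, hm hm0, hn hn0, Nat.factorization_mul hm0 hn0,
      Finsupp.prod_add_index' (by simp) (by simp [pow_add])]

section PrimitiveRoot

variable {A l : ℕ}

theorem ne_zero_of_orderOf_eq (hl : l.Prime) (hl2 : l ≠ 2)
    (hA : orderOf (A : ZMod (l ^ 2)) = l * (l - 1)) : A ≠ 0 := by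
  rintro rfl
  have h := hl.two_le
  have : (0 : ZMod (l ^ 2)) ^ (l * (l - 1)) = 1 := by
    rw [← hA, Nat.cast_zero]; exact pow_orderOf_eq_one _
  rw [zero_pow (Nat.mul_ne_zero (by lia) (by lia))] at this
  have : Fact (1 < l ^ 2) := ⟨by nlinarith⟩
  simp_all

theorem coprime_of_orderOf_eq (hl : l.Prime)
    (hA : orderOf (A : ZMod (l ^ 2)) = l * (l - 1)) : A.Coprime l := by
  have h := hl.two_le
  have h1 := pow_orderOf_eq_one (A : ZMod (l ^ 2))
  rw [hA] at h1
  have hu : IsUnit (A : ZMod (l ^ 2)) :=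
    IsUnit.of_pow_eq_one h1 (Nat.mul_ne_zero (by lia) (by lia))
  exact ((ZMod.isUnit_iff_coprime _ _).1 hu).coprime_dvd_right (dvd_pow_self _ two_ne_zero)

theorem factorization_pow_sub_one (hl : l.Prime) (hl2 : l ≠ 2)
    (hA : orderOf (A : ZMod (l ^ 2)) = l * (l - 1)) {m : ℕ} (hm : m ≠ 0) :
    (A ^ ((l - 1) * m) - 1).factorization l = m.factorization l + 1 := by
  have h2 := hl.two_le
  have hA0 := ne_zero_of_orderOf_eq hl hl2 hA
  have hc := coprime_of_orderOf_eq hl hA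
  have : Fact l.Prime := ⟨hl⟩
  have hd : l ∣ A ^ (l - 1) - 1 := by
    have := (Nat.modEq_iff_dvd' (Nat.one_le_pow _ _ (Nat.pos_of_ne_zero hA0))).1
      (Nat.ModEq.pow_totient hc).symm
    rwa [Nat.totient_prime hl] at this
  have hnd : ¬ l ^ 2 ∣ A ^ (l - 1) - 1 := by
    rw [← zmod_pow_eq_one_iff_dvd hA0, ← orderOf_dvd_iff_pow_eq_one, hA]
    intro h
    have := Nat.le_of_dvd (by lia) h
    have h1 : 1 ≤ l - 1 := by lia
    nlinarith
  have hgt : 1 < A ^ (l - 1) := by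
    by_contra h
    have : A ^ (l - 1) - 1 = 0 := by lia
    simp [this] at hnd
  have h1 : (A ^ (l - 1) - 1).factorization l = 1 := by
    have ha := (hl.pow_dvd_iff_le_factorization (k := 1) (n := A ^ (l - 1) - 1) (by lia)).1
      (by simpa using hd)
    have hb := mt (hl.pow_dvd_iff_le_factorization (k := 2) (n := A ^ (l - 1) - 1) (by lia)).2 hnd
    lia
  have := padicValNat.pow_sub_pow (p := l) (hl.odd_of_ne_two hl2) hgt hd
    (fun h => (Nat.Prime.coprime_iff_not_dvd hl).1 hc.symm (hl.dvd_of_dvd_pow h)) hm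
  rw [one_pow, ← pow_mul] at this
  rw [Nat.factorization_def _ hl, this, ← Nat.factorization_def _ hl, h1,
    Nat.factorization_def _ hl, add_comm]

theorem jacobiSym_eq_neg_one_of_orderOf_eq (hl : l.Prime) (hl2 : l ≠ 2)
    (hA : orderOf (A : ZMod (l ^ 2)) = l * (l - 1)) : J(A | l) = -1 := by
  have h2 := hl.two_le
  have hc := coprime_of_orderOf_eq hl hA
  have : Fact l.Prime := ⟨hl⟩
  refine (jacobiSym.eq_one_or_neg_one (by simpa using hc)).resolve_left fun h => ?_
  have hAl : (A : ZMod l) ≠ 0 := by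
    rw [Ne, ZMod.natCast_eq_zero_iff]
    exact (Nat.Prime.coprime_iff_not_dvd hl).1 hc.symm
  have hsq : IsSquare (A : ZMod l) := by simpa using ZMod.isSquare_of_jacobiSym_eq_one h
  have he := (ZMod.euler_criterion l hAl).1 hsq
  have hdvd : (l : ℤ) ∣ (A : ℤ) ^ (l / 2) - 1 := by
    rw [← ZMod.intCast_zmod_eq_zero_iff_dvd]
    simp [he]
  have := dvd_sub_pow_of_dvd_sub hdvd 1
  have h3 : (A : ZMod (l ^ 2)) ^ (l / 2 * l) = 1 := by
    have h4 := (ZMod.intCast_zmod_eq_zero_iff_dvd _ (l ^ 2)).2 (by simpa using this)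
    rw [pow_mul]
    simpa [sub_eq_zero] using h4
  have h5 := orderOf_dvd_of_pow_eq_one h3
  rw [hA] at h5
  have h6 := Nat.le_of_dvd (Nat.mul_pos (by lia) (by lia)) h5
  rw [mul_comm] at h6
  have := Nat.le_of_mul_le_mul_right h6 (by lia)
  have := hl.odd_of_ne_two hl2
  lia

theorem orderOf_zmod_pow (hl : l.Prime) (hl2 : l ≠ 2)
    (hA : orderOf (A : ZMod (l ^ 2)) = l * (l - 1)) (n : ℕ) :
    (l ^ (n + 2)).totient ∣ orderOf (A : ZMod (l ^ (n + 2))) := by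
  have h2 := hl.two_le
  have hA0 := ne_zero_of_orderOf_eq hl hl2 hA
  have hc := coprime_of_orderOf_eq hl hA
  set d := orderOf (A : ZMod (l ^ (n + 2))) with hd
  have hpow := pow_orderOf_eq_one (A : ZMod (l ^ (n + 2)))
  rw [← hd, zmod_pow_eq_one_iff_dvd hA0] at hpow
  have h1 : l * (l - 1) ∣ d := by
    rw [← hA, orderOf_dvd_iff_pow_eq_one, zmod_pow_eq_one_iff_dvd hA0]
    exact (pow_dvd_pow l (by lia)).trans hpow
  obtain ⟨e, he⟩ := (Dvd.intro_left _ rfl : l - 1 ∣ l * (l - 1)).trans h1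
  rw [Nat.totient_prime_pow_succ hl, he, mul_comm]
  refine Nat.mul_dvd_mul_left _ ?_
  rcases eq_or_ne e 0 with rfl | he0
  · simp
  have hf := factorization_pow_sub_one hl hl2 hA he0
  have hne : A ^ ((l - 1) * e) - 1 ≠ 0 := by
    intro h0
    simp [h0] at hf
  rw [he, hl.pow_dvd_iff_le_factorization hne, hf] at hpow
  rw [hl.pow_dvd_iff_le_factorization he0]
  lia

theorem exists_even_pow_modEq_two (hl : l.Prime) (hl8 : l % 8 = 7)
    (hA : orderOf (A : ZMod (l ^ 2)) = l * (l - 1)) (n : ℕ) :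
    ∃ x, Even x ∧ 4 ≤ x ∧ A ^ x ≡ 2 [MOD l ^ (n + 2)] := by
  have hl2 : l ≠ 2 := by rintro rfl; simp at hl8
  have : Fact l.Prime := ⟨hl⟩
  have h2 := hl.two_le
  have hc := coprime_of_orderOf_eq hl hA
  have : NeZero (l ^ (n + 2)) := ⟨pow_ne_zero _ hl.ne_zero⟩
  let u : (ZMod (l ^ (n + 2)))ˣ := ZMod.unitOfCoprime A (hc.pow_right _)
  let t : (ZMod (l ^ (n + 2)))ˣ := ZMod.unitOfCoprime 2
    (Nat.Coprime.pow_right _ ((Nat.coprime_primes Nat.prime_two hl).2 hl2.symm))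
  have hu : orderOf u = Nat.card (ZMod (l ^ (n + 2)))ˣ := by
    refine Nat.dvd_antisymm (orderOf_dvd_natCard u) ?_
    rw [Nat.card_eq_fintype_card, ZMod.card_units_eq_totient, ← orderOf_units,
      ZMod.coe_unitOfCoprime]
    exact orderOf_zmod_pow hl hl2 hA n
  have ht : t ∈ Submonoid.powers u := by
    rw [mem_powers_iff_mem_zpowers, (Subgroup.zpowers u).eq_top_of_card_eq (by
      rw [Nat.card_zpowers, hu])]
    trivial
  obtain ⟨y, hy⟩ := ht
  have hx : A ^ (y + orderOf u * 4) ≡ 2 [MOD l ^ (n + 2)] := by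
    rw [← ZMod.natCast_eq_natCast_iff]
    have : u ^ (y + orderOf u * 4) = t := by
      rw [pow_add u, pow_mul u, pow_orderOf_eq_one u, one_pow, mul_one]; exact hy
    simpa [u, t] using congrArg Units.val this
  refine ⟨y + orderOf u * 4, ?_, ?_, hx⟩
  · have hJ : J((A ^ (y + orderOf u * 4) : ℕ) | l) = J(2 | l) :=
      jacobiSym.mod_left' (by
        exact_mod_cast (hx.of_dvd (dvd_pow_self l (by lia))))
    have h1 : J(2 | l) = 1 := by
      rw [jacobiSym.at_two (Nat.odd_iff.2 (by lia)), ZMod.χ₈_nat_eq_if_mod_eight]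
      simp [hl8, show l % 2 = 1 by lia]
    rw [h1, Nat.cast_pow, jacobiSym.pow_left, jacobiSym_eq_neg_one_of_orderOf_eq hl hl2 hA] at hJ
    exact (neg_one_pow_eq_one_iff_even (by decide)).1 hJ
  · have := orderOf_pos u
    lia

end PrimitiveRoot

theorem orderOf_two_lt_of_pow_eq_two {p A x : ℕ} (hp : p.Prime) (hJ : J(A | p) = -1)
    (hx : Even x) (h : A ^ x ≡ 2 [MOD p]) :
    orderOf (2 : ZMod p) < orderOf (A : ZMod p) := by
  have : Fact p.Prime := ⟨hp⟩
  have hns := (ZMod.nonsquare_iff_jacobiSym_eq_neg_one (a := (A : ℤ)) (p := p)).1 hJ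
  rw [Int.cast_natCast] at hns
  have hA0 : (A : ZMod p) ≠ 0 := by
    intro h0
    simp [h0] at hns
  have hpos : 0 < orderOf (A : ZMod p) :=
    orderOf_pos_iff.2 (isOfFinOrder_iff_pow_eq_one.2 ⟨p - 1,
      by have := hp.two_le; lia, ZMod.pow_card_sub_one_eq_one hA0⟩)
  have heven : Even (orderOf (A : ZMod p)) := by
    by_contra ho
    obtain ⟨k, hk⟩ := Nat.not_even_iff_odd.1 ho
    apply hns
    refine ⟨(A : ZMod p) ^ (k + 1), ?_⟩
    rw [← pow_add, show k + 1 + (k + 1) = orderOf (A : ZMod p) + 1 by lia, pow_add,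
      pow_orderOf_eq_one]
    simp
  have h2 : (2 : ZMod p) = (A : ZMod p) ^ x := by
    have := (ZMod.natCast_eq_natCast_iff _ _ _).2 h
    exact_mod_cast this.symm
  obtain ⟨m, hm⟩ := heven
  obtain ⟨k, rfl⟩ := hx
  have hdvd : orderOf (2 : ZMod p) ∣ m := by
    rw [orderOf_dvd_iff_pow_eq_one, h2, ← pow_mul, show (k + k) * m = orderOf (A : ZMod p) * k by
      rw [hm]; ring, pow_mul, pow_orderOf_eq_one, one_pow]
  have := Nat.le_of_dvd (by lia) hdvd
  lia

/-- The odd part of `A ^ y - 2`, for `A ≥ 2` and `y ≥ 2`. -/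
def oddPowSubTwo (A y : ℕ) : ℕ := (A ^ y - 2) / Nat.gcd 2 A

theorem gcd_mul_oddPowSubTwo (A : ℕ) {y : ℕ} (hy : y ≠ 0) :
    Nat.gcd 2 A * oddPowSubTwo A y = A ^ y - 2 :=
  Nat.mul_div_cancel' (Nat.dvd_sub ((Nat.gcd_dvd_right 2 A).trans (dvd_pow_self A hy))
    (Nat.gcd_dvd_left 2 A))

theorem odd_oddPowSubTwo {A y : ℕ} (hA : 2 ≤ A) (hy : 2 ≤ y) : Odd (oddPowSubTwo A y) := by
  have h := gcd_mul_oddPowSubTwo A (y := y) (by lia)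
  have hle : 2 ^ 2 ≤ A ^ y := (Nat.pow_le_pow_left hA 2).trans (Nat.pow_le_pow_right (by lia) hy)
  rcases Nat.even_or_odd A with he | ho
  · rw [Nat.gcd_eq_left he.two_dvd] at h
    have : 2 ^ 2 ∣ A ^ y := (pow_dvd_pow_of_dvd he.two_dvd 2).trans (pow_dvd_pow A hy)
    rw [Nat.odd_iff]
    lia
  · rw [ho.coprime_two_left] at h
    have := ho.pow (n := y)
    rw [Nat.odd_iff] at this ⊢
    lia

theorem coprime_oddPowSubTwo {A y : ℕ} (hA : 2 ≤ A) (hy : 2 ≤ y) :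
    A.Coprime (oddPowSubTwo A y) := by
  refine Nat.coprime_of_dvd fun p hp hpA hpM => ?_
  have hle : 2 ^ 2 ≤ A ^ y := (Nat.pow_le_pow_left hA 2).trans (Nat.pow_le_pow_right (by lia) hy)
  have h1 : p ∣ A ^ y - 2 :=
    gcd_mul_oddPowSubTwo A (y := y) (by lia) ▸ Dvd.dvd.mul_left hpM _
  have h2 : p ∣ 2 := (Nat.dvd_sub_iff_right (by lia) (hpA.trans (dvd_pow_self A (by lia)))).1 h1
  rw [(Nat.prime_dvd_prime_iff_eq hp Nat.prime_two).1 h2] at hpM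
  exact Nat.not_even_iff_odd.2 (odd_oddPowSubTwo hA hy) (even_iff_two_dvd.2 hpM)

theorem oddPowSubTwo_ne_zero {A y : ℕ} (hA : 2 ≤ A) (hy : 2 ≤ y) : oddPowSubTwo A y ≠ 0 :=
  fun h => by simpa [h] using odd_oddPowSubTwo hA hy

theorem factorization_oddPowSubTwo {A y p : ℕ} (hA : 2 ≤ A) (hy : 2 ≤ y) (hp2 : p ≠ 2)
    (hp : p.Prime) :
    (oddPowSubTwo A y).factorization p = (A ^ y - 2).factorization p := by
  have hg : Nat.gcd 2 A ≠ 0 := by simp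
  rw [← gcd_mul_oddPowSubTwo A (y := y) (by lia),
    Nat.factorization_mul hg (oddPowSubTwo_ne_zero hA hy), Finsupp.add_apply,
    Nat.factorization_eq_zero_of_not_dvd (n := Nat.gcd 2 A), zero_add]
  exact fun h => hp2 ((Nat.prime_dvd_prime_iff_eq hp Nat.prime_two).1
    (h.trans (Nat.gcd_dvd_left 2 A)))

theorem jacobiSym_oddPowSubTwo_add {A x k : ℕ} (hA : 2 ≤ A) (hx : 4 ≤ x) (hk : Even k) :
    J(A | oddPowSubTwo A (x + k)) = J(A | oddPowSubTwo A x) := by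
  suffices h : oddPowSubTwo A (x + k) ≡ oddPowSubTwo A x [MOD 4 * A] by
    rw [jacobiSym.mod_right _ (odd_oddPowSubTwo hA (by lia)),
      jacobiSym.mod_right _ (odd_oddPowSubTwo hA (by lia : 2 ≤ x)), Int.natAbs_natCast, h]
  have hle : ∀ y, 2 ≤ y → 2 ≤ A ^ y := fun y hy => hA.trans (Nat.le_self_pow (by lia) A)
  have hpow : A ^ (x + k) ≡ A ^ x [MOD Nat.gcd 2 A * (4 * A)] := by
    rw [pow_add]
    rcases Nat.even_or_odd A with he | ho
    · have : Nat.gcd 2 A * (4 * A) ∣ A ^ x := by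
        rw [Nat.gcd_eq_left he.two_dvd]
        refine Dvd.dvd.trans ?_ (pow_dvd_pow A hx)
        obtain ⟨c, rfl⟩ := he.two_dvd
        exact ⟨c ^ 3, by ring⟩
      exact ((Nat.modEq_zero_iff_dvd.2 (this.mul_right _))).trans
        (Nat.modEq_zero_iff_dvd.2 this).symm
    · rw [ho.coprime_two_left, one_mul]
      refine (Nat.modEq_and_modEq_iff_modEq_mul ?_).1 ⟨?_, ?_⟩
      · exact Nat.Coprime.pow_left 2 ho.coprime_two_left
      · obtain ⟨j, rfl⟩ := hk
        have h1 : A ^ 2 ≡ 1 [MOD 4] := by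
          obtain ⟨i, rfl⟩ := ho
          refine ((Nat.modEq_iff_dvd' (Nat.one_le_pow _ _ (by lia))).2 ⟨i ^ 2 + i, ?_⟩).symm
          rw [Nat.sub_eq_iff_eq_add (Nat.one_le_pow _ _ (by lia))]
          ring
        have h2 := (h1.pow j).mul_left (A ^ x)
        rwa [← pow_mul, one_pow, mul_one, two_mul] at h2
      · have : A ∣ A ^ x := dvd_pow_self A (by lia)
        exact ((Nat.modEq_zero_iff_dvd.2 (this.mul_right _))).trans
          (Nat.modEq_zero_iff_dvd.2 this).symm
  refine Nat.ModEq.mul_left_cancel' (c := Nat.gcd 2 A) (by simp) ?_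
  rw [gcd_mul_oddPowSubTwo A (by lia), gcd_mul_oddPowSubTwo A (by lia)]
  refine Nat.ModEq.add_right_cancel' 2 ?_
  rwa [Nat.sub_add_cancel (hle _ (by lia)), Nat.sub_add_cancel (hle _ (by lia))]

theorem pow_add_sub_two {A x k : ℕ} (hA : 2 ≤ A) (hx : 2 ≤ x) :
    A ^ (x + k) - 2 = (A ^ x - 2) + A ^ x * (A ^ k - 1) := by
  have h1 : 2 ≤ A ^ x := hA.trans (Nat.le_self_pow (by lia) A)
  have h2 : 1 ≤ A ^ k := Nat.one_le_pow _ _ (by lia)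
  obtain ⟨c, hc⟩ := Nat.exists_eq_add_of_le h1
  obtain ⟨d, hd⟩ := Nat.exists_eq_add_of_le h2
  rw [pow_add, hc, hd, Nat.add_sub_cancel_left, Nat.add_sub_cancel_left]
  rw [Nat.sub_eq_iff_eq_add (by nlinarith)]
  ring

theorem infinite_orderOf_two_lt {A l : ℕ} (hl : l.Prime) (hl8 : l % 8 = 7)
    (hA : orderOf (A : ZMod (l ^ 2)) = l * (l - 1)) :
    {p : ℕ | p.Prime ∧ ¬ p ∣ 2 * A ∧ orderOf (2 : ZMod p) < orderOf (A : ZMod p)}.Infinite := by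
  intro hfin
  have hl2 : l ≠ 2 := by rintro rfl; simp at hl8
  have hl_two := hl.two_le
  have hA0 := ne_zero_of_orderOf_eq hl hl2 hA
  have hA2 : 2 ≤ A := by
    by_contra h
    obtain rfl : A = 1 := by lia
    rw [Nat.cast_one, orderOf_one] at hA
    exact hl.one_lt.ne' (Nat.dvd_one.1 (hA ▸ dvd_mul_right l (l - 1)))
  have hAl : A.Coprime l := coprime_of_orderOf_eq hl hA
  have hle : ∀ y, 2 ≤ y → 2 ≤ A ^ y := fun y hy => hA2.trans (Nat.le_self_pow (by lia) A)
  set T := hfin.toFinset with hT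
  have hTp : ∀ p ∈ T, p.Prime ∧ p ≠ 2 ∧ A.Coprime p := by
    intro p hp
    obtain ⟨h1, h2, -⟩ := hfin.mem_toFinset.1 hp
    refine ⟨h1, ?_, ?_⟩
    · rintro rfl
      exact h2 (dvd_mul_right _ _)
    · exact ((Nat.Prime.coprime_iff_not_dvd h1).2 fun h => h2 (h.mul_left 2)).symm
  have hmem : ∀ p x : ℕ, p.Prime → p ≠ 2 → J(A | p) = -1 → Even x → A ^ x ≡ 2 [MOD p] → p ∈ T := by
    intro p x hp hp2 hJ hx h
    refine hfin.mem_toFinset.2 ⟨hp, fun hd => ?_, orderOf_two_lt_of_pow_eq_two hp hJ hx h⟩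
    rcases hp.dvd_mul.1 hd with hd | hd
    · exact hp2 ((Nat.prime_dvd_prime_iff_eq hp Nat.prime_two).1 hd)
    · have : NeZero p := ⟨hp.ne_zero⟩
      have : J(A | p) = 0 := jacobiSym.eq_zero_iff_not_coprime.2 (by
        rw [Int.gcd_natCast_natCast]
        exact fun hc => (Nat.Prime.coprime_iff_not_dvd hp).1 (Nat.Coprime.symm hc) hd)
      rw [this] at hJ
      exact absurd hJ (by decide)
  set Q := 2 * ∏ p ∈ T, (p - 1) with hQ
  have hQ0 : Q ≠ 0 := mul_ne_zero two_ne_zero (Finset.prod_ne_zero_iff.2 fun p hp => by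
    have := (hTp p hp).1.two_le
    lia)
  set b := Q.factorization l with hb
  obtain ⟨x, hxe, hx4, hx⟩ := exists_even_pow_modEq_two hl hl8 hA (b + 1)
  set R := ∏ p ∈ T.erase l, p ^ (A ^ x) with hR
  have hR0 : R ≠ 0 := Finset.prod_ne_zero_iff.2 fun p hp =>
    pow_ne_zero _ (hTp p (Finset.mem_of_mem_erase hp)).1.ne_zero
  have hRl : R.factorization l = 0 := by
    refine Nat.factorization_eq_zero_of_not_dvd ?_
    rw [← Nat.Prime.coprime_iff_not_dvd hl]
    refine Nat.Coprime.prod_right fun p hp => Nat.Coprime.pow_right _ ?_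
    obtain ⟨hpl, hp⟩ := Finset.mem_erase.1 hp
    exact (Nat.coprime_primes hl (hTp p hp).1).2 hpl.symm
  have key_l : ∀ j, j ≠ 0 → j.factorization l ≤ 1 →
      (oddPowSubTwo A (x + (l - 1) * (Q * R * j))).factorization l
        = b + j.factorization l + 1 := by
    intro j hj hj1
    have hfac : (A ^ x * (A ^ ((l - 1) * (Q * R * j)) - 1)).factorization l
        = b + j.factorization l + 1 := by
      have h1 := factorization_pow_sub_one hl hl2 hA (mul_ne_zero (mul_ne_zero hQ0 hR0) hj)
      rw [Nat.factorization_mul (mul_ne_zero hQ0 hR0) hj, Nat.factorization_mul hQ0 hR0] at h1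
      simp only [Finsupp.add_apply, hRl, ← hb, add_zero] at h1
      have h2 : A ^ ((l - 1) * (Q * R * j)) - 1 ≠ 0 := by
        intro h0
        simp [h0] at h1
      rw [Nat.factorization_mul (pow_ne_zero _ hA0) h2, Finsupp.add_apply, h1,
        Nat.factorization_eq_zero_of_not_dvd, zero_add]
      exact fun h => (Nat.Prime.coprime_iff_not_dvd hl).1 hAl.symm (hl.dvd_of_dvd_pow h)
    rw [factorization_oddPowSubTwo hA2 (by lia) hl2 hl, ← hfac]
    symm
    refine Nat.factorization_eq_of_modEq (e := b + 3) hl ?_ ?_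
    · rw [pow_add_sub_two hA2 (by lia)]
      have := (Nat.modEq_iff_dvd' (hle x (by lia))).1 hx.symm
      simpa using (Nat.modEq_zero_iff_dvd.2 this).symm.add_right
        (A ^ x * (A ^ ((l - 1) * (Q * R * j)) - 1))
    · intro h
      have h0 : A ^ x * (A ^ ((l - 1) * (Q * R * j)) - 1) ≠ 0 := by
        intro h0
        simp [h0] at hfac
      have := (hl.pow_dvd_iff_le_factorization h0).1 h
      lia
  have key_T : ∀ j, ∀ p ∈ T, p ≠ l →
      (oddPowSubTwo A (x + (l - 1) * (Q * R * j))).factorization p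
        = (oddPowSubTwo A x).factorization p := by
    intro j p hp hpl
    obtain ⟨hpp, hp2, hpA⟩ := hTp p hp
    rw [factorization_oddPowSubTwo hA2 (by lia) hp2 hpp,
      factorization_oddPowSubTwo hA2 (by lia) hp2 hpp]
    symm
    refine Nat.factorization_eq_of_modEq (e := A ^ x + 1) hpp ?_ ?_
    · rw [pow_add_sub_two hA2 (by lia)]
      have htot : (p ^ (A ^ x + 1)).totient ∣ (l - 1) * (Q * R * j) := by
        rw [Nat.totient_prime_pow_succ hpp, mul_comm]
        refine Dvd.dvd.mul_left (Dvd.dvd.mul_right (mul_dvd_mul ?_ ?_) _) _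
        · exact (Finset.dvd_prod_of_mem (fun p => p - 1) hp).mul_left _
        · exact Finset.dvd_prod_of_mem (fun p => p ^ (A ^ x)) (Finset.mem_erase.2 ⟨hpl, hp⟩)
      obtain ⟨c, hc⟩ := htot
      have h1 : A ^ ((l - 1) * (Q * R * j)) ≡ 1 [MOD p ^ (A ^ x + 1)] := by
        rw [hc, pow_mul]
        simpa using (Nat.ModEq.pow_totient (hpA.pow_right (A ^ x + 1))).pow c
      have h2 := (Nat.modEq_iff_dvd' (Nat.one_le_pow _ _ (by lia))).1 h1.symm
      simpa using ((Nat.modEq_zero_iff_dvd.2 (h2.mul_left (A ^ x))).symm.add_left (A ^ x - 2))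
    · intro h
      have h3 : 2 < A ^ x := lt_of_lt_of_le (by lia : 2 < 2 ^ 2)
        ((Nat.pow_le_pow_left hA2 2).trans (Nat.pow_le_pow_right (by lia) (by lia)))
      have h1 := Nat.le_of_dvd (by lia) h
      have h2 := Nat.lt_pow_self hpp.one_lt (n := A ^ x + 1)
      lia
  have hJl : J(A | l) = -1 := jacobiSym_eq_neg_one_of_orderOf_eq hl hl2 hA
  have heven : ∀ j, Even ((l - 1) * (Q * R * j)) := fun j => by
    refine Even.mul_left (Even.mul_right (Even.mul_right ?_ _) _) _
    exact even_two.mul_right _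
  have hJp : ∀ j, ∀ p ∈ (oddPowSubTwo A (x + (l - 1) * (Q * R * j))).primeFactors,
      p ∉ T → J(A | p) = 1 := by
    intro j p hp hpT
    obtain ⟨hpp, hpd, -⟩ := Nat.mem_primeFactors.1 hp
    have hc : A.Coprime p := (coprime_oddPowSubTwo hA2 (by lia)).coprime_dvd_right hpd
    refine (jacobiSym.eq_one_or_neg_one (by simpa using hc)).resolve_right fun hJ => hpT ?_
    refine hmem p _ hpp ?_ hJ (hxe.add (heven j)) ?_
    · rintro rfl
      exact Nat.not_even_iff_odd.2 (odd_oddPowSubTwo hA2 (by lia)) (even_iff_two_dvd.2 hpd)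
    · refine ((Nat.modEq_iff_dvd' (hle _ (by lia))).2 ?_).symm
      rw [← gcd_mul_oddPowSubTwo A (by lia)]
      exact hpd.mul_left _
  set M₁ := oddPowSubTwo A (x + (l - 1) * (Q * R * 1)) with hM₁
  set M₂ := oddPowSubTwo A (x + (l - 1) * (Q * R * l)) with hM₂
  have hM₁0 : M₁ ≠ 0 := oddPowSubTwo_ne_zero hA2 (by lia)
  have hM₂0 : M₂ ≠ 0 := oddPowSubTwo_ne_zero hA2 (by lia)
  have hl₁ : M₁.factorization l = b + 1 := by
    rw [hM₁, key_l 1 one_ne_zero (by simp), Nat.factorization_one, Finsupp.zero_apply, add_zero]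
  have hl₂ : M₂.factorization l = b + 2 := by
    simpa [hl.factorization_self] using key_l l hl.ne_zero (by simp [hl.factorization_self])
  have hJ : J(A | M₁) = J(A | M₂) :=
    (jacobiSym_oddPowSubTwo_add hA2 hx4 (heven 1)).trans
      (jacobiSym_oddPowSubTwo_add hA2 hx4 (heven l)).symm
  have hJ₁ : J(A | M₁) ≠ 0 := jacobiSym.ne_zero (by
    simpa using coprime_oddPowSubTwo hA2 (by lia))
  set F := M₁.primeFactors ∪ M₂.primeFactors with hF
  have hlF : l ∈ F := by
    refine Finset.mem_union_left _ (Nat.mem_primeFactors.2 ⟨hl, ?_, hM₁0⟩)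
    exact Nat.dvd_of_factorization_pos (by lia)
  have e₁ : J(A | M₁) = ∏ p ∈ F, J(A | p) ^ M₁.factorization p := by
    rw [jacobiSym_eq_factorization_prod _ hM₁0]
    exact Finsupp.prod_of_support_subset _ (by simp [hF]) _ (by simp)
  have e₂ : J(A | M₂) = ∏ p ∈ F, J(A | p) ^ M₂.factorization p := by
    rw [jacobiSym_eq_factorization_prod _ hM₂0]
    exact Finsupp.prod_of_support_subset _ (by simp [hF]) _ (by simp)
  have e₃ : ∏ p ∈ F.erase l, J(A | p) ^ M₁.factorization p
      = ∏ p ∈ F.erase l, J(A | p) ^ M₂.factorization p := by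
    refine Finset.prod_congr rfl fun p hp => ?_
    obtain ⟨hpl, hpF⟩ := Finset.mem_erase.1 hp
    by_cases hpT : p ∈ T
    · rw [hM₁, hM₂, key_T 1 p hpT hpl, key_T l p hpT hpl]
    · have : J(A | p) = 1 := by
        rcases Finset.mem_union.1 hpF with h | h
        · exact hJp 1 p h hpT
        · exact hJp l p h hpT
      simp [this]
  rw [← Finset.mul_prod_erase _ _ hlF, hJl, hl₁] at e₁
  rw [← Finset.mul_prod_erase _ _ hlF, hJl, hl₂, ← e₃, pow_succ, mul_neg_one, neg_mul,
    ← e₁, ← hJ] at e₂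
  lia

end Arithmetic

theorem le_totient_sq_of_odd {m : ℕ} (hm : Odd m) : m ≤ m.totient ^ 2 := by
  induction m using Nat.recOnPosPrimePosCoprime with
  | zero => simp
  | one => simp
  | prime_pow p n hp hn =>
    have hp2 : p ≠ 2 := by
      rintro rfl
      exact Nat.not_even_iff_odd.2 hm (even_two.pow_of_ne_zero hn.ne')
    have h3 : 3 ≤ p := lt_of_le_of_ne hp.two_le hp2.symm
    obtain ⟨k, rfl⟩ := Nat.exists_eq_succ_of_ne_zero hn.ne'
    obtain ⟨q, rfl⟩ : ∃ q, p = q + 1 := ⟨p - 1, by lia⟩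
    rw [Nat.succ_eq_add_one, Nat.totient_prime_pow_succ hp, Nat.add_sub_cancel, mul_pow, pow_succ]
    refine Nat.mul_le_mul (Nat.le_self_pow two_ne_zero _) ?_
    nlinarith
  | coprime a b ha hb hab iha ihb =>
    rw [Nat.odd_mul] at hm
    rw [Nat.totient_mul hab, mul_pow]
    exact Nat.mul_le_mul (iha hm.1) (ihb hm.2)

theorem card_orderOf_eq_le {l : ℕ} [NeZero (l ^ 2)] (hl : l.Prime) (hl2 : l ≠ 2) :
    (l - 1) * (l - 1).totient ≤
      (Finset.univ.filter fun a : ZMod (l ^ 2) => orderOf a = l * (l - 1)).card := by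
  classical
  have := ZMod.isCyclic_units_of_prime_pow l hl hl2 2
  have hcard : Fintype.card (ZMod (l ^ 2))ˣ = l * (l - 1) := by
    rw [ZMod.card_units_eq_totient, Nat.totient_prime_pow_succ hl, pow_one]
  have hcop : l.Coprime (l - 1) := by
    have := hl.one_le
    exact (Nat.coprime_self_sub_right this).2 (Nat.coprime_one_right l)
  have h := IsCyclic.card_orderOf_eq_totient (α := (ZMod (l ^ 2))ˣ) (d := l * (l - 1))
    (by rw [hcard])
  rw [Nat.totient_mul hcop, Nat.totient_prime hl] at h
  rw [← h]
  refine Finset.card_le_card_of_injOn Units.val ?_ Units.val_injective.injOn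
  intro u hu
  simpa [orderOf_units] using hu

theorem card_range_filter_mem_le {L : Finset ℕ} (m : ℕ → ℕ) [∀ i, NeZero (m i)]
    (hm : (L : Set ℕ).Pairwise fun i j => (m i).Coprime (m j)) (S : ∀ i, Finset (ZMod (m i))) :
    ((Finset.range (∏ i ∈ L, m i)).filter fun n : ℕ => ∀ i ∈ L, (n : ZMod (m i)) ∈ S i).card
      ≤ ∏ i ∈ L, (S i).card := by
  classical
  rw [← Finset.card_pi]
  refine Finset.card_le_card_of_injOn (fun n i _ => (n : ZMod (m i))) ?_ ?_
  · intro n hn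
    simpa using (Finset.mem_filter.1 hn).2
  · intro n hn k hk h
    have h1 : ((∏ i ∈ L, m i : ℕ) : ℤ) ∣ (k : ℤ) - n := by
      rw [Nat.cast_prod]
      refine Finset.prod_dvd_of_coprime (fun i hi j hj hij => ?_) fun i hi => ?_
      · exact Nat.isCoprime_iff_coprime.2 (hm hi hj hij)
      · exact Nat.modEq_iff_dvd.1 ((ZMod.natCast_eq_natCast_iff _ _ _).1
          (congrFun (congrFun h i) hi))
    exact (Nat.modEq_iff_dvd.2 h1).eq_of_lt_of_lt
      (Finset.mem_range.1 (Finset.mem_filter.1 hn).1)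
      (Finset.mem_range.1 (Finset.mem_filter.1 hk).1)

theorem count_mul_of_periodic (p : ℕ → Prop) [DecidablePred p] {W : ℕ}
    (hp : Function.Periodic p W) (k : ℕ) : Nat.count p (W * k) = k * Nat.count p W := by
  induction k with
  | zero => simp
  | succ k ih =>
    have h : (fun i => p (W * k + i)) = p := by
      funext i
      rw [add_comm, mul_comm]
      simpa using hp.nat_mul k i
    rw [mul_add, mul_one, Nat.count_add, ih]
    simp only [h]
    ring

theorem log_div_le {l : ℕ} (hl8 : l % 8 = 7) :
    Real.log l / (8 * l) ≤ ((l - 1 : ℕ) * (l - 1).totient : ℕ) / (l ^ 2 : ℝ) := by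
  have h7 : 7 ≤ l := by lia
  have hl : (7 : ℝ) ≤ l := by exact_mod_cast h7
  have hodd : Odd ((l - 1) / 2) := by rw [Nat.odd_iff]; lia
  have htot : (l - 1).totient = ((l - 1) / 2).totient := by
    conv_lhs => rw [show l - 1 = 2 * ((l - 1) / 2) by lia]
    rw [Nat.totient_mul_of_prime_of_not_dvd Nat.prime_two (by lia)]
    simp
  have h1 : (l : ℝ) / 4 ≤ ((l - 1).totient : ℝ) ^ 2 := by
    have h2 := le_totient_sq_of_odd hodd
    rw [← htot] at h2
    have h3 : l ≤ 4 * (l - 1).totient ^ 2 := by lia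
    have h4 : (l : ℝ) ≤ 4 * ((l - 1).totient : ℝ) ^ 2 := by exact_mod_cast h3
    linarith
  have h2 : √(l : ℝ) ≤ 2 * (l - 1).totient := by
    rw [Real.sqrt_le_left (by positivity)]
    nlinarith
  have h3 : Real.log l ≤ 2 * √(l : ℝ) := by
    have h4 := Real.log_le_sub_one_of_pos (Real.sqrt_pos.2 (by linarith : (0 : ℝ) < l))
    rw [Real.log_sqrt (by linarith)] at h4
    linarith
  rw [div_le_div_iff₀ (by positivity) (by positivity), Nat.cast_mul, Nat.cast_sub (by lia),
    Nat.cast_one]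
  have h5 : Real.log l ≤ 4 * (l - 1).totient := by linarith
  calc Real.log l * (l : ℝ) ^ 2 ≤ 4 * ((l - 1).totient : ℝ) * (l : ℝ) ^ 2 := by gcongr
    _ = ((l : ℝ) / 2) * ((l - 1).totient : ℝ) * (8 * (l : ℝ)) := by ring
    _ ≤ ((l : ℝ) - 1) * ((l - 1).totient : ℝ) * (8 * (l : ℝ)) := by gcongr; linarith

theorem exists_finset_primes_sum_ge (C : ℝ) :
    ∃ L : Finset ℕ, (∀ l ∈ L, l.Prime ∧ l % 8 = 7) ∧ C ≤ ∑ l ∈ L, Real.log l / l := by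
  have hu : IsUnit (7 : ZMod 8) := by decide
  have h := ArithmeticFunction.vonMangoldt.not_summable_residueClass_prime_div hu
  rw [not_summable_iff_tendsto_nat_atTop_of_nonneg] at h
  · obtain ⟨n, hn⟩ := (h.eventually_ge_atTop C).exists
    refine ⟨(Finset.range n).filter fun l => l.Prime ∧ l % 8 = 7,
      fun l hl => (Finset.mem_filter.1 hl).2, hn.trans_eq ?_⟩
    rw [Finset.sum_filter]
    refine Finset.sum_congr rfl fun l _ => ?_
    have h7 : ((l : ZMod 8) = 7) ↔ l % 8 = 7 := by
      have := ZMod.natCast_eq_natCast_iff' l 7 8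
      simpa using this
    by_cases hl : l.Prime
    · by_cases hl8 : l % 8 = 7
      · simp [hl, hl8, ArithmeticFunction.vonMangoldt.residueClass, h7,
          ArithmeticFunction.vonMangoldt_apply_prime]
      · simp [hl, hl8, ArithmeticFunction.vonMangoldt.residueClass, h7]
    · simp [hl]
  · intro n
    have := ArithmeticFunction.vonMangoldt.residueClass_nonneg (7 : ZMod 8) n
    positivity

theorem exists_period_sparse {ε : ℝ} (hε : 0 < ε) :
    ∃ W C : ℕ, 0 < W ∧ (C : ℝ) ≤ ε * W ∧ ∀ N : ℕ,
      (Set.Icc 1 N ∩ {A : ℕ | ∀ l : ℕ, l.Prime → l % 8 = 7 →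
        orderOf (A : ZMod (l ^ 2)) ≠ l * (l - 1)}).ncard ≤ (N / W + 1) * C := by
  classical
  obtain ⟨L, hL, hsum⟩ := exists_finset_primes_sum_ge (-8 * Real.log ε)
  let m : ℕ → ℕ := fun i => if i ∈ L then i ^ 2 else 1
  have hmL : ∀ i ∈ L, m i = i ^ 2 := fun i hi => if_pos hi
  have : ∀ i, NeZero (m i) := fun i => ⟨by
    by_cases hi : i ∈ L
    · rw [hmL i hi]; exact pow_ne_zero _ (hL i hi).1.ne_zero
    · simp [m, hi]⟩
  let S : ∀ i, Finset (ZMod (m i)) := fun i => Finset.univ.filter fun a => ¬ orderOf a = i * (i - 1)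
  let p : ℕ → Prop := fun n => ∀ i ∈ L, (n : ZMod (m i)) ∈ S i
  set W := ∏ i ∈ L, m i with hW
  have hWpos : 0 < W := Finset.prod_pos fun i _ => Nat.pos_of_ne_zero (NeZero.ne _)
  have hper : Function.Periodic p W := fun n => by
    refine propext (forall₂_congr fun i hi => ?_)
    have : (W : ZMod (m i)) = 0 :=
      (ZMod.natCast_eq_zero_iff _ _).2 (Finset.dvd_prod_of_mem m hi)
    rw [Nat.cast_add, this, add_zero]
  refine ⟨W, Nat.count p W, hWpos, ?_, fun N => ?_⟩
  · have hcard : ∀ i ∈ L, ((S i).card : ℝ) ≤ m i * Real.exp (-(Real.log i / (8 * i))) := by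
      intro i hi
      obtain ⟨hp, h8⟩ := hL i hi
      have hi2 : i ≠ 2 := by rintro rfl; simp at h8
      have hle : (i - 1) * (i - 1).totient ≤
          (Finset.univ.filter fun a : ZMod (m i) => orderOf a = i * (i - 1)).card := by
        have key : ∀ k [NeZero k], k = i ^ 2 → (i - 1) * (i - 1).totient ≤
            (Finset.univ.filter fun a : ZMod k => orderOf a = i * (i - 1)).card := by
          rintro k _ rfl
          exact card_orderOf_eq_le hp hi2
        exact key _ (hmL i hi)
      have htot := Finset.card_filter_add_card_filter_not (s := (Finset.univ : Finset (ZMod (m i))))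
        (fun a => orderOf a = i * (i - 1))
      rw [Finset.card_univ, ZMod.card] at htot
      have h1 : (S i).card + (i - 1) * (i - 1).totient ≤ m i := by
        simp only [S]
        lia
      have h2 : ((S i).card : ℝ) + ((i - 1) * (i - 1).totient : ℕ) ≤ m i := by exact_mod_cast h1
      have h3 := log_div_le h8
      have hmi : (m i : ℝ) = (i : ℝ) ^ 2 := by rw [hmL i hi]; push_cast; rfl
      have hipos : (0 : ℝ) < (i : ℝ) ^ 2 := by
        have := hp.pos
        positivity
      rw [le_div_iff₀ hipos] at h3
      have h4 := Real.one_sub_le_exp_neg (Real.log i / (8 * i))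
      rw [hmi] at h2 ⊢
      calc ((S i).card : ℝ) ≤ (i : ℝ) ^ 2 * (1 - Real.log i / (8 * i)) := by linarith
        _ ≤ _ := by gcongr
    have hcop : (L : Set ℕ).Pairwise fun i j => (m i).Coprime (m j) := by
      intro i hi j hj hij
      rw [hmL i hi, hmL j hj]
      exact Nat.Coprime.pow _ _ ((Nat.coprime_primes (hL i hi).1 (hL j hj).1).2 hij)
    have h1 := card_range_filter_mem_le m hcop S
    rw [← Nat.count_eq_card_filter_range] at h1
    calc (Nat.count p W : ℝ) ≤ ∏ i ∈ L, ((S i).card : ℝ) := by exact_mod_cast h1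
      _ ≤ ∏ i ∈ L, (m i * Real.exp (-(Real.log i / (8 * i)))) :=
        Finset.prod_le_prod (fun i _ => by positivity) hcard
      _ = Real.exp (-((∑ i ∈ L, Real.log i / i) / 8)) * W := by
        rw [Finset.prod_mul_distrib, ← Real.exp_sum, hW, mul_comm, Nat.cast_prod,
          Finset.sum_div, ← Finset.sum_neg_distrib]
        congr 3
        funext i
        ring
      _ ≤ ε * W := by
        gcongr
        rw [← Real.le_log_iff_exp_le hε]
        linarith
  · rw [← count_mul_of_periodic p hper]
    have hlt : N + 1 ≤ W * (N / W + 1) := Nat.lt_mul_div_succ N hWpos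
    refine le_trans ?_ (Nat.count_monotone p hlt)
    rw [Nat.count_eq_card_filter_range, ← Set.ncard_coe_finset]
    refine Set.ncard_le_ncard ?_ (Finset.finite_toSet _)
    rintro A ⟨⟨-, hAN⟩, hA⟩
    simp only [Finset.coe_filter, Finset.mem_range, Set.mem_ofPred_eq]
    refine ⟨by lia, fun i hi => ?_⟩
    simp only [S, Finset.mem_filter, Finset.mem_univ, true_and]
    have := hA i (hL i hi).1 (hL i hi).2
    rwa [← hmL i hi] at this

theorem tendsto_ncard_div_zero_of_sparse {E : Set ℕ}
    (hE : ∀ ε : ℝ, 0 < ε → ∃ W C : ℕ, 0 < W ∧ (C : ℝ) ≤ ε * W ∧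
      ∀ N : ℕ, (Set.Icc 1 N ∩ E).ncard ≤ (N / W + 1) * C) :
    Filter.Tendsto (fun N : ℕ => ((Set.Icc 1 N ∩ E).ncard : ℝ) / N) Filter.atTop (nhds 0) := by
  rw [Metric.tendsto_atTop]
  intro ε hε
  obtain ⟨W, C, hW, hC, hN⟩ := hE (ε / 2) (half_pos hε)
  obtain ⟨n, hn⟩ := exists_nat_gt (2 * C / ε : ℝ)
  refine ⟨n + 1, fun N hNn => ?_⟩
  have hN0 : (0 : ℝ) < N := by exact_mod_cast (by lia : 0 < N)
  rw [Real.dist_0_eq_abs, abs_of_nonneg (by positivity), div_lt_iff₀ hN0]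
  have hWr : (0 : ℝ) < W := by exact_mod_cast hW
  have h1 : ((Set.Icc 1 N ∩ E).ncard : ℝ) ≤ ((N / W : ℕ) + 1) * C := by exact_mod_cast hN N
  have h2 : ((N / W : ℕ) : ℝ) ≤ N / W := Nat.cast_div_le
  have h3 : (n : ℝ) + 1 ≤ N := by exact_mod_cast hNn
  have h4 : 2 * (C : ℝ) < N * ε := by
    rw [div_lt_iff₀ hε] at hn
    nlinarith
  have h5 : (N : ℝ) / W * C ≤ N * (ε / 2) := by
    rw [div_mul_eq_mul_div, div_le_iff₀ hWr]
    nlinarith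
  have h6 : ((N / W : ℕ) : ℝ) * C ≤ N / W * C := by gcongr
  nlinarith

theorem tendsto_ncard_div_one_of_compl {E G : Set ℕ} (hEG : ∀ n, n ∉ G → n ∈ E)
    (hE : Filter.Tendsto (fun N : ℕ => ((Set.Icc 1 N ∩ E).ncard : ℝ) / N) Filter.atTop (nhds 0)) :
    Filter.Tendsto (fun N : ℕ => ((Set.Icc 1 N ∩ G).ncard : ℝ) / N) Filter.atTop (nhds 1) := by
  have h1 : Filter.Tendsto (fun N : ℕ => 1 - ((Set.Icc 1 N ∩ E).ncard : ℝ) / N)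
      Filter.atTop (nhds 1) := by simpa using hE.const_sub 1
  refine tendsto_of_tendsto_of_tendsto_of_le_of_le' h1 tendsto_const_nhds ?_ ?_
  · filter_upwards [Filter.eventually_gt_atTop 0] with N hN
    have hN0 : (0 : ℝ) < N := by exact_mod_cast hN
    have hsub : Set.Icc 1 N ⊆ (Set.Icc 1 N ∩ E) ∪ (Set.Icc 1 N ∩ G) := fun n hn => by
      by_cases h : n ∈ G
      · exact Or.inr ⟨hn, h⟩
      · exact Or.inl ⟨hn, hEG n h⟩
    have h2 := (Set.ncard_le_ncard hsub ((Set.finite_Icc 1 N).inter_of_left _ |>.union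
      ((Set.finite_Icc 1 N).inter_of_left _))).trans (Set.ncard_union_le _ _)
    rw [← Finset.coe_Icc, Set.ncard_coe_finset, Nat.card_Icc, Nat.add_sub_cancel,
      Finset.coe_Icc] at h2
    have h3 : (N : ℝ) ≤ (Set.Icc 1 N ∩ E).ncard + (Set.Icc 1 N ∩ G).ncard := by exact_mod_cast h2
    rw [sub_le_iff_le_add, ← add_div, le_div_iff₀ hN0]
    linarith
  · filter_upwards with N
    refine div_le_one_of_le₀ ?_ (by positivity)
    have h2 := Set.ncard_le_ncard (Set.inter_subset_left (s := Set.Icc 1 N) (t := G))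
      (Set.finite_Icc 1 N)
    rw [← Finset.coe_Icc, Set.ncard_coe_finset, Nat.card_Icc, Nat.add_sub_cancel] at h2
    exact_mod_cast h2

/-- Theorem 1.2: the pair `A, 2` is order-dominant for almost all positive integers `A`;
i.e., the set of positive integers `A` for which infinitely many primes `p` (not dividing
`2A`) satisfy `ord_p(A) > ord_p(2)` has asymptotic density `1`. -/
theorem almost_all_A_two_order_dominant :
    Filter.Tendsto
      (fun N : ℕ =>
        ((Set.Icc 1 N ∩ {A : ℕ |
          {p : ℕ | p.Prime ∧ ¬ p ∣ 2 * A ∧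
            orderOf ((2 : ZMod p)) < orderOf ((A : ZMod p))}.Infinite}).ncard : ℝ) / N)
      Filter.atTop (nhds 1) := by
  refine tendsto_ncard_div_one_of_compl (E := {A : ℕ | ∀ l : ℕ, l.Prime → l % 8 = 7 →
      orderOf (A : ZMod (l ^ 2)) ≠ l * (l - 1)}) (fun A hA l hl hl8 h => hA ?_)
    (tendsto_ncard_div_zero_of_sparse fun ε hε => exists_period_sparse hε)
  exact infinite_orderOf_two_lt hl hl8 h
end

section
/- Let A be an integer with 3 ∤ A and A² ≢ 1 (mod 9). Then there are infinitely many primes p, not dividing 3A, such that ord_p(-3) divides ord_p(A) and the quotient ord_p(A)/ord_p(-3) is an integer multiple of 3. -/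
open scoped QuadraticAlgebra

/-- The ring `ℤ[ω]` of Eisenstein integers, where `ω ^ 2 = -1 - ω`. -/
abbrev Eisenstein : Type := QuadraticAlgebra ℤ (-1) (-1)

namespace Eisenstein

lemma norm_eq (z : Eisenstein) : z.norm = z.re ^ 2 - z.re * z.im + z.im ^ 2 := by
  rw [QuadraticAlgebra.norm_def]; ring

lemma norm_nonneg (z : Eisenstein) : 0 ≤ z.norm := by
  rw [norm_eq]
  nlinarith [sq_nonneg (2 * z.re - z.im), sq_nonneg z.im]

lemma eq_zero_of_norm_eq_zero {z : Eisenstein} (h : z.norm = 0) : z = 0 := by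
  rw [norm_eq] at h
  have him : z.im = 0 := by
    rw [← sq_eq_zero_iff]
    nlinarith [sq_nonneg (2 * z.re - z.im), sq_nonneg z.im]
  have hre : z.re = 0 := by simpa [him] using h
  ext <;> simp [hre, him]

instance : IsDomain Eisenstein := by
  have : NoZeroDivisors Eisenstein := ⟨fun {x y} h ↦ by
    have : x.norm * y.norm = 0 := by rw [← map_mul, h, QuadraticAlgebra.norm_zero]
    exact (mul_eq_zero.mp this).imp eq_zero_of_norm_eq_zero eq_zero_of_norm_eq_zero⟩
  exact NoZeroDivisors.to_isDomain _

instance : CharZero Eisenstein := ⟨fun m n h ↦ by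
  simpa using congrArg QuadraticAlgebra.re h⟩

lemma mul_star_eq_norm (z : Eisenstein) : z * star z = (z.norm : Eisenstein) := by
  rw [← QuadraticAlgebra.algebraMap_norm_eq_mul_star]; simp

lemma omega_sq : (ω : Eisenstein) ^ 2 + ω + 1 = 0 := by
  ext <;> simp [pow_two]

lemma eq_add_mul_omega (z : Eisenstein) : z = z.re + z.im * (ω : Eisenstein) := by
  ext <;> simp

lemma intCast_dvd_iff {n : ℤ} {z : Eisenstein} :
    (n : Eisenstein) ∣ z ↔ n ∣ z.re ∧ n ∣ z.im := by
  constructor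
  · rintro ⟨w, rfl⟩
    simp
  · rintro ⟨⟨x, hx⟩, ⟨y, hy⟩⟩
    exact ⟨⟨x, y⟩, by ext <;> simp [hx, hy]⟩

lemma isPrimitiveRoot_omega : IsPrimitiveRoot (ω : Eisenstein) 3 := by
  rw [IsPrimitiveRoot.iff_orderOf]
  refine orderOf_eq_prime ?_ fun h ↦ ?_
  · linear_combination (ω - 1) * omega_sq
  · simpa using congrArg QuadraticAlgebra.im h

/-- A root of `X ^ 2 + X + 1` in `S` defines a ring homomorphism from the Eisenstein integers. -/
def liftRoot {S : Type*} [CommRing S] (w : S) (hw : w ^ 2 + w + 1 = 0) : Eisenstein →+* S :=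
  (QuadraticAlgebra.lift (R := ℤ) (a := -1) (b := -1)
    ⟨w, by simp; linear_combination hw⟩).toRingHom

lemma liftRoot_apply {S : Type*} [CommRing S] (w : S) (hw : w ^ 2 + w + 1 = 0) (z : Eisenstein) :
    liftRoot w hw z = z.re + z.im * w := by
  simp [liftRoot]

lemma pow_three_of_norm_eq_one {z : Eisenstein} (h : z.norm = 1) : z ^ 3 = 1 ∨ z ^ 3 = -1 := by
  rw [norm_eq] at h
  obtain ⟨x, y⟩ := z
  simp only at h
  have hx : x ^ 2 ≤ 1 := by nlinarith [sq_nonneg (2 * y - x), sq_nonneg x]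
  have hy : y ^ 2 ≤ 1 := by nlinarith [sq_nonneg (2 * x - y), sq_nonneg y]
  obtain ⟨hx1, hx2⟩ := abs_le.mp ((sq_le_one_iff_abs_le_one x).mp hx)
  obtain ⟨hy1, hy2⟩ := abs_le.mp ((sq_le_one_iff_abs_le_one y).mp hy)
  interval_cases x <;> interval_cases y <;> simp at h <;>
    simp [QuadraticAlgebra.ext_iff, pow_succ]

lemma eq_of_map_eq {K : Type*} [Field K] (h3 : (3 : K) ≠ 0) (θ : Eisenstein →+* K)
    {x y : Eisenstein} (hx : x ^ 3 = 1) (hy : y ^ 3 = 1) (h : θ x = θ y) : x = y := by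
  by_contra hne
  have hsub : x - y ≠ 0 := sub_ne_zero.mpr hne
  have hq : x ^ 2 + x * y + y ^ 2 = 0 := by
    refine (mul_eq_zero.mp ?_).resolve_left hsub
    linear_combination hx - hy
  have hq' := congrArg θ hq
  have hy' := congrArg θ hy
  simp only [map_add, map_mul, map_pow, h, map_zero, map_one] at hq' hy'
  apply h3
  linear_combination θ y * hq' - 3 * hy'

lemma three_ne_zero_of_ne {q : ℕ} [Fact q.Prime] (hq3 : q ≠ 3) {K : Type*} [Field K] [CharP K q] :
    (3 : K) ≠ 0 := by
  intro h
  have : ((3 : ℕ) : K) = 0 := by exact_mod_cast h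
  rw [CharP.cast_eq_zero_iff K q, Nat.prime_dvd_prime_iff_eq Fact.out Nat.prime_three] at this
  exact hq3 this

lemma sq_mod_three {n : ℕ} (hn : ¬ 3 ∣ n) : n ^ 2 % 3 = 1 := by
  have : n % 3 = 1 ∨ n % 3 = 2 := by omega
  rcases this with h | h <;> simp [Nat.pow_mod, h]

lemma prime_sq_mod_three {q : ℕ} [Fact q.Prime] (hq3 : q ≠ 3) : q ^ 2 % 3 = 1 :=
  sq_mod_three fun h ↦ hq3 ((Nat.prime_dvd_prime_iff_eq Nat.prime_three Fact.out).mp h).symm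

lemma three_dvd_sq_sub_one {q : ℕ} [Fact q.Prime] (hq3 : q ≠ 3) : 3 ∣ q ^ 2 - 1 := by
  have := prime_sq_mod_three hq3
  omega

lemma map_pow_sq {q : ℕ} [Fact q.Prime] (hq3 : q ≠ 3) {K : Type*} [Field K] [CharP K q]
    (θ : Eisenstein →+* K) (z : Eisenstein) : θ z ^ q ^ 2 = θ z := by
  have hω : (ω : Eisenstein) ^ q ^ 2 = ω := by
    rw [← pow_mod_orderOf, ← isPrimitiveRoot_omega.eq_orderOf, prime_sq_mod_three hq3, pow_one]
  rw [eq_add_mul_omega z, ← iterateFrobenius_def]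
  simp only [map_add, map_mul, map_intCast]
  rw [iterateFrobenius_def, ← map_pow, hω]

lemma map_pow_sq_sub_one {q : ℕ} [Fact q.Prime] (hq3 : q ≠ 3) {K : Type*} [Field K] [CharP K q]
    (θ : Eisenstein →+* K) {z : Eisenstein} (hz : θ z ≠ 0) : θ z ^ (q ^ 2 - 1) = 1 := by
  refine mul_right_cancel₀ hz ?_
  rw [pow_sub_one_mul (pow_pos (Fact.out : q.Prime).pos 2).ne', map_pow_sq hq3, one_mul]

/-- The value of a cubic character at a prime `q`, in characteristic `q`, is a power of a
Jacobi sum. -/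
lemma apply_eq_jacobiSum_pow {p q : ℕ} [Fact p.Prime] [Fact q.Prime] (hpq : p ≠ q) (hq3 : q ≠ 3)
    {K : Type*} [Field K] [IsAlgClosed K] [CharP K q] {χ : MulChar (ZMod p) K}
    (hχ : orderOf χ = 3) :
    χ q = (p * jacobiSum χ χ) ^ ((q ^ 2 - 1) / 3) := by
  have hq : q.Prime := Fact.out
  have hp : p.Prime := Fact.out
  have hpK : (p : K) ≠ 0 := by
    rw [Ne, CharP.cast_eq_zero_iff K q, Nat.prime_dvd_prime_iff_eq hq hp]
    exact hpq.symm
  have : NeZero (p : K) := ⟨hpK⟩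
  obtain ⟨ζ, hζ⟩ := HasEnoughRootsOfUnity.exists_primitiveRoot K p
  obtain ⟨ψ, hψ⟩ : ∃ ψ : AddChar (ZMod p) K, ψ.IsPrimitive :=
    ⟨_, AddChar.zmodChar_primitive_of_primitive_root p hζ⟩
  have hq2 : q ^ 2 % 3 = 1 := prime_sq_mod_three hq3
  have hχ3 : χ ^ 3 = 1 := hχ ▸ pow_orderOf_eq_one χ
  have hχ1 : χ ≠ 1 := by rintro rfl; simp at hχ
  have hunit (x : (ZMod p)ˣ) : χ x ^ 3 = 1 := by
    rw [← MulChar.pow_apply_coe, hχ3, MulChar.one_apply_coe]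
  have hneg : χ (-1) = 1 := by
    have h := hunit (-1)
    rw [← map_pow] at h
    simpa [Odd.neg_one_pow (show Odd 3 by decide)] using h
  have hcube : gaussSum χ ψ ^ 3 = p * jacobiSum χ χ := by
    have h := gaussSum_pow_eq_prod_jacobiSum (χ := χ) (by omega) hψ
    simpa [hχ, hneg, ZMod.card] using h
  have hg : gaussSum χ ψ ≠ 0 :=
    gaussSum_ne_zero_of_nontrivial (by simpa [ZMod.card] using hpK) hχ1 hψ
  have hfrob : gaussSum χ ψ ^ q ^ 2 = gaussSum χ (ψ.mulShift ((q : ZMod p) ^ 2)) := by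
    rw [sq, pow_mul, gaussSum_frob, gaussSum_frob, ← pow_mul, ← pow_mul, ← sq,
      ← pow_mod_orderOf, hχ, hq2, pow_one, AddChar.pow_mulShift]
    simp
  have hqp : IsUnit (q : ZMod p) := by
    rw [ZMod.isUnit_iff_coprime]
    exact (Nat.coprime_primes hq hp).mpr hpq.symm
  obtain ⟨x, hx⟩ := hqp
  have hshift := gaussSum_mulShift χ ψ (x ^ 2)
  rw [Units.val_pow_eq_pow_val, hx, ← hfrob, map_pow] at hshift
  have hx3 := hunit x
  rw [hx] at hx3
  have hpos : 0 < q ^ 2 := pow_pos hq.pos 2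
  rw [← hcube, ← pow_mul, Nat.mul_div_cancel' (by omega)]
  refine mul_right_cancel₀ hg ?_
  rw [pow_sub_one_mul hpos.ne']
  linear_combination (gaussSum χ ψ ^ q ^ 2) * hx3 - χ q * hshift

lemma norm_eq_one_of_pow_three {z : Eisenstein} (h : z ^ 3 = 1) : z.norm = 1 := by
  have h1 : z.norm ^ 3 = 1 := by rw [← map_pow, h, QuadraticAlgebra.norm_one]
  exact (pow_eq_one_iff_of_nonneg z.norm_nonneg three_ne_zero).mp h1

lemma jacobiSum_inv_eq_star {p : ℕ} [Fact p.Prime] {χ : MulChar (ZMod p) Eisenstein}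
    (hχ : χ ^ 3 = 1) : jacobiSum χ⁻¹ χ⁻¹ = star (jacobiSum χ χ) := by
  have hinv : χ.ringHomComp (starRingEnd Eisenstein) = χ⁻¹ := by
    rw [eq_inv_iff_mul_eq_one]
    ext x : 1
    have h3 : χ x ^ 3 = 1 := by
      rw [← MulChar.pow_apply_coe, hχ, MulChar.one_apply_coe]
    have h := mul_star_eq_norm (χ x)
    rw [norm_eq_one_of_pow_three h3] at h
    rw [MulChar.one_apply_coe, MulChar.coeToFun_mul, Pi.mul_apply, MulChar.ringHomComp_apply,
      starRingEnd_apply, mul_comm, h, Int.cast_one]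
  rw [← hinv, jacobiSum_ringHomComp, starRingEnd_apply]

lemma jacobiSum_mul_star {p : ℕ} [Fact p.Prime] {χ : MulChar (ZMod p) Eisenstein}
    (hχ : orderOf χ = 3) : jacobiSum χ χ * star (jacobiSum χ χ) = p := by
  have hχ3 : χ ^ 3 = 1 := hχ ▸ pow_orderOf_eq_one χ
  have hχ1 : χ ≠ 1 := by rintro rfl; simp at hχ
  have hχ2 : χ * χ ≠ 1 := by
    rw [← sq]
    exact pow_ne_one_of_lt_orderOf two_ne_zero (by omega)
  let f := algebraMap Eisenstein (FractionRing Eisenstein)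
  have hf : Function.Injective f := IsFractionRing.injective _ _
  have hchar : ringChar (FractionRing Eisenstein) ≠ ringChar (ZMod p) := by
    rw [ZMod.ringChar_zmod_n]
    have : CharZero (FractionRing Eisenstein) := charZero_of_injective_algebraMap hf
    rw [ringChar.eq_zero]
    exact (Fact.out : p.Prime).ne_zero.symm
  apply hf
  rw [map_mul, ← jacobiSum_inv_eq_star hχ3, ← jacobiSum_ringHomComp, ← jacobiSum_ringHomComp,
    ← MulChar.ringHomComp_inv, jacobiSum_mul_jacobiSum_inv hchar, ZMod.card, map_natCast]
  · rwa [MulChar.ringHomComp_ne_one_iff hf]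
  · rwa [MulChar.ringHomComp_ne_one_iff hf]
  · rwa [← MulChar.ringHomComp_mul, MulChar.ringHomComp_ne_one_iff hf]

lemma exists_cubic_mulChar {p : ℕ} [Fact p.Prime] (hp : 3 ∣ p - 1) (φ : Eisenstein →+* ZMod p) :
    ∃ χ : MulChar (ZMod p) Eisenstein, orderOf χ = 3 ∧ φ (jacobiSum χ χ) = 0 := by
  obtain ⟨χ, hχ⟩ := MulChar.exists_mulChar_orderOf (ZMod p) (n := 3) (by rwa [ZMod.card])
    isPrimitiveRoot_omega
  have h := congrArg φ (jacobiSum_mul_star hχ)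
  rw [map_mul, map_natCast, CharP.cast_eq_zero, mul_eq_zero] at h
  rcases h with h | h
  · exact ⟨χ, hχ, h⟩
  · refine ⟨χ⁻¹, by rw [orderOf_inv, hχ], ?_⟩
    rw [jacobiSum_inv_eq_star (hχ ▸ pow_orderOf_eq_one χ), h]

lemma map_omega {S : Type*} [CommRing S] (φ : Eisenstein →+* S) : φ ω ^ 2 + φ ω + 1 = 0 := by
  simpa using congrArg φ omega_sq

lemma map_eq {S : Type*} [CommRing S] (φ : Eisenstein →+* S) (z : Eisenstein) :
    φ z = z.re + z.im * φ ω := by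
  conv_lhs => rw [eq_add_mul_omega z]
  simp

lemma dvd_of_map_eq_zero {p : ℕ} [Fact p.Prime] (hp3 : p ≠ 3) {π : Eisenstein}
    (hπ : π * star π = p) (φ : Eisenstein →+* ZMod p) (hφ : φ π = 0) {z : Eisenstein}
    (hz : φ z = 0) : π ∣ z := by
  have hp : p.Prime := Fact.out
  have h3 : (3 : ZMod p) ≠ 0 := three_ne_zero_of_ne hp3
  have hω := map_omega φ
  have hne : 2 * φ ω + 1 ≠ 0 := by
    intro h
    apply h3
    linear_combination 4 * hω - (2 * φ ω + 1) * h
  set y := z * star π with hy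
  have h1 : φ y = 0 := by rw [hy, map_mul, hz, zero_mul]
  have h2 : φ (star y) = 0 := by rw [hy, star_mul, star_star, map_mul, hφ, zero_mul]
  rw [map_eq] at h1 h2
  simp only [QuadraticAlgebra.re_star, QuadraticAlgebra.im_star] at h2
  push_cast at h2
  have him : (y.im : ZMod p) = 0 := by
    refine (mul_eq_zero.mp ?_).resolve_right hne
    linear_combination h1 - h2
  have hre : (y.re : ZMod p) = 0 := by simpa [him] using h1
  rw [ZMod.intCast_zmod_eq_zero_iff_dvd] at him hre
  obtain ⟨κ, hκ⟩ := intCast_dvd_iff.mpr ⟨hre, him⟩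
  refine ⟨κ, ?_⟩
  have hstar : star π ≠ 0 := by
    rintro h
    rw [h, mul_zero] at hπ
    exact hp.ne_zero (by exact_mod_cast hπ.symm)
  refine mul_right_cancel₀ hstar ?_
  rw [Int.cast_natCast, ← hπ] at hκ
  linear_combination hκ

lemma jacobiSum_add_one_dvd {p : ℕ} [Fact p.Prime] (hp : 3 ∣ p - 1)
    {χ : MulChar (ZMod p) Eisenstein} (hχ : orderOf χ = 3) : 3 ∣ jacobiSum χ χ + 1 := by
  have hχ3 : χ ^ 3 = 1 := hχ ▸ pow_orderOf_eq_one χ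
  obtain ⟨z, -, hz⟩ := exists_jacobiSum_eq_neg_one_add (by norm_num) hχ3 hχ3
    (by rwa [ZMod.card]) isPrimitiveRoot_omega
  exact ⟨-z * ω, by linear_combination hz + z * omega_sq⟩

/-- A prime dividing the norm but not the element gives a ring homomorphism to the prime field. -/
lemma exists_map_eq_zero {p : ℕ} [Fact p.Prime] {z : Eisenstein} (hz : (p : ℤ) ∣ z.norm)
    (hpz : ¬ (p : Eisenstein) ∣ z) : ∃ φ : Eisenstein →+* ZMod p, φ z = 0 := by
  have hn : (z.re : ZMod p) ^ 2 - z.re * z.im + (z.im : ZMod p) ^ 2 = 0 := by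
    rw [← ZMod.intCast_zmod_eq_zero_iff_dvd, norm_eq] at hz
    exact_mod_cast hz
  have him : (z.im : ZMod p) ≠ 0 := by
    intro him
    have hre : (z.re : ZMod p) = 0 := by simpa [him] using hn
    rw [ZMod.intCast_zmod_eq_zero_iff_dvd] at him hre
    exact hpz (by simpa using intCast_dvd_iff.mpr ⟨hre, him⟩)
  refine ⟨liftRoot (-z.re / z.im) ?_, ?_⟩
  · field_simp
    linear_combination hn
  · rw [liftRoot_apply]
    field_simp
    ring

lemma three_dvd_sub_one {p : ℕ} [Fact p.Prime] (hp3 : p ≠ 3) (φ : Eisenstein →+* ZMod p) :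
    3 ∣ p - 1 := by
  have hω := map_omega φ
  have hne : φ ω ≠ 0 := by
    intro h
    simp [h] at hω
  have hord : orderOf (φ ω) = 3 := by
    refine orderOf_eq_prime (by linear_combination (φ ω - 1) * hω) fun h ↦ ?_
    rw [h] at hω
    exact three_ne_zero_of_ne hp3 (by linear_combination hω : (3 : ZMod p) = 0)
  rw [← hord]
  exact orderOf_dvd_of_pow_eq_one (ZMod.pow_card_sub_one_eq_one hne)

/-- The conclusion of cubic reciprocity for an Eisenstein integer `z` and a natural number `A` which
is a cube modulo all primes dividing the norm of `z`. -/
theorem exists_cubic_symbol {A : ℕ} (z : Eisenstein) (h3 : ¬ 3 ∣ z.norm)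
    (hA : IsCoprime z.norm A)
    (hcube : ∀ p : ℕ, p.Prime → (p : ℤ) ∣ z.norm → ∃ x : ZMod p, x ^ 3 = A) :
    ∃ u : Eisenstein, u ^ 3 = 1 ∧ (∃ s : ℤ, 3 ∣ u * z - s) ∧ ∃ ψ : ℕ →* Eisenstein, ψ A = 1 ∧
      (∀ n, n ∣ A → ψ n ^ 3 = 1) ∧
      ∀ (q : ℕ) [Fact q.Prime], q ∣ A → q ≠ 3 → ∀ θ : Eisenstein →+* AlgebraicClosure (ZMod q),
        θ (ψ q) = θ (z.norm * (u * z)) ^ ((q ^ 2 - 1) / 3) := by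
  induction hn : z.norm.natAbs using Nat.strong_induction_on generalizing z with
  | _ n ih =>
  subst hn
  have hz0 : z.norm ≠ 0 := by rintro h; simp [h] at h3
  by_cases h1 : z.norm.natAbs = 1
  · have hz : z.norm = 1 := by have := z.norm_nonneg; omega
    have hz3 := pow_three_of_norm_eq_one hz
    refine ⟨z ^ 2, ?_, ?_, 1, rfl, fun _ _ ↦ one_pow 3, fun q _ hq hq3 θ ↦ ?_⟩
    · rw [← pow_mul, mul_comm, pow_mul]
      rcases hz3 with h | h <;> simp [h]
    · rw [← pow_succ]
      rcases hz3 with h | h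
      · exact ⟨1, by simp [h]⟩
      · exact ⟨-1, by simp [h]⟩
    · have hθ : θ z ≠ 0 := by
        intro h
        have := congrArg θ (mul_star_eq_norm z)
        simp [h, hz] at this
      rw [← pow_succ, hz, Int.cast_one, one_mul, MonoidHom.one_apply, map_one, map_pow, ← pow_mul,
        Nat.mul_div_cancel' (three_dvd_sq_sub_one hq3), map_pow_sq_sub_one hq3 θ hθ]
  · obtain ⟨p, hp, hpz⟩ := Nat.exists_prime_and_dvd h1
    have := Fact.mk hp
    have hpz : (p : ℤ) ∣ z.norm := Int.natCast_dvd.mpr hpz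
    have hp3 : p ≠ 3 := by rintro rfl; exact h3 hpz
    have hpA : ¬ p ∣ A := fun h ↦ by
      have := hA.isUnit_of_dvd' hpz (Int.natCast_dvd_natCast.mpr h)
      exact hp.ne_one (by simpa [Int.isUnit_iff] using this)
    -- the inductive step, for a factor whose own symbol is known
    have step (y w : Eisenstein) (hzw : z = y * w) (hy : y.norm.natAbs ≠ 1) (s : ℤ)
        (hys : 3 ∣ y - s) (χ : ℕ →* Eisenstein) (hχA : χ A = 1)
        (hχ3 : ∀ n, n ∣ A → χ n ^ 3 = 1)
        (hχ : ∀ (q : ℕ) [Fact q.Prime], q ∣ A → q ≠ 3 →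
          ∀ θ : Eisenstein →+* AlgebraicClosure (ZMod q),
          θ (χ q) = θ (y.norm * y) ^ ((q ^ 2 - 1) / 3)) :
        ∃ u : Eisenstein, u ^ 3 = 1 ∧ (∃ s : ℤ, 3 ∣ u * z - s) ∧ ∃ ψ : ℕ →* Eisenstein,
          ψ A = 1 ∧ (∀ n, n ∣ A → ψ n ^ 3 = 1) ∧
          ∀ (q : ℕ) [Fact q.Prime], q ∣ A → q ≠ 3 →
            ∀ θ : Eisenstein →+* AlgebraicClosure (ZMod q),
            θ (ψ q) = θ (z.norm * (u * z)) ^ ((q ^ 2 - 1) / 3) := by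
      have hnorm : z.norm = y.norm * w.norm := by rw [hzw, map_mul]
      have hdvd : w.norm ∣ z.norm := hnorm ▸ dvd_mul_left _ _
      have hlt : w.norm.natAbs < z.norm.natAbs := by
        rw [hnorm, Int.natAbs_mul]
        rw [hnorm, mul_ne_zero_iff] at hz0
        have h2 : 0 < w.norm.natAbs := Int.natAbs_pos.mpr hz0.2
        have h3 : 0 < y.norm.natAbs := Int.natAbs_pos.mpr hz0.1
        exact lt_mul_left h2 (by omega)
      obtain ⟨u, hu, ⟨t, d, ht⟩, ψ, hψA, hψ3, hψ⟩ := ih _ hlt w (fun h ↦ h3 (h.trans hdvd))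
        (hA.of_isCoprime_of_dvd_left hdvd) (fun p hp h ↦ hcube p hp (h.trans hdvd)) rfl
      refine ⟨u, hu, ⟨s * t, ?_⟩, χ * ψ, by simp [hψA, hχA], fun n hn ↦ ?_,
        fun q _ hq hq3 θ ↦ ?_⟩
      · obtain ⟨c, hc⟩ := hys
        rw [hzw]
        exact ⟨c * (u * w) + s * d, by push_cast; linear_combination (u * w) * hc + s * ht⟩
      · rw [MonoidHom.mul_apply, mul_pow, hχ3 n hn, hψ3 n hn, one_mul]
      · rw [MonoidHom.mul_apply, map_mul, hχ q hq hq3, hψ q hq hq3, ← mul_pow, ← map_mul, hnorm,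
          hzw]
        push_cast
        congr 2
        ring
    by_cases hpz' : (p : Eisenstein) ∣ z
    · obtain ⟨w, hw⟩ := hpz'
      refine step p w hw ?_ p (by simp) 1 rfl (fun _ _ ↦ one_pow 3) fun q _ hq hq3 θ ↦ ?_
      · rw [QuadraticAlgebra.norm_natCast, Int.natAbs_pow, Int.natAbs_natCast]
        exact fun h ↦ hp.ne_one (by simpa using h)
      · have hpq : θ p ≠ 0 := by
          rw [map_natCast, Ne, CharP.cast_eq_zero_iff _ q, Nat.prime_dvd_prime_iff_eq Fact.out hp]
          rintro rfl
          exact hpA hq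
        rw [MonoidHom.one_apply, map_one, QuadraticAlgebra.norm_natCast]
        push_cast
        rw [← pow_succ, map_pow, ← pow_mul, Nat.mul_div_cancel' (three_dvd_sq_sub_one hq3),
          map_pow_sq_sub_one hq3 θ hpq]
    · obtain ⟨φ, hφ⟩ := exists_map_eq_zero hpz hpz'
      have h3p := three_dvd_sub_one hp3 φ
      obtain ⟨χ, hχ, hφχ⟩ := exists_cubic_mulChar h3p φ
      have hπ := jacobiSum_mul_star hχ
      obtain ⟨w, hw⟩ := dvd_of_map_eq_zero hp3 hπ φ hφχ hφ
      have hnorm : (jacobiSum χ χ).norm = p := by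
        rw [mul_star_eq_norm] at hπ
        exact_mod_cast hπ
      have hχ3 {x : ZMod p} (hx : x ≠ 0) : χ x ^ 3 = 1 := by
        rw [← MulChar.pow_apply' _ three_ne_zero, ← hχ, pow_orderOf_eq_one,
          MulChar.one_apply (isUnit_iff_ne_zero.mpr hx)]
      have hne {n : ℕ} (hn : n ∣ A) : (n : ZMod p) ≠ 0 := by
        rw [Ne, ZMod.natCast_eq_zero_iff]
        exact fun h ↦ hpA (h.trans hn)
      refine step _ w hw ?_ (-1) ?_ ((χ : ZMod p →* Eisenstein).comp (Nat.castRingHom (ZMod p)))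
        ?_ (fun n hn ↦ ?_) fun q _ hq hq3 θ ↦ ?_
      · rw [hnorm, Int.natAbs_natCast]
        exact hp.ne_one
      · simpa using jacobiSum_add_one_dvd h3p hχ
      · obtain ⟨x, hx⟩ := hcube p hp hpz
        have hx0 : x ≠ 0 := by
          rintro rfl
          exact hne dvd_rfl (by simpa using hx.symm)
        change χ (A : ZMod p) = 1
        rw [← hx, map_pow, hχ3 hx0]
      · exact hχ3 (hne hn)
      · have hpq : p ≠ q := by rintro rfl; exact hpA hq
        have h3 : (3 : AlgebraicClosure (ZMod q)) ≠ 0 := three_ne_zero_of_ne hq3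
        have hord : orderOf (χ.ringHomComp θ) = 3 := by
          refine orderOf_eq_prime ?_ fun h ↦ ?_
          · rw [MulChar.ringHomComp_pow, ← hχ, pow_orderOf_eq_one, MulChar.ringHomComp_one]
          · have : χ = 1 := by
              ext x : 1
              refine eq_of_map_eq h3 θ (hχ3 x.ne_zero) (by simp) ?_
              rw [← MulChar.ringHomComp_apply, h]
              simp
            simp [this] at hχ
        have key := apply_eq_jacobiSum_pow hpq hq3 hord
        rw [jacobiSum_ringHomComp, MulChar.ringHomComp_apply] at key
        rw [hnorm]
        simpa using key

/-- If `A ^ 2` is not `1` modulo `9`, then the primes dividing `A ^ (2 * k) + 3` detect that `A` is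
not a cube. -/
theorem exists_prime_not_cube {A k : ℕ} (hk : k ≠ 0) (h3 : ¬ 3 ∣ A) (h9 : ¬ 9 ∣ A ^ 2 - 1) :
    ∃ p : ℕ, p.Prime ∧ p ∣ A ^ (2 * k) + 3 ∧ ¬ ∃ x : ZMod p, x ^ 3 = A := by
  obtain ⟨t, z, hre, him, hnorm, him3⟩ : ∃ (t : ℕ) (z : Eisenstein),
      t * z.re = A ^ k + 1 ∧ t * z.im = 2 ∧
      t ^ 2 * z.norm = A ^ (2 * k) + 3 ∧ ¬ 3 ∣ z.im := by
    rw [mul_comm 2, pow_mul]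
    by_cases h2 : 2 ∣ A
    · refine ⟨1, ⟨A ^ k + 1, 2⟩, by simp, by simp, ?_, by norm_num⟩
      rw [norm_eq]
      push_cast
      ring
    · have hodd : Odd (A ^ k) := (Nat.odd_iff.mpr (by omega)).pow
      obtain ⟨m, hm⟩ := hodd
      have hm' : (A : ℤ) ^ k = 2 * m + 1 := by exact_mod_cast hm
      refine ⟨2, ⟨m + 1, 1⟩, ?_, by simp, ?_, by norm_num⟩
      · rw [hm']
        push_cast
        ring
      · rw [norm_eq, hm']
        push_cast
        ring
  have hdvd : z.norm ∣ (A : ℤ) ^ (2 * k) + 3 := ⟨_, by rw [← hnorm, mul_comm]⟩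
  have h3A : ¬ (3 : ℤ) ∣ A := by exact_mod_cast h3
  have hz3 : ¬ 3 ∣ z.norm := fun h ↦
    h3A (Int.prime_three.dvd_of_dvd_pow ((Int.dvd_add_left dvd_rfl).mp (h.trans hdvd)))
  have hcop : IsCoprime z.norm A := by
    refine IsCoprime.of_isCoprime_of_dvd_left ?_ hdvd
    obtain ⟨j, hj⟩ := Nat.exists_eq_succ_of_ne_zero (mul_ne_zero two_ne_zero hk)
    rw [hj, pow_succ, add_comm]
    exact (((Int.prime_three.coprime_iff_not_dvd).mpr h3A)).add_mul_right_left _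
  by_contra! hcon
  obtain ⟨u, hu, ⟨s, hs⟩, ψ, hψA, hψ3, hψ⟩ := exists_cubic_symbol z hz3 hcop fun p hp hpz ↦
    hcon p hp (by exact_mod_cast hpz.trans hdvd)
  have hu1 : orderOf u = 3 := by
    refine orderOf_eq_prime hu ?_
    rintro rfl
    have := (intCast_dvd_iff (n := 3)).mp (by simpa using hs)
    exact him3 (by simpa using this.2)
  have hprime (q : ℕ) (hq : q.Prime) (hqA : q ∣ A) : ψ q = u ^ ((q ^ 2 - 1) / 3) := by
    have := Fact.mk hq
    have hq3 : q ≠ 3 := by rintro rfl; exact h3 hqA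
    obtain ⟨w, hw⟩ := IsAlgClosed.exists_root
      (Polynomial.X ^ 2 + Polynomial.X + 1 : Polynomial (AlgebraicClosure (ZMod q))) <| by
        rw [show Polynomial.degree _ = 2 by compute_degree!]
        norm_num
    let θ : Eisenstein →+* AlgebraicClosure (ZMod q) := liftRoot w (by simpa using hw)
    have hK3 : (3 : AlgebraicClosure (ZMod q)) ≠ 0 := three_ne_zero_of_ne hq3
    have hE := three_dvd_sq_sub_one hq3
    have hAK : (A : AlgebraicClosure (ZMod q)) = 0 := by rwa [CharP.cast_eq_zero_iff _ q]
    have hθ : θ (-(1 + 2 * ω)) = -(1 + 2 * θ ω) := by simp [two_mul]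
    have hy : θ (-(1 + 2 * ω)) ^ 2 = -3 := by
      linear_combination (θ (-(1 + 2 * ω)) - (1 + 2 * θ ω)) * hθ + 4 * map_omega θ
    have htz : θ t * θ z = - θ (-(1 + 2 * ω)) := by
      have hre' := congrArg (Int.cast : ℤ → AlgebraicClosure (ZMod q)) hre
      have him' := congrArg (Int.cast : ℤ → AlgebraicClosure (ZMod q)) him
      push_cast at hre' him'
      rw [hAK, zero_pow hk] at hre'
      rw [map_natCast, map_eq θ z]
      linear_combination hre' + θ ω * him' + hθ
    have htN : θ t ^ 2 * θ z.norm = 3 := by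
      have h := congrArg (Int.cast : ℤ → AlgebraicClosure (ZMod q)) hnorm
      push_cast at h
      simpa [hAK, hk] using h
    have ht0 : θ t ≠ 0 := by
      intro h
      exact hK3 (by rw [← htN, h]; ring)
    have hy0 : θ (-(1 + 2 * ω)) ≠ 0 := by
      intro h
      rw [h] at hy
      exact hK3 (by linear_combination hy)
    have hX : θ (z.norm * z) ^ ((q ^ 2 - 1) / 3) = 1 := by
      have h : θ t ^ 3 * θ (z.norm * z) = θ (-(1 + 2 * ω)) ^ 3 := by
        rw [map_mul]
        linear_combination θ t * θ z * htN + 3 * htz - θ (-(1 + 2 * ω)) * hy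
      have h' := congrArg (· ^ ((q ^ 2 - 1) / 3)) h
      simpa only [mul_pow, ← pow_mul, Nat.mul_div_cancel' hE, map_pow_sq_sub_one hq3 θ ht0,
        map_pow_sq_sub_one hq3 θ hy0, one_mul] using h'
    refine eq_of_map_eq hK3 θ (hψ3 q hqA) (by rw [← pow_mul, mul_comm, pow_mul, hu, one_pow]) ?_
    rw [hψ q hqA hq3 θ, mul_left_comm, map_mul, mul_pow, hX, mul_one, map_pow]
  have hmul (n : ℕ) (hn : n ∣ A) : ψ n = u ^ ((n ^ 2 - 1) / 3) := by
    induction n using induction_on_primes with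
    | zero => simp [Nat.eq_zero_of_zero_dvd hn] at h3
    | one => simp
    | prime_mul p n hp ih =>
      have h3p : ¬ 3 ∣ p := fun h ↦ h3 (h.trans (dvd_of_mul_right_dvd hn))
      have h3n : ¬ 3 ∣ n := fun h ↦ h3 (h.trans (dvd_of_mul_left_dvd hn))
      rw [map_mul, hprime p hp (dvd_of_mul_right_dvd hn), ih (dvd_of_mul_left_dvd hn), ← pow_add]
      refine pow_eq_pow_of_modEq ?_ hu
      have hp2 := Nat.div_add_mod (p ^ 2) 3
      have hn2 := Nat.div_add_mod (n ^ 2) 3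
      rw [sq_mod_three h3p] at hp2
      rw [sq_mod_three h3n] at hn2
      rw [mul_pow, ← hp2, ← hn2]
      generalize p ^ 2 / 3 = a
      generalize n ^ 2 / 3 = b
      have : (3 * a + 1) * (3 * b + 1) - 1 = 3 * (a + b + 3 * (a * b)) := by
        rw [Nat.sub_eq_iff_eq_add (by nlinarith)]
        ring
      rw [this]
      simp only [Nat.add_sub_cancel, Nat.mul_div_cancel_left _ (show 0 < 3 by norm_num)]
      simp [Nat.ModEq]
  have h := hmul A dvd_rfl
  rw [hψA] at h
  have hdvd3 := hu1 ▸ orderOf_dvd_of_pow_eq_one h.symm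
  have := sq_mod_three h3
  omega

end Eisenstein

/-- Theorem 1.3: if `3 ∤ A` and `A² ≢ 1 (mod 9)`, then for infinitely many primes `p`
(not dividing `3A`), the ratio `ord_p(A)/ord_p(-3)` is an integer multiple of `3`. -/
theorem ratio_multiple_of_three (A : ℤ) (h3 : ¬ (3 : ℤ) ∣ A)
    (h9 : ¬ A ^ 2 ≡ 1 [ZMOD 9]) :
    {p : ℕ | p.Prime ∧ ¬ (p : ℤ) ∣ 3 * A ∧
      orderOf ((-3 : ZMod p)) ∣ orderOf ((A : ZMod p)) ∧
      3 ∣ orderOf ((A : ZMod p)) / orderOf ((-3 : ZMod p))}.Infinite := by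
  refine Set.infinite_of_forall_exists_gt fun N ↦ ?_
  have hA0 : A.natAbs ≠ 0 := by omega
  have h9' : ¬ 9 ∣ A.natAbs ^ 2 - 1 := by
    intro h
    apply h9
    have h1 : 1 ≤ A.natAbs ^ 2 := Nat.one_le_pow _ _ (by omega)
    rw [← Int.natAbs_sq]
    refine ((Int.modEq_iff_dvd).mpr ?_).symm
    have h' : ((9 : ℕ) : ℤ) ∣ ((A.natAbs ^ 2 - 1 : ℕ) : ℤ) := Int.natCast_dvd_natCast.mpr h
    rw [Nat.cast_sub h1] at h'
    exact_mod_cast h'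
  obtain ⟨p, hp, hpdvd, hcube⟩ := Eisenstein.exists_prime_not_cube (A := A.natAbs) (k := 3 * N.factorial)
    (by positivity) (by omega) h9'
  have hcubeA : ¬ ∃ x : ZMod p, x ^ 3 = A := by
    rintro ⟨x, hx⟩
    rcases Int.natAbs_eq A with h | h
    · refine hcube ⟨x, ?_⟩
      rw [hx]
      conv_lhs => rw [h]
      exact Int.cast_natCast _
    · refine hcube ⟨-x, ?_⟩
      rw [Odd.neg_pow (by decide), hx]
      conv_lhs => rw [h]
      rw [Int.cast_neg, neg_neg, Int.cast_natCast]
  have hp2 : p ≠ 2 := by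
    rintro rfl
    exact hcubeA ⟨(A : ZMod 2), by generalize (A : ZMod 2) = x; revert x; decide⟩
  have hp3 : p ≠ 3 := by
    rintro rfl
    exact hcubeA ⟨(A : ZMod 3), by generalize (A : ZMod 3) = x; revert x; decide⟩
  have := Fact.mk hp
  have hpA : (A : ZMod p) ≠ 0 := fun h ↦ hcubeA ⟨0, by rw [h]; simp⟩
  have hpow : (-3 : ZMod p) = (A : ZMod p) ^ (2 * (3 * N.factorial)) := by
    have h : (p : ℤ) ∣ A ^ (2 * (3 * N.factorial)) + 3 := by
      rw [pow_mul, ← Int.natAbs_sq, ← pow_mul]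
      exact_mod_cast hpdvd
    rw [← ZMod.intCast_zmod_eq_zero_iff_dvd] at h
    push_cast at h
    linear_combination -h
  have hord3 : 3 ∣ orderOf (A : ZMod p) := by
    by_contra h
    obtain ⟨m, hm⟩ := exists_pow_eq_self_of_coprime
      ((Nat.Prime.coprime_iff_not_dvd Nat.prime_three).mpr h)
    exact hcubeA ⟨(A : ZMod p) ^ m, by rw [← pow_mul, mul_comm, pow_mul, hm]⟩
  refine ⟨p, ⟨hp, ?_, ?_, ?_⟩, ?_⟩
  · rw [← ZMod.intCast_zmod_eq_zero_iff_dvd]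
    push_cast
    exact mul_ne_zero (Eisenstein.three_ne_zero_of_ne hp3) hpA
  · rw [hpow]
    exact orderOf_pow_dvd _
  · rw [hpow, orderOf_pow' _ (by positivity),
      Nat.div_div_self (Nat.gcd_dvd_left _ _) (orderOf_pos_iff.mpr ?_).ne']
    · exact Nat.dvd_gcd hord3 ⟨2 * N.factorial, by ring⟩
    · exact isOfFinOrder_iff_pow_eq_one.mpr
        ⟨p - 1, by have := hp.two_le; omega, ZMod.pow_card_sub_one_eq_one hpA⟩
  · by_contra! hle
    have hdvd : p - 1 ∣ 2 * (3 * N.factorial) := by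
      refine Dvd.dvd.mul_left (Dvd.dvd.mul_left ?_ _) _
      exact Nat.dvd_factorial (by have := hp.two_le; omega) (by omega)
    obtain ⟨c, hc⟩ := hdvd
    rw [hc, pow_mul, ZMod.pow_card_sub_one_eq_one hpA, one_pow] at hpow
    have h4 : ((2 ^ 2 : ℕ) : ZMod p) = 0 := by
      push_cast
      linear_combination -hpow
    rw [ZMod.natCast_eq_zero_iff] at h4
    exact hp2 ((Nat.prime_dvd_prime_iff_eq hp Nat.prime_two).mp (hp.dvd_of_dvd_pow h4))
end

section
/- Let A be an integer with 3 ∤ A and A² ≢ 1 (mod 9). Then there are infinitely many primes p not dividing 3A with ord_p(A) > ord_p(-3), and there are infinitely many primes p not dividing 3A with ord_p(A) > ord_p(3). -/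
/-- The ring of Eisenstein integers `ℤ[ω]`, with `ω ^ 2 = -1 - ω`. -/
abbrev EisensteinInt : Type := QuadraticAlgebra ℤ (-1) (-1)

namespace EisensteinInt

open QuadraticAlgebra hiding norm norm_zero norm_one norm_neg norm_star norm_natCast norm_intCast

local notation "𝓔" => EisensteinInt

local notation "ζ" => (QuadraticAlgebra.omega : EisensteinInt)

theorem norm_eq (z : 𝓔) : z.norm = z.re ^ 2 - z.re * z.im + z.im ^ 2 := by
  rw [norm_def]; ring

theorem norm_nonneg (z : 𝓔) : 0 ≤ z.norm := by
  rw [norm_eq]; nlinarith [sq_nonneg (2 * z.re - z.im), sq_nonneg z.im]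

theorem norm_eq_zero {z : 𝓔} : z.norm = 0 ↔ z = 0 := by
  refine ⟨fun h => ?_, fun h => by rw [h, QuadraticAlgebra.norm_zero]⟩
  rw [norm_eq] at h
  have him : z.im = 0 := by
    nlinarith [sq_nonneg (2 * z.re - z.im), sq_nonneg z.im]
  have hre : z.re = 0 := by simpa [him] using h
  ext <;> simp [him, hre]

instance : IsDomain 𝓔 :=
  have : NoZeroDivisors 𝓔 := ⟨fun {a b} h => by
    simpa only [map_mul, mul_eq_zero, norm_eq_zero] using norm_eq_zero.2 h⟩
  NoZeroDivisors.to_isDomain _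

theorem norm_pos {z : 𝓔} (hz : z ≠ 0) : 0 < z.norm :=
  (norm_nonneg z).lt_of_ne' (mt norm_eq_zero.1 hz)

theorem mul_star_eq_norm (z : 𝓔) : z * star z = (z.norm : 𝓔) :=
  (algebraMap_norm_eq_mul_star z).symm

/-- Division with remainder by an Eisenstein integer, rounding both coordinates. -/
theorem exists_norm_sub_mul_lt (x : 𝓔) {y : 𝓔} (hy : y ≠ 0) :
    ∃ c : 𝓔, (x - y * c : 𝓔).norm < y.norm := by
  have hn := norm_pos hy
  have round (z : ℤ) : ∃ c : ℤ, -y.norm ≤ 2 * (z - y.norm * c) ∧ 2 * (z - y.norm * c) ≤ y.norm := by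
    refine ⟨(2 * z + y.norm) / (2 * y.norm), ?_⟩
    have h1 := Int.mul_ediv_add_emod (2 * z + y.norm) (2 * y.norm)
    have h2 := Int.emod_nonneg (2 * z + y.norm) (b := 2 * y.norm) (by lia)
    have h3 := Int.emod_lt_of_pos (2 * z + y.norm) (b := 2 * y.norm) (by lia)
    constructor <;> linarith
  obtain ⟨z, hz⟩ : ∃ z, z = x * star y := ⟨_, rfl⟩
  obtain ⟨c, hc1, hc2⟩ := round z.re
  obtain ⟨d, hd1, hd2⟩ := round z.im
  refine ⟨⟨c, d⟩, ?_⟩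
  have key : (x - y * ⟨c, d⟩ : 𝓔).norm * y.norm = (z - (y.norm : 𝓔) * ⟨c, d⟩ : 𝓔).norm := by
    rw [← mul_star_eq_norm, ← QuadraticAlgebra.norm_star y, ← map_mul, hz]
    congr 1
    ring
  rw [norm_eq (z - _)] at key
  simp only [re_sub, im_sub, re_mul, im_mul, re_intCast, im_intCast, zero_mul, mul_zero,
    add_zero, Int.cast_id] at key
  generalize z.re - y.norm * c = r at *
  generalize z.im - y.norm * d = s at *
  have h1 : 4 * r ^ 2 ≤ y.norm ^ 2 := by nlinarith
  have h2 : 4 * s ^ 2 ≤ y.norm ^ 2 := by nlinarith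
  have h3 : -(4 * (r * s)) ≤ y.norm ^ 2 := by
    nlinarith [mul_nonneg (sub_nonneg.2 hc1) (sub_nonneg.2 hd1),
      mul_nonneg (sub_nonneg.2 hc2) (sub_nonneg.2 hd2)]
  nlinarith

noncomputable instance : EuclideanDomain 𝓔 where
  quotient x y := by
    classical exact if hy : y = 0 then 0 else (exists_norm_sub_mul_lt x hy).choose
  quotient_zero x := by simp
  remainder x y := by
    classical exact x - y * if hy : y = 0 then 0 else (exists_norm_sub_mul_lt x hy).choose
  quotient_mul_add_remainder_eq x y := by ring
  r x y := (x.norm).toNat < (y.norm).toNat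
  r_wellFounded := (measure fun x : 𝓔 => (x.norm).toNat).wf
  remainder_lt x y hy := by
    have := (exists_norm_sub_mul_lt x hy).choose_spec
    have := norm_pos hy
    simp only [dif_neg hy]
    lia
  mul_left_not_lt x y hy := by
    have h1 := norm_pos hy
    have h2 := norm_nonneg x
    have : x.norm ≤ (x * y).norm := by rw [map_mul]; nlinarith
    lia

theorem eq_of_isUnit {u : 𝓔} (hu : IsUnit u) :
    ∃ s : ℤ, s ^ 2 = 1 ∧ (u = s ∨ u = s * ζ ∨ u = s * ζ ^ 2) := by
  have h : u.norm = 1 := by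
    have h1 := isUnit_iff_norm_isUnit.1 hu
    have := norm_nonneg u
    rcases Int.isUnit_iff.1 h1 with h | h <;> lia
  rw [norm_eq] at h
  have h1 : u.re ≤ 1 := by nlinarith [sq_nonneg (2 * u.im - u.re)]
  have h2 : -1 ≤ u.re := by nlinarith [sq_nonneg (2 * u.im - u.re)]
  have h3 : u.im ≤ 1 := by nlinarith [sq_nonneg (2 * u.re - u.im)]
  have h4 : -1 ≤ u.im := by nlinarith [sq_nonneg (2 * u.re - u.im)]
  have key : u.im = 0 ∧ u.re ^ 2 = 1 ∨ u.re = 0 ∧ u.im ^ 2 = 1 ∨ u.re = u.im ∧ u.im ^ 2 = 1 := by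
    generalize u.re = a at *
    generalize u.im = b at *
    interval_cases a <;> interval_cases b <;> simp_all
  rcases key with ⟨h5, h6⟩ | ⟨h5, h6⟩ | ⟨h5, h6⟩
  · exact ⟨u.re, h6, .inl <| by ext <;> simp [h5]⟩
  · exact ⟨u.im, h6, .inr <| .inl <| by ext <;> simp [h5]⟩
  · exact ⟨-u.im, by simpa using h6, .inr <| .inr <| by
      ext <;> simp [h5, pow_two, omega_mul_omega_eq_mk]⟩

theorem zeta_sq_add_zeta_add_one : ζ ^ 2 + ζ + 1 = 0 := by
  ext <;> simp [pow_two]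

theorem zeta_pow_three : ζ ^ 3 = 1 := by
  linear_combination (ζ - 1) * zeta_sq_add_zeta_add_one

theorem zeta_ne_one : ζ ≠ 1 := fun h => by
  simpa using congrArg QuadraticAlgebra.im h

theorem isPrimitiveRoot_zeta : IsPrimitiveRoot ζ 3 :=
  (IsPrimitiveRoot.iff_orderOf).2 <| orderOf_eq_prime zeta_pow_three zeta_ne_one

theorem star_zeta : star ζ = ζ ^ 2 := by
  ext <;> simp [pow_two]

theorem map_zeta_isPrimitiveRoot {k : Type*} [Field k] (h3 : (3 : k) ≠ 0) (φ : 𝓔 →+* k) :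
    IsPrimitiveRoot (φ ζ) 3 := by
  refine (IsPrimitiveRoot.iff_orderOf).2 <| orderOf_eq_prime ?_ fun h => h3 ?_
  · rw [← map_pow, zeta_pow_three, map_one]
  · have := congrArg φ zeta_sq_add_zeta_add_one
    simp only [map_add, map_pow, h, map_one, map_zero] at this
    linear_combination this

/-- A homomorphism to a field of characteristic other than three is injective on cube roots of
unity. -/
theorem eq_of_pow_three_eq_one {k : Type*} [Field k] (h3 : (3 : k) ≠ 0) (φ : 𝓔 →+* k) {x y : 𝓔}
    (hx : x ^ 3 = 1) (hy : y ^ 3 = 1) (h : φ x = φ y) : x = y := by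
  obtain ⟨i, hi, rfl⟩ := isPrimitiveRoot_zeta.eq_pow_of_pow_eq_one hx
  obtain ⟨j, hj, rfl⟩ := isPrimitiveRoot_zeta.eq_pow_of_pow_eq_one hy
  rw [map_pow, map_pow] at h
  rw [(map_zeta_isPrimitiveRoot h3 φ).pow_inj hi hj h]

theorem mul_star_of_pow_three {x : 𝓔} (hx : x ^ 3 = 1) : x * star x = 1 := by
  obtain ⟨i, hi, rfl⟩ := isPrimitiveRoot_zeta.eq_pow_of_pow_eq_one hx
  rw [star_pow, star_zeta, ← mul_pow, ← pow_succ', zeta_pow_three, one_pow]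

theorem ne_one_of_orderOf {p : ℕ} {χ : MulChar (ZMod p) 𝓔} (hχ : orderOf χ = 3) : χ ≠ 1 :=
  fun h => by simp [h] at hχ

section Characters

variable {p : ℕ} [Fact p.Prime]

theorem gaussSum_pow_sq_char {k : Type*} [Field k] (q : ℕ) [Fact q.Prime] [CharP k q]
    (hpq : p ≠ q) {χ : MulChar (ZMod p) k} (hχ : orderOf χ = 3) {ψ : AddChar (ZMod p) k}
    (hψ : ψ.IsPrimitive) {e : ℕ} (he : 3 * e + 1 = q ^ 2) :
    (p * jacobiSum χ χ) ^ e = χ q := by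
  have h3 : χ ^ 3 = 1 := hχ ▸ pow_orderOf_eq_one χ
  have hq : IsUnit (q : ZMod p) := by
    rw [ZMod.isUnit_iff_coprime]
    exact ((Nat.coprime_primes (Fact.out : q.Prime) (Fact.out : p.Prime)).2 hpq.symm)
  have hval {x : ZMod p} (hx : IsUnit x) : χ x ^ 3 = 1 := by
    rw [← MulChar.pow_apply' _ three_ne_zero, h3, MulChar.one_apply hx]
  have hneg : χ (-1) = 1 := by
    have h1 := hval (x := -1) (isUnit_one.neg)
    have h2 : χ (-1) ^ 2 = 1 := by rw [← map_pow]; simp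
    linear_combination h1 - χ (-1) * h2
  have hχ1 : χ ≠ 1 := fun h => by simp [h] at hχ
  have hg : gaussSum χ ψ ≠ 0 := by
    refine gaussSum_ne_zero_of_nontrivial ?_ hχ1 hψ
    rw [ZMod.card, Ne, CharP.cast_eq_zero_iff k q,
      Nat.prime_dvd_prime_iff_eq Fact.out Fact.out]
    exact hpq.symm
  have hg3 : gaussSum χ ψ ^ 3 = p * jacobiSum χ χ := by
    have := gaussSum_pow_eq_prod_jacobiSum (χ := χ) (by lia) hψ
    simpa [hχ, hneg, ZMod.card] using this
  have hfrob : χ q ^ 2 * gaussSum χ ψ ^ q ^ 2 = gaussSum χ ψ := by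
    rw [pow_two q, pow_mul, gaussSum_frob, gaussSum_frob, ← pow_mul, ← pow_mul, ← pow_two, ← he,
      pow_succ χ, pow_mul χ, h3, one_pow, one_mul, he, AddChar.pow_mulShift, ← map_pow,
      ← Nat.cast_pow]
    rw [Nat.cast_pow, ← (hq.pow 2).unit_spec]
    exact gaussSum_mulShift _ _ _
  rw [← hg3]
  rw [← he, pow_succ (gaussSum χ ψ), pow_mul] at hfrob
  have h4 : χ q ^ 2 * (gaussSum χ ψ ^ 3) ^ e = 1 :=
    mul_right_cancel₀ hg (by rw [one_mul, mul_assoc]; exact hfrob)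
  linear_combination χ q * h4 - (gaussSum χ ψ ^ 3) ^ e * hval hq

theorem jacobiSum_pow_sq_char {k : Type*} [Field k] (q : ℕ) [Fact q.Prime] [CharP k q]
    (hpq : p ≠ q) {χ : MulChar (ZMod p) k} (hχ : orderOf χ = 3) {e : ℕ}
    (he : 3 * e + 1 = q ^ 2) : (p * jacobiSum χ χ) ^ e = χ q := by
  have hchar : ringChar k ≠ ringChar (ZMod p) := by
    rw [ringChar.eq k q, ringChar.eq (ZMod p) p]
    exact hpq.symm
  let ψ := AddChar.FiniteField.primitiveChar (ZMod p) k hchar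
  let K := CyclotomicField ψ.n k
  have hinj := (algebraMap k K).injective
  have : CharP K q := charP_of_injective_algebraMap hinj q
  have hχ' : orderOf (χ.ringHomComp (algebraMap k K)) = 3 := by
    rw [← hχ]
    exact orderOf_injective (MulChar.ringHomCompHom _) (MulChar.injective_ringHomComp hinj) χ
  have := gaussSum_pow_sq_char q hpq hχ' ψ.prim he
  apply hinj
  simpa [jacobiSum_ringHomComp] using this

variable {χ : MulChar (ZMod p) 𝓔}

theorem apply_pow_three (hχ : orderOf χ = 3) {x : ZMod p} (hx : IsUnit x) : χ x ^ 3 = 1 := by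
  rw [← MulChar.pow_apply' _ three_ne_zero, ← hχ, pow_orderOf_eq_one, MulChar.one_apply hx]

theorem ringHomComp_star_eq_inv (hχ : orderOf χ = 3) :
    χ.ringHomComp (starRingEnd 𝓔) = χ⁻¹ := by
  rw [eq_inv_iff_mul_eq_one]
  ext1 x
  have := mul_star_of_pow_three (apply_pow_three hχ x.isUnit)
  rwa [MulChar.mul_apply, MulChar.ringHomComp_apply, starRingEnd_apply, MulChar.one_apply_coe,
    mul_comm]

theorem star_jacobiSum (hχ : orderOf χ = 3) : star (jacobiSum χ χ) = jacobiSum χ⁻¹ χ⁻¹ := by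
  rw [← ringHomComp_star_eq_inv hχ, jacobiSum_ringHomComp, starRingEnd_apply]

theorem norm_jacobiSum (hχ : orderOf χ = 3) : (jacobiSum χ χ).norm = p := by
  let K := FractionRing 𝓔
  have hinj : Function.Injective (algebraMap 𝓔 K) := IsFractionRing.injective 𝓔 K
  have hne {χ : MulChar (ZMod p) 𝓔} (h : χ ≠ 1) : χ.ringHomComp (algebraMap 𝓔 K) ≠ 1 :=
    (MulChar.ringHomComp_ne_one_iff hinj).2 h
  have hsq : χ * χ ≠ 1 := fun h => by
    have := orderOf_dvd_of_pow_eq_one ((pow_two χ).trans h)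
    rw [hχ] at this
    revert this
    decide
  have : CharZero K := charZero_of_injective_algebraMap hinj
  have hchar : ringChar K ≠ ringChar (ZMod p) := by
    rw [ringChar.eq_zero, ringChar.eq (ZMod p) p]
    exact (Fact.out : p.Prime).ne_zero.symm
  have := jacobiSum_mul_jacobiSum_inv hchar (hne (ne_one_of_orderOf hχ))
    (hne (ne_one_of_orderOf hχ)) (by rw [← MulChar.ringHomComp_mul]; exact hne hsq)
  rw [MulChar.ringHomComp_inv, jacobiSum_ringHomComp, jacobiSum_ringHomComp, ← map_mul,
    ← star_jacobiSum hχ, mul_star_eq_norm, ZMod.card, ← map_natCast (algebraMap 𝓔 K)] at this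
  have := hinj this
  exact_mod_cast this

theorem three_dvd_im_jacobiSum (hχ : orderOf χ = 3) : 3 ∣ (jacobiSum χ χ).im := by
  have h3 : χ ^ 3 = 1 := hχ ▸ pow_orderOf_eq_one χ
  obtain ⟨z, -, hz⟩ := exists_jacobiSum_eq_neg_one_add (by norm_num) h3 h3
    (hχ ▸ χ.orderOf_dvd_card_sub_one) isPrimitiveRoot_zeta
  have : (ζ - 1) ^ 2 = (3 : ℤ) * -ζ := by
    push_cast
    linear_combination zeta_sq_add_zeta_add_one
  rw [hz, this]
  exact ⟨(z * -ζ).im, by simp; ring⟩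

theorem map_star_jacobiSum_pow {k : Type*} [Field k] (q : ℕ) [Fact q.Prime] [CharP k q]
    (hpq : p ≠ q) (h3 : (3 : k) ≠ 0) (hχ : orderOf χ = 3) {e : ℕ} (he : 3 * e + 1 = q ^ 2)
    (φ : 𝓔 →+* k) :
    φ (star (jacobiSum χ χ)) ^ e = φ (χ q) * φ (jacobiSum χ χ) ^ e := by
  have hcube : χ ^ 3 = 1 := hχ ▸ pow_orderOf_eq_one χ
  have hq : IsUnit (q : ZMod p) := by
    rw [ZMod.isUnit_iff_coprime]
    exact ((Nat.coprime_primes (Fact.out : q.Prime) (Fact.out : p.Prime)).2 hpq.symm)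
  have hord : orderOf (χ.ringHomComp φ) = 3 := by
    refine orderOf_eq_prime ?_ fun h => ne_one_of_orderOf hχ ?_
    · rw [MulChar.ringHomComp_pow, hcube, MulChar.ringHomComp_one]
    · ext1 x
      have := congrArg (fun χ => χ (x : ZMod p)) h
      simp only [MulChar.ringHomComp_apply, MulChar.one_apply_coe] at this ⊢
      exact eq_of_pow_three_eq_one h3 φ (apply_pow_three hχ x.isUnit) (one_pow 3)
        (this.trans (map_one φ).symm)
  have h1 := jacobiSum_pow_sq_char q hpq hord he
  have h2 := jacobiSum_pow_sq_char q hpq ((orderOf_inv _).trans hord) he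
  rw [MulChar.ringHomComp_inv, jacobiSum_ringHomComp, ← star_jacobiSum hχ] at h2
  rw [jacobiSum_ringHomComp] at h1
  have hp : (p : k) ^ e ≠ 0 := by
    refine pow_ne_zero _ ?_
    rw [Ne, CharP.cast_eq_zero_iff k q, Nat.prime_dvd_prime_iff_eq Fact.out Fact.out]
    exact hpq.symm
  rw [mul_pow, MulChar.ringHomComp_apply] at h1 h2
  apply mul_left_cancel₀ hp
  rw [h2, mul_left_comm, h1, ← map_mul, ← pow_two, ← MulChar.pow_apply' _ two_ne_zero]
  congr 2
  rw [inv_eq_iff_mul_eq_one, ← pow_succ', hcube]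

end Characters

/-- `x` is congruent to a rational integer modulo three, and `f` is the cubic residue character of
`x` restricted to the natural numbers, for which a form of cubic reciprocity holds. -/
structure IsReciprocal (x : 𝓔) (f : ℕ →* 𝓔) : Prop where
  three_dvd_im : 3 ∣ x.im
  apply_eq_one : ∀ n : ℕ,
    (∀ p : ℕ, p.Prime → (p : ℤ) ∣ x.norm → ¬ 3 ∣ orderOf (n : ZMod p)) → f n = 1
  apply_pow_three : ∀ q : ℕ, q.Prime → ¬ (q : ℤ) ∣ x.norm → f q ^ 3 = 1
  map_star_pow : ∀ q : ℕ, q.Prime → ¬ (q : ℤ) ∣ x.norm →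
    ∀ (k : Type) [Field k] [CharP k q], (3 : k) ≠ 0 → ∀ (φ : 𝓔 →+* k) (e : ℕ),
      3 * e + 1 = q ^ 2 → φ (star x) ^ e = φ (f q) * φ x ^ e

theorem IsReciprocal.mul {x y : 𝓔} {f g : ℕ →* 𝓔} (hx : IsReciprocal x f)
    (hy : IsReciprocal y g) : IsReciprocal (x * y) (f * g) where
  three_dvd_im := by
    obtain ⟨a, ha⟩ := hx.three_dvd_im
    obtain ⟨b, hb⟩ := hy.three_dvd_im
    rw [im_mul, ha, hb]
    exact ⟨x.re * b + a * y.re - 3 * a * b, by ring⟩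
  apply_eq_one n h := by
    rw [map_mul] at h
    rw [MonoidHom.mul_apply, hx.apply_eq_one n fun p hp hd => h p hp (hd.mul_right _),
      hy.apply_eq_one n fun p hp hd => h p hp (hd.mul_left _), one_mul]
  apply_pow_three q hq h := by
    rw [map_mul] at h
    rw [MonoidHom.mul_apply, mul_pow, hx.apply_pow_three q hq fun hd => h (hd.mul_right _),
      hy.apply_pow_three q hq fun hd => h (hd.mul_left _), one_mul]
  map_star_pow q hq h k _ _ h3 φ e he := by
    rw [map_mul] at h
    have h1 := hx.map_star_pow q hq (fun hd => h (hd.mul_right _)) k h3 φ e he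
    have h2 := hy.map_star_pow q hq (fun hd => h (hd.mul_left _)) k h3 φ e he
    rw [star_mul', map_mul, mul_pow, h1, h2, MonoidHom.mul_apply, map_mul, map_mul]
    ring

theorem isReciprocal_natCast (c : ℕ) : IsReciprocal c 1 where
  three_dvd_im := by simp
  apply_eq_one _ _ := rfl
  apply_pow_three _ _ _ := one_pow 3
  map_star_pow q _ _ k _ _ _ φ e _ := by
    rw [star_natCast, MonoidHom.one_apply, map_one, one_mul]

theorem isReciprocal_jacobiSum {p : ℕ} [Fact p.Prime] {χ : MulChar (ZMod p) 𝓔}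
    (hχ : orderOf χ = 3) :
    IsReciprocal (jacobiSum χ χ)
      (χ.toMonoidHom.comp (Nat.castRingHom (ZMod p) : ℕ →* ZMod p)) where
  three_dvd_im := three_dvd_im_jacobiSum hχ
  apply_eq_one n h := by
    change χ (n : ZMod p) = 1
    have h := h p Fact.out (by rw [norm_jacobiSum hχ])
    have hn : orderOf (n : ZMod p) ≠ 0 := fun h0 => h (h0 ▸ dvd_zero 3)
    have hu : IsUnit (n : ZMod p) := IsUnit.of_pow_eq_one (pow_orderOf_eq_one _) hn
    have h1 : χ n ^ orderOf (n : ZMod p) = 1 := by rw [← map_pow, pow_orderOf_eq_one, map_one]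
    have h2 := apply_pow_three hχ hu
    have := ((Nat.Prime.coprime_iff_not_dvd Nat.prime_three).2 h)
    rw [← orderOf_eq_one_iff]
    exact Nat.eq_one_of_dvd_coprimes this (orderOf_dvd_of_pow_eq_one h2)
      (orderOf_dvd_of_pow_eq_one h1)
  apply_pow_three q hq h := by
    change χ (q : ZMod p) ^ 3 = 1
    rw [norm_jacobiSum hχ] at h
    refine EisensteinInt.apply_pow_three hχ ((ZMod.isUnit_iff_coprime _ _).2 ?_)
    exact (Nat.Prime.coprime_iff_not_dvd hq).2 (mod_cast h)
  map_star_pow q hq h k _ _ h3 φ e he := by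
    have : Fact q.Prime := ⟨hq⟩
    rw [norm_jacobiSum hχ] at h
    refine map_star_jacobiSum_pow q ?_ h3 hχ he φ
    rintro rfl
    exact h dvd_rfl

theorem isUnit_of_norm_eq_one {x : 𝓔} (h : x.norm = 1) : IsUnit x :=
  isUnit_iff_norm_isUnit.2 (h.symm ▸ isUnit_one)

theorem exists_isReciprocal_of_dvd {π y : 𝓔} {f : ℕ →* 𝓔} (hy : IsReciprocal y f) (h : π ∣ y)
    (hn : π.norm = y.norm) (hπ : π ≠ 0) :
    ∃ u y f, IsUnit u ∧ IsReciprocal y f ∧ π = u * y := by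
  obtain ⟨c, rfl⟩ := h
  have hc : IsUnit c := isUnit_of_norm_eq_one <| by
    rw [map_mul] at hn
    exact (mul_left_cancel₀ (norm_pos hπ).ne' (hn.symm.trans (mul_one _).symm))
  obtain ⟨v, rfl⟩ := hc
  refine ⟨(v⁻¹ : 𝓔ˣ), _, f, v⁻¹.isUnit, hy, ?_⟩
  rw [mul_left_comm, Units.inv_mul, mul_one]

theorem exists_isReciprocal_of_prime {π : 𝓔} (hπ : Prime π) (h3 : ¬ 3 ∣ π.norm) :
    ∃ u y f, IsUnit u ∧ IsReciprocal y f ∧ π = u * y := by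
  have hpos := norm_pos hπ.ne_zero
  obtain ⟨p, hp, hdvd⟩ : ∃ p : ℕ, p.Prime ∧ π ∣ (p : 𝓔) := by
    have h : π ∣ ((π.norm.toNat : ℕ) : 𝓔) := by
      refine ⟨star π, ?_⟩
      rw [mul_star_eq_norm, ← Int.cast_natCast, Int.toNat_of_nonneg hpos.le]
    rw [← Nat.prod_primeFactorsList (n := π.norm.toNat) (by lia), Nat.cast_list_prod] at h
    obtain ⟨a, ha, h⟩ := (hπ.dvd_prod_iff).1 h
    obtain ⟨p, hp, rfl⟩ := List.mem_map.1 ha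
    exact ⟨p, Nat.prime_of_mem_primeFactorsList hp, h⟩
  have : Fact p.Prime := ⟨hp⟩
  have hnorm : π.norm.natAbs ∣ p ^ 2 := by
    have := map_dvd (QuadraticAlgebra.norm (R := ℤ) (a := -1) (b := -1)) hdvd
    rw [QuadraticAlgebra.norm_natCast] at this
    exact_mod_cast Int.natAbs_dvd_natAbs.2 this
  obtain ⟨i, hi, hnorm⟩ := (Nat.dvd_prime_pow hp).1 hnorm
  have hnorm : π.norm = p ^ i := by
    rw [← Int.natAbs_of_nonneg hpos.le, hnorm, Nat.cast_pow]
  interval_cases i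
  · exact absurd (isUnit_of_norm_eq_one (by simpa using hnorm)) hπ.not_isUnit
  · rw [pow_one] at hnorm
    have hp3 : 3 ∣ Fintype.card (ZMod p) - 1 := by
      rw [ZMod.card]
      have h1 := norm_eq π
      rw [hnorm] at h1 h3
      have h2 : ((p : ℤ) : ZMod 3) = 0 ∨ ((p : ℤ) : ZMod 3) = 1 := by
        rw [h1]
        push_cast
        generalize (π.re : ZMod 3) = a
        generalize (π.im : ZMod 3) = b
        revert a b
        decide
      have h4 : ¬ ((p : ℤ) : ZMod 3) = 0 := by
        rwa [ZMod.intCast_zmod_eq_zero_iff_dvd]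
      have h5 := h2.resolve_left h4
      rw [← Int.cast_one, ZMod.intCast_eq_intCast_iff_dvd_sub] at h5
      have := hp.pos
      push_cast at h5
      lia
    obtain ⟨χ, hχ⟩ := MulChar.exists_mulChar_orderOf (ZMod p) hp3 isPrimitiveRoot_zeta
    have hmul : jacobiSum χ χ * jacobiSum χ⁻¹ χ⁻¹ = p := by
      rw [← star_jacobiSum hχ, mul_star_eq_norm, norm_jacobiSum hχ, Int.cast_natCast]
    rw [← hmul] at hdvd
    have hχ' : orderOf χ⁻¹ = 3 := (orderOf_inv χ).trans hχ
    rcases hπ.dvd_or_dvd hdvd with h | h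
    · exact exists_isReciprocal_of_dvd (isReciprocal_jacobiSum hχ) h
        (hnorm.trans (norm_jacobiSum hχ).symm) hπ.ne_zero
    · exact exists_isReciprocal_of_dvd (isReciprocal_jacobiSum hχ') h
        (hnorm.trans (norm_jacobiSum hχ').symm) hπ.ne_zero
  · exact exists_isReciprocal_of_dvd (isReciprocal_natCast p) hdvd
      (by rw [hnorm, QuadraticAlgebra.norm_natCast]) hπ.ne_zero

theorem exists_isReciprocal {x : 𝓔} (hx : ¬ 3 ∣ x.norm) :
    ∃ u y f, IsUnit u ∧ IsReciprocal y f ∧ x = u * y := by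
  induction x using UniqueFactorizationMonoid.induction_on_prime with
  | h₁ => simp at hx
  | h₂ x h => exact ⟨x, _, 1, h, isReciprocal_natCast 1, by simp⟩
  | h₃ a π _ hπ ih =>
    rw [map_mul] at hx
    obtain ⟨u, y, f, hu, hy, rfl⟩ := ih fun h => hx (h.mul_left _)
    obtain ⟨v, z, g, hv, hz, rfl⟩ := exists_isReciprocal_of_prime hπ fun h => hx (h.mul_right _)
    exact ⟨v * u, _, _, hv.mul hu, hz.mul hy, by ring⟩

theorem exists_ringHom (k : Type*) [Field k] [IsAlgClosed k] : Nonempty (𝓔 →+* k) := by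
  have hdeg : (Polynomial.X ^ 2 + Polynomial.X + 1 : Polynomial k).degree = 2 := by
    compute_degree!
  obtain ⟨r, hr⟩ := IsAlgClosed.exists_root (Polynomial.X ^ 2 + Polynomial.X + 1 : Polynomial k)
    (by rw [hdeg]; decide)
  simp only [Polynomial.IsRoot, Polynomial.eval_add, Polynomial.eval_pow, Polynomial.eval_X,
    Polynomial.eval_one] at hr
  exact ⟨(QuadraticAlgebra.lift (R := ℤ) ⟨r, by
    simp only [neg_smul, one_smul]; linear_combination hr⟩).toRingHom⟩

theorem eq_mul_zeta_sq_of_re_im {t : ℕ} (ht : t % 3 = 1) {u y : 𝓔} (hu : IsUnit u)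
    (hy : 3 ∣ y.im) (h : (⟨t + 1, 2⟩ : 𝓔) = u * y) : ∃ s : ℤ, s ^ 2 = 1 ∧ u = s * ζ ^ 2 := by
  obtain ⟨s, hs, rfl | rfl | rfl⟩ := eq_of_isUnit hu
  · have := congrArg QuadraticAlgebra.im h
    simp only [im_mul, re_intCast, im_intCast, Int.cast_id] at this
    obtain ⟨c, hc⟩ := hy
    rw [hc] at this
    have : (3 : ℤ) ∣ 2 := ⟨s * c, by linear_combination this⟩
    lia
  · have h1 := congrArg QuadraticAlgebra.im h
    have h2 := congrArg QuadraticAlgebra.re h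
    obtain ⟨c, hc⟩ := hy
    simp [hc] at h1 h2
    have : (3 : ℤ) ∣ t + 1 := ⟨-(s * c), by linear_combination h2⟩
    lia
  · exact ⟨s, hs, rfl⟩

theorem apply_eq_zeta_pow {t : ℕ} {y : 𝓔} {f : ℕ →* 𝓔} (hy : IsReciprocal y f) {s : ℤ}
    (h : (⟨t + 1, 2⟩ : 𝓔) = s * ζ ^ 2 * y) {q : ℕ} (hq : q.Prime) (hq3 : q ≠ 3)
    (hqt : q ∣ t) (hqy : ¬ (q : ℤ) ∣ y.norm) {e : ℕ} (he : 3 * e + 1 = q ^ 2) : f q = ζ ^ e := by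
  have : Fact q.Prime := ⟨hq⟩
  let k := AlgebraicClosure (ZMod q)
  have : CharP k q := charP_of_injective_algebraMap (algebraMap (ZMod q) k).injective q
  obtain ⟨φ⟩ := exists_ringHom k
  have h3 : (3 : k) ≠ 0 := by
    have := CharP.cast_eq_zero_iff k q 3
    rw [Nat.prime_dvd_prime_iff_eq hq Nat.prime_three] at this
    exact_mod_cast mt this.1 hq3
  have hneg : (-1 : k) ^ e = 1 := by
    rcases hq.eq_two_or_odd with rfl | hodd
    · rw [CharTwo.neg_eq, one_pow]
    · refine Even.neg_one_pow ?_
      have : Odd (q ^ 2) := (Nat.odd_iff.2 hodd).pow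
      rw [← he] at this
      grind
  have ht : (t : k) = 0 := (CharP.cast_eq_zero_iff k q t).2 hqt
  have hz : φ ζ ^ 2 + φ ζ + 1 = 0 := by
    simpa using congrArg φ zeta_sq_add_zeta_add_one
  have hx : (⟨t + 1, 2⟩ : 𝓔) = t + 1 + 2 * ζ := by ext <;> simp
  have hx1 : φ s * φ ζ ^ 2 * φ y = 1 + 2 * φ ζ := by
    have := congrArg φ (h.symm.trans hx)
    simpa only [map_mul, map_add, map_pow, map_natCast, map_one, map_ofNat, ht, zero_add] using this
  have hx2 : φ s * φ ζ * φ (star y) = -1 * (1 + 2 * φ ζ) := by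
    have := congrArg φ (congrArg star (h.symm.trans hx))
    simp only [star_mul', star_add, star_pow, star_zeta, star_intCast, star_natCast, star_one,
      star_ofNat, map_mul, map_add, map_pow, map_natCast, map_one, map_ofNat, ht] at this
    have hz3 : φ ζ ^ 3 = 1 := by linear_combination (φ ζ - 1) * hz
    linear_combination this + 2 * hz - φ s * φ ζ * φ (star y) * hz3
  have hne : (1 + 2 * φ ζ) ≠ 0 := fun h0 => h3 <| by
    linear_combination 4 * hz - (1 + 2 * φ ζ) * h0
  have hs0 : φ s ^ e * φ ζ ^ e * φ y ^ e ≠ 0 := by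
    rw [← hx1] at hne
    refine mul_ne_zero (mul_ne_zero ?_ ?_) ?_ <;> refine pow_ne_zero _ fun h0 => hne ?_ <;>
      rw [h0] <;> ring
  have hrec := hy.map_star_pow q hq hqy k h3 φ e he
  have key : φ (f q) = φ ζ ^ e := by
    apply mul_left_cancel₀ hs0
    have h1 := congrArg (· ^ e) hx1
    have h2 := congrArg (· ^ e) hx2
    simp only [mul_pow, hneg, one_mul, hrec] at h1 h2
    linear_combination h2 - h1
  refine eq_of_pow_three_eq_one h3 φ (hy.apply_pow_three q hq hqy) ?_ (by rw [key, map_pow])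
  rw [← pow_mul, mul_comm, pow_mul, zeta_pow_three, one_pow]

/-- If `n ∣ t` and the order of `n` modulo each prime divisor of `t ^ 2 + 3` is prime to three, then
cubic reciprocity forces `n ^ 2 ≡ 1` modulo nine. -/
theorem sq_modEq_one_of_not_three_dvd_orderOf {n t : ℕ} (hn : ¬ 3 ∣ n) (ht : t % 3 = 1)
    (hnt : n ∣ t) (h : ∀ p : ℕ, p.Prime → p ∣ t ^ 2 + 3 → ¬ 3 ∣ orderOf (n : ZMod p)) :
    n ^ 2 ≡ 1 [MOD 9] := by
  have hnorm : (⟨t + 1, 2⟩ : 𝓔).norm = (t ^ 2 + 3 : ℕ) := by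
    rw [norm_eq]
    push_cast
    ring
  have ht3 : ¬ 3 ∣ t := by lia
  have h3 : ¬ 3 ∣ t ^ 2 + 3 := fun hd =>
    ht3 (Nat.prime_three.dvd_of_dvd_pow ((Nat.dvd_add_left (dvd_refl 3)).1 hd))
  obtain ⟨u, y, f, hu, hy, hx⟩ := exists_isReciprocal (x := ⟨t + 1, 2⟩) (by
    rw [hnorm]
    exact_mod_cast h3)
  obtain ⟨s, hs, rfl⟩ := eq_mul_zeta_sq_of_re_im ht hu hy.three_dvd_im hx
  have hny : y.norm = (t ^ 2 + 3 : ℕ) := by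
    rw [← hnorm, hx, map_mul, map_mul, map_pow, QuadraticAlgebra.norm_intCast, norm_eq ζ]
    simp [hs]
  have key (m : ℕ) : m ∣ n → ∃ i, f m = ζ ^ i ∧ m ^ 2 ≡ 1 + 3 * i [MOD 9] := by
    induction m using induction_on_primes with
    | zero => exact fun h => absurd (Nat.eq_zero_of_zero_dvd h ▸ dvd_zero 3) hn
    | one => exact fun _ => ⟨0, by simp, rfl⟩
    | prime_mul q a hq ih =>
      intro hd
      obtain ⟨i, hi, hia⟩ := ih (dvd_of_mul_left_dvd hd)
      have hqn : q ∣ n := dvd_of_mul_right_dvd hd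
      have hq3 : ¬ 3 ∣ q := fun h => hn (h.trans hqn)
      obtain ⟨e, he⟩ : ∃ e, 3 * e + 1 = q ^ 2 := by
        have : q ^ 2 % 3 = 1 := by
          rcases (by lia : q % 3 = 1 ∨ q % 3 = 2) with h | h <;> simp [Nat.pow_mod, h]
        exact ⟨q ^ 2 / 3, by lia⟩
      have hqt := hqn.trans hnt
      have hqy : ¬ (q : ℤ) ∣ y.norm := by
        rw [hny]
        intro hd
        have hd : q ∣ t ^ 2 + 3 := mod_cast hd
        have := (Nat.dvd_add_right (hqt.trans (dvd_pow_self t two_ne_zero))).1 hd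
        rw [Nat.prime_dvd_prime_iff_eq hq Nat.prime_three] at this
        exact hq3 this.symm.dvd
      have hfq := apply_eq_zeta_pow hy hx hq (fun h => hq3 h.symm.dvd) hqt hqy he
      refine ⟨e + i, by rw [map_mul, hfq, hi, pow_add], ?_⟩
      rw [mul_pow, ← he]
      refine (hia.mul_left _).trans ?_
      rw [show (3 * e + 1) * (1 + 3 * i) = 1 + 3 * (e + i) + 9 * (e * i) by ring]
      simp [Nat.ModEq]
  obtain ⟨i, hi, hin⟩ := key n dvd_rfl
  rw [hy.apply_eq_one n fun p hp hd => h p hp (by rw [hny] at hd; exact_mod_cast hd)] at hi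
  obtain ⟨j, rfl⟩ := isPrimitiveRoot_zeta.dvd_of_pow_eq_one i hi.symm
  refine hin.trans ?_
  rw [← mul_assoc]
  simp [Nat.ModEq]

end EisensteinInt

theorem orderOf_lt_of_pow_two_mul {G : Type*} [Monoid G] {a b : G} (h3 : 3 ∣ orderOf a)
    (h0 : orderOf a ≠ 0) {m : ℕ} (h : b ^ 2 = a ^ (3 * m)) : orderOf b < orderOf a := by
  obtain ⟨k, hk⟩ := h3
  have : b ^ (2 * k) = 1 := by
    rw [pow_mul, h, ← pow_mul, mul_right_comm, ← hk, pow_mul, pow_orderOf_eq_one, one_pow]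
  have := orderOf_le_of_pow_eq_one (by lia) this
  lia

theorem exists_gt_prime_three_dvd_orderOf {A : ℤ} (h3 : ¬ (3 : ℤ) ∣ A)
    (h9 : ¬ A ^ 2 ≡ 1 [ZMOD 9]) (B : ℕ) :
    ∃ p : ℕ, B < p ∧ p.Prime ∧ ¬ (p : ℤ) ∣ 3 * A ∧ 3 ∣ orderOf (A : ZMod p) ∧
      ∃ m, ((-3 : ZMod p)) = A ^ (3 * m) := by
  have hn3 : ¬ 3 ∣ A.natAbs := by lia
  have hn9 : ¬ A.natAbs ^ 2 ≡ 1 [MOD 9] := fun h => h9 <| by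
    have := (Int.natCast_modEq_iff).2 h
    simpa using this
  set t := A.natAbs ^ (6 * B.factorial) with ht_def
  have hB := B.factorial_pos
  have ht : t % 3 = 1 := by
    rw [ht_def, pow_mul, Nat.pow_mod]
    have : A.natAbs ^ 6 % 3 = 1 := by
      rcases (by lia : A.natAbs % 3 = 1 ∨ A.natAbs % 3 = 2) with h | h <;> simp [Nat.pow_mod, h]
    simp [this]
  have hnt : A.natAbs ∣ t := dvd_pow_self _ (by lia)
  obtain ⟨p, hp, hpt, hord⟩ : ∃ p : ℕ, p.Prime ∧ p ∣ t ^ 2 + 3 ∧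
      3 ∣ orderOf (A.natAbs : ZMod p) := by
    by_contra! h
    exact hn9 (EisensteinInt.sq_modEq_one_of_not_three_dvd_orderOf hn3 ht hnt h)
  have : Fact p.Prime := ⟨hp⟩
  have hp3 : p ≠ 3 := by
    rintro rfl
    have := Nat.prime_three.dvd_of_dvd_pow ((Nat.dvd_add_left (dvd_refl 3)).1 hpt)
    lia
  have hpn : ¬ p ∣ A.natAbs := fun hd => hp3 <| by
    have := (Nat.dvd_add_right ((hd.trans hnt).trans (dvd_pow_self t two_ne_zero))).1 hpt
    rwa [Nat.prime_dvd_prime_iff_eq hp Nat.prime_three] at this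
  have hn0 : (A.natAbs : ZMod p) ≠ 0 := by rwa [Ne, ZMod.natCast_eq_zero_iff]
  have hsq : (A.natAbs : ZMod p) ^ 2 = (A : ZMod p) ^ 2 := by
    rw [← Int.cast_natCast, ← Int.cast_pow, Int.natAbs_sq, Int.cast_pow]
  have hpt' : (A.natAbs : ZMod p) ^ (6 * B.factorial * 2) + 3 = 0 := by
    rw [← ZMod.natCast_eq_zero_iff, ht_def, ← pow_mul] at hpt
    exact_mod_cast hpt
  refine ⟨p, ?_, hp, ?_, ?_, 4 * B.factorial, ?_⟩
  · by_contra! hle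
    obtain ⟨c, hc⟩ := Nat.dvd_factorial (by have := hp.two_le; lia : 0 < p - 1) (by lia : p - 1 ≤ B)
    rw [hc, show 6 * ((p - 1) * c) * 2 = (p - 1) * (12 * c) by ring, pow_mul,
      ZMod.pow_card_sub_one_eq_one hn0, one_pow] at hpt'
    have h4 : ((2 ^ 2 : ℕ) : ZMod p) = 0 := by
      push_cast
      linear_combination hpt'
    rw [ZMod.natCast_eq_zero_iff] at h4
    have := (Nat.prime_dvd_prime_iff_eq hp Nat.prime_two).1 (hp.dvd_of_dvd_pow h4)
    subst this
    have h1 : (A.natAbs : ZMod 2) = 1 :=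
      ZMod.natCast_eq_one_iff_odd.2 (Nat.not_even_iff_odd.1 fun h => hpn h.two_dvd)
    rw [h1, orderOf_one] at hord
    lia
  · intro hd
    rcases Int.Prime.dvd_mul' hp hd with h | h
    · have : p ∣ 3 := mod_cast h
      exact hp3 ((Nat.prime_dvd_prime_iff_eq hp Nat.prime_three).1 this)
    · exact hpn (Int.natCast_dvd.1 h)
  · have : orderOf (A.natAbs : ZMod p) ∣ 2 * orderOf (A : ZMod p) := by
      apply orderOf_dvd_of_pow_eq_one
      rw [pow_mul, hsq, ← pow_mul, mul_comm, pow_mul, pow_orderOf_eq_one, one_pow]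
    exact (Nat.Coprime.dvd_mul_left (by norm_num)).1 (hord.trans this)
  · rw [show 6 * B.factorial * 2 = 2 * (6 * B.factorial) by ring, pow_mul, hsq, ← pow_mul] at hpt'
    rw [show 3 * (4 * B.factorial) = 2 * (6 * B.factorial) by ring]
    linear_combination -hpt'

/-- Theorem 1.3, consequence: if `3 ∤ A` and `A² ≢ 1 (mod 9)`, then both pairs `A, -3`
and `A, 3` are order-dominant. -/
theorem order_dominant_A_neg_three_and_three (A : ℤ) (h3 : ¬ (3 : ℤ) ∣ A)
    (h9 : ¬ A ^ 2 ≡ 1 [ZMOD 9]) :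
    {p : ℕ | p.Prime ∧ ¬ (p : ℤ) ∣ 3 * A ∧
      orderOf ((-3 : ZMod p)) < orderOf ((A : ZMod p))}.Infinite ∧
    {p : ℕ | p.Prime ∧ ¬ (p : ℤ) ∣ 3 * A ∧
      orderOf ((3 : ZMod p)) < orderOf ((A : ZMod p))}.Infinite := by
  have key (B : ℕ) : ∃ p : ℕ, B < p ∧ p.Prime ∧ ¬ (p : ℤ) ∣ 3 * A ∧
      ∀ b : ZMod p, b ^ 2 = (-3) ^ 2 → orderOf b < orderOf (A : ZMod p) := by
    obtain ⟨p, hB, hp, hpA, hord, m, hm⟩ := exists_gt_prime_three_dvd_orderOf h3 h9 B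
    have : Fact p.Prime := ⟨hp⟩
    have hA : (A : ZMod p) ≠ 0 := fun h =>
      hpA (((ZMod.intCast_zmod_eq_zero_iff_dvd A p).1 h).mul_left 3)
    refine ⟨p, hB, hp, hpA, fun b hb => ?_⟩
    refine orderOf_lt_of_pow_two_mul hord (m := m * 2) ?_ ?_
    · exact orderOf_ne_zero_iff.2 (isOfFinOrder_iff_pow_eq_one.2
        ⟨p - 1, by have := hp.two_le; lia, ZMod.pow_card_sub_one_eq_one hA⟩)
    · rw [hb, hm, ← pow_mul, mul_assoc]
  constructor <;> refine Set.infinite_of_forall_exists_gt fun B => ?_ <;>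
    obtain ⟨p, hB, hp, hpA, h⟩ := key B
  · exact ⟨p, ⟨hp, hpA, h _ rfl⟩, hB⟩
  · exact ⟨p, ⟨hp, hpA, h _ (by norm_num)⟩, hB⟩
end

section
/- Let K be an imaginary quadratic number field with ring of integers O_K, and let α, β ∈ O_K be nonzero elements, neither of which is a root of unity. Then there are infinitely many maximal (nonzero prime) ideals P of O_K such that the images of α and β in the residue field O_K/P are both nonzero and generate the same cyclic subgroup of the unit group (O_K/P)ˣ. -/
open NumberField

theorem jacobiSym_four_mul_sub_one {d : ℕ} (hd : 0 < d) : jacobiSym d (4 * d - 1) = 1 := by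
  have hodd : Odd (4 * d - 1) := by rw [Nat.odd_iff]; omega
  have h : jacobiSym (4 * d) (4 * d - 1) = 1 := by
    rw [← jacobiSym.one_left (4 * d - 1)]
    refine jacobiSym.mod_left' ?_
    refine Int.ModEq.symm (Int.modEq_iff_dvd.2 ⟨1, ?_⟩)
    push_cast [show 1 ≤ 4 * d by omega]
    ring
  rwa [jacobiSym.mul_left, jacobiSym.at_four hodd, one_mul] at h

theorem legendreSym_neg_of_four_mul_dvd {q d : ℕ} [Fact q.Prime] (hd : 0 < d)
    (h : 4 * d ∣ q + 1) : legendreSym q (-d) = -1 := by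
  obtain ⟨c, hc⟩ := h
  obtain ⟨c, rfl⟩ : ∃ b, c = b + 1 := ⟨c - 1, by cases c <;> simp_all⟩
  have hmod4 : q % 4 = 3 := by
    have : q + 1 = 4 * (d * (c + 1)) := by rw [hc]; ring
    omega
  have hodd : Odd q := by rw [Nat.odd_iff]; omega
  have hmod : q % (4 * d) = 4 * d - 1 := by
    have : q = (4 * d - 1) + 4 * d * c := by
      have : 4 * d * (c + 1) = 4 * d * c + 4 * d := by ring
      omega
    rw [this, Nat.add_mul_mod_self_left, Nat.mod_eq_of_lt (by omega)]
  rw [jacobiSym.legendreSym.to_jacobiSym, jacobiSym.neg _ hodd, ZMod.χ₄_nat_three_mod_four hmod4,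
    jacobiSym.mod_right' _ hodd, hmod, jacobiSym_four_mul_sub_one hd, mul_one]

/-- The Frobenius congruence at an inert prime, for a root `x` of `X ^ 2 - t X + n` with
discriminant `-d`. -/
theorem natCast_dvd_pow_sub_of_inert {R : Type*} [CommRing R] [IsDomain R] {x : R} {t : ℤ} {d q : ℕ}
    (hx : (2 * x - t) ^ 2 = -(d : R)) (hq : q.Prime) (h4 : 4 ∣ q + 1) (hd : 4 * d ∣ q + 1 ∨ d = 0) :
    (q : R) ∣ x ^ q - (t - x) := by
  have := Fact.mk hq
  obtain ⟨j, hj⟩ : ∃ j, q = 2 * j + 1 := ⟨q / 2, by omega⟩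
  have hj' : q / 2 = j := by omega
  have hcast (a b : ℤ) (h : (a : ZMod q) = b) : ∃ r : R, (a : R) = b + q * r := by
    obtain ⟨r, hr⟩ := (ZMod.intCast_eq_intCast_iff_dvd_sub b a q).1 h.symm
    refine ⟨r, ?_⟩
    rw [← sub_eq_iff_eq_add']
    exact_mod_cast congrArg (Int.cast : ℤ → R) hr
  obtain ⟨r, hr⟩ := exists_add_pow_prime_eq hq (t : R) (2 * x - t)
  obtain ⟨r₂, hr₂⟩ := hcast (2 ^ q) 2 (by simp [ZMod.pow_card])
  obtain ⟨r₃, hr₃⟩ := hcast (t ^ q) t (by simp [ZMod.pow_card])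
  obtain ⟨r₄, hr₄⟩ : ∃ r : R, (2 * x - t) ^ q = -(2 * x - t) + q * r := by
    rcases Nat.eq_zero_or_pos d with rfl | hpos
    · have h0 : 2 * x - t = 0 := by simpa using hx
      exact ⟨0, by rw [h0, zero_pow hq.ne_zero]; ring⟩
    · obtain ⟨r, hr⟩ := hcast ((-d) ^ j) (-1) (by
        have := legendreSym.eq_pow q (-d)
        rw [legendreSym_neg_of_four_mul_dvd hpos (hd.resolve_right hpos.ne'), hj'] at this
        rw [this]; push_cast; rfl)
      refine ⟨(2 * x - t) * r, ?_⟩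
      push_cast at hr
      rw [hj, pow_succ, pow_mul, hx, hr, hj]
      ring
  rw [add_sub_cancel, mul_pow] at hr
  push_cast at hr₂ hr₃
  rw [hr₂, hr₃, hr₄] at hr
  refine ⟨x ^ q - (t - x) - j * (r₃ + r₄ + t * (2 * x - t) * r - r₂ * x ^ q), ?_⟩
  have hjR : (q : R) = 2 * j + 1 := by exact_mod_cast congrArg (Nat.cast : ℕ → R) hj
  linear_combination (-(j : R)) * hr + (x ^ q - (t - x)) * (-hjR)

section NormForm

variable {R : Type*} [CommRing R] {f : R →+* ℂ} {N : R → ℤ}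

theorem norm_add_natCast_mul_modEq (hN : ∀ x, (N x : ℝ) = Complex.normSq (f x)) (q : ℕ) (y w : R) :
    N (y + q * w) ≡ N y [ZMOD q] := by
  refine (Int.modEq_iff_dvd.2 ⟨N (y + w) - N y - N w + q * N w, ?_⟩).symm
  have : (N (y + q * w) - N y : ℝ) = q * (N (y + w) - N y - N w + q * N w) := by
    simp only [hN, map_add, map_mul, map_natCast, Complex.normSq_apply, Complex.add_re,
      Complex.add_im, Complex.mul_re, Complex.mul_im, Complex.natCast_re, Complex.natCast_im]
    ring
  exact_mod_cast this

/-- In an imaginary quadratic ring, the conjugate of `x` lies in the ring, and is congruent to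
`x ^ q` modulo all primes `q` congruent to `-1` modulo a suitable integer. -/
theorem exists_conj_and_frobenius [IsDomain R] (hf : Function.Injective f)
    (hN : ∀ x, (N x : ℝ) = Complex.normSq (f x)) (x : R) :
    ∃ y : R, f y = starRingEnd ℂ (f x) ∧
      ∃ D : ℕ, 0 < D ∧ ∀ q : ℕ, q.Prime → D ∣ q + 1 → (q : R) ∣ x ^ q - y := by
  set t : ℤ := N (x + 1) - N x - 1 with ht
  have htr : (t : ℝ) = 2 * (f x).re := by
    rw [ht]
    push_cast
    simp only [hN, map_add, map_one, Complex.normSq_apply, Complex.add_re,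
      Complex.add_im, Complex.one_re, Complex.one_im]
    ring
  have htC : (t : ℂ) = 2 * ((f x).re : ℂ) := by exact_mod_cast congrArg Complex.ofReal htr
  have hdisc : ((4 * N x - t ^ 2 : ℤ) : ℝ) = 4 * (f x).im ^ 2 := by
    push_cast
    rw [htr, hN, Complex.normSq_apply]
    ring
  obtain ⟨d, hd⟩ : ∃ d : ℕ, 4 * N x - t ^ 2 = d := by
    refine Int.eq_ofNat_of_zero_le ?_
    have : (0 : ℝ) ≤ ((4 * N x - t ^ 2 : ℤ) : ℝ) := by rw [hdisc]; positivity
    exact_mod_cast this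
  have hx : (2 * x - t) ^ 2 = -(d : R) := by
    apply hf
    have him : (d : ℂ) = 4 * ((f x).im : ℂ) ^ 2 := by
      rw [hd] at hdisc
      exact_mod_cast congrArg Complex.ofReal hdisc
    simp only [map_pow, map_sub, map_mul, map_ofNat, map_intCast, map_neg, map_natCast, him, htC]
    nth_rewrite 1 [← Complex.re_add_im (f x)]
    ring_nf
    simp
  refine ⟨t - x, ?_, ?_⟩
  · rw [map_sub, map_intCast, htC]
    apply Complex.ext <;> simp
    ring
  · rcases Nat.eq_zero_or_pos d with h0 | hpos
    · exact ⟨4, by norm_num, fun q hq h4 => natCast_dvd_pow_sub_of_inert hx hq h4 (Or.inr h0)⟩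
    · exact ⟨4 * d, by positivity, fun q hq h => natCast_dvd_pow_sub_of_inert hx hq
        (dvd_of_mul_right_dvd h) (Or.inl h)⟩

end NormForm

theorem normSq_conj_sub_lt {z w : ℂ} (hz : 1 < Complex.normSq z) (hw : 1 < Complex.normSq w) :
    Complex.normSq (starRingEnd ℂ z - w) < Complex.normSq (1 - z * w) := by
  have h := mul_pos (sub_pos.2 hz) (sub_pos.2 hw)
  simp only [Complex.normSq_apply, Complex.sub_re, Complex.sub_im, Complex.mul_re, Complex.mul_im,
    Complex.conj_re, Complex.conj_im, Complex.one_re, Complex.one_im] at *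
  nlinarith

theorem Submonoid.powers_eq_powers_of_pow_eq {G : Type*} [Monoid G] {a b : G} {q : ℕ}
    (h : a ^ q = b) (hq : q.Coprime (orderOf a)) : Submonoid.powers a = Submonoid.powers b := by
  apply le_antisymm
  · rw [Submonoid.powers_le]
    obtain ⟨m, hm⟩ := exists_pow_eq_self_of_coprime hq
    exact ⟨m, by simpa [h] using hm⟩
  · rw [Submonoid.powers_le]
    exact ⟨q, h⟩

theorem absNorm_modEq_one {R : Type*} [CommRing R] [IsDedekindDomain R] [Module.Free ℤ R]
    (q : ℕ) (I : Ideal R) (hI : I ≠ ⊥)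
    (h : ∀ P : Ideal R, P.IsPrime → P ≠ ⊥ → I ≤ P → Ideal.absNorm P ≡ 1 [MOD q]) :
    Ideal.absNorm I ≡ 1 [MOD q] := by
  induction I using UniqueFactorizationMonoid.induction_on_prime with
  | h₁ => exact absurd rfl hI
  | h₂ I hu => rw [Ideal.isUnit_iff.1 hu, Ideal.absNorm_top]
  | h₃ I P hI0 hP ih =>
    rw [map_mul]
    simpa using (h P (Ideal.isPrime_of_prime hP) hP.ne_zero Ideal.mul_le_left).mul
      (ih hI0 fun Q hQ hQ0 hle => h Q hQ hQ0 (Ideal.mul_le_right.trans hle))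

/-- The cofactor of the ideal `(α ^ k, β)` in `α ^ q - β` is coprime to `α` when `k` is past the
point where these ideals stabilize. -/
theorem notMem_of_mem_span_mul {R : Type*} [CommRing R] [IsDedekindDomain R] {α β : R} {k q : ℕ}
    {P : Ideal R} (hP : P.IsPrime) (hβ0 : β ≠ 0)
    (hk : α ^ k ∈ Ideal.span {α ^ (k + 1), β}) (hkq : k < q)
    (hx : α ^ q - β ∈ Ideal.span {α ^ k, β} * P) : α ∉ P := by
  intro hα
  have hβD : β ∈ Ideal.span {α ^ k, β} := Ideal.subset_span (by simp)
  have hD0 : Ideal.span {α ^ k, β} ≠ ⊥ := fun h => hβ0 (by simpa [h] using hβD)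
  have hpow (n : ℕ) (hn : k < n) : α ^ n ∈ Ideal.span {α ^ k, β} * P := by
    rw [← Nat.sub_add_cancel hn, Nat.succ_eq_add_one, pow_add, pow_succ]
    exact Ideal.mul_mem_left _ _ (Ideal.mul_mem_mul (Ideal.subset_span (by simp)) hα)
  have hβPD : β ∈ Ideal.span {α ^ k, β} * P := by
    simpa using Ideal.sub_mem _ (hpow q hkq) hx
  have hle : Ideal.span {α ^ (k + 1), β} ≤ Ideal.span {α ^ k, β} * P := by
    rw [Ideal.span_le]
    rintro _ (rfl | rfl)
    exacts [hpow _ (by omega), hβPD]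
  have hle' : Ideal.span {α ^ k, β} ≤ Ideal.span {α ^ k, β} * P := by
    refine Ideal.span_le.2 ?_
    rintro _ (rfl | rfl)
    exacts [hle hk, hβPD]
  refine hP.ne_top (mul_left_cancel₀ hD0 ?_)
  rw [Ideal.mul_top]
  exact le_antisymm Ideal.mul_le_left hle'

section Dedekind

variable {R : Type*} [CommRing R] [IsDedekindDomain R] [Module.Free ℤ R] [Module.Finite ℤ R]

theorem powers_eq_or_absNorm_modEq_one {α β : R} {q : ℕ} (hq : q.Prime) {P : Ideal R}
    (hP : P.IsMaximal) (hP0 : P ≠ ⊥) (hα : α ∉ P) (h : α ^ q - β ∈ P) :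
    Submonoid.powers (Ideal.Quotient.mk P α) = Submonoid.powers (Ideal.Quotient.mk P β) ∨
      Ideal.absNorm P ≡ 1 [MOD q] := by
  have hfin : Finite (R ⧸ P) := P.finiteQuotientOfFreeOfNeBot hP0
  let _ := Ideal.Quotient.field P
  let _ := Fintype.ofFinite (R ⧸ P)
  have hα' : Ideal.Quotient.mk P α ≠ 0 := by rwa [Ne, Ideal.Quotient.eq_zero_iff_mem]
  have hcard : Ideal.absNorm P = Fintype.card (R ⧸ P) := by
    rw [Ideal.absNorm_apply, Submodule.cardQuot_apply, ← Nat.card_eq_fintype_card]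
  have hord : orderOf (Ideal.Quotient.mk P α) ∣ Ideal.absNorm P - 1 := by
    rw [hcard]
    exact orderOf_dvd_of_pow_eq_one (FiniteField.pow_card_sub_one_eq_one _ hα')
  by_cases hdvd : q ∣ Ideal.absNorm P - 1
  · right
    have : 1 ≤ Ideal.absNorm P := by rw [hcard]; exact Fintype.card_pos
    exact ((Nat.modEq_iff_dvd' this).2 hdvd).symm
  · left
    refine Submonoid.powers_eq_powers_of_pow_eq ?_
      (((Nat.Prime.coprime_iff_not_dvd hq).2 hdvd).coprime_dvd_right hord)
    rw [← map_pow]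
    exact Ideal.Quotient.eq.2 h

theorem exists_pow_sub_one_mem {α : R} {J : Ideal R} (hJ : J ≠ ⊥)
    (h : IsCoprime (Ideal.span {α}) J) : ∃ M : ℕ, 0 < M ∧ α ^ M - 1 ∈ J := by
  have hfin : Finite (R ⧸ J) := J.finiteQuotientOfFreeOfNeBot hJ
  have hu : IsUnit (Ideal.Quotient.mk J α) := by
    obtain ⟨a, ha, j, hj, haj⟩ := Ideal.isCoprime_iff_exists.1 h
    obtain ⟨c, rfl⟩ := Ideal.mem_span_singleton'.1 ha
    refine IsUnit.of_mul_eq_one (Ideal.Quotient.mk J c) ?_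
    rw [← map_mul, ← map_one (Ideal.Quotient.mk J), Ideal.Quotient.eq, ← haj]
    convert J.neg_mem hj using 1
    ring
  obtain ⟨u, hu⟩ := hu
  refine ⟨orderOf u, (isOfFinOrder_of_finite u).orderOf_pos, ?_⟩
  rw [← Ideal.Quotient.eq, map_pow, map_one, ← hu, ← Units.val_pow_eq_pow_val, pow_orderOf_eq_one,
    Units.val_one]

theorem exists_pow_mem_span_pow_succ (α : R) {β : R} (hβ : β ≠ 0) :
    ∃ k : ℕ, α ^ k ∈ Ideal.span {α ^ (k + 1), β} := by
  have hfin : Finite (R ⧸ Ideal.span {β}) :=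
    (Ideal.span {β}).finiteQuotientOfFreeOfNeBot (by simpa using hβ)
  obtain ⟨i, j, hij, h⟩ := Finite.exists_ne_map_eq_of_infinite
    fun n : ℕ => Ideal.Quotient.mk (Ideal.span {β}) (α ^ n)
  wlog hlt : i < j generalizing i j
  · exact this j i hij.symm h.symm (by omega)
  obtain ⟨c, hc⟩ := Ideal.mem_span_singleton'.1 (Ideal.Quotient.eq.1 h)
  refine ⟨i, Ideal.mem_span_pair.2 ⟨α ^ (j - (i + 1)), c, ?_⟩⟩
  rw [hc, ← pow_add, Nat.sub_add_cancel hlt]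
  ring

theorem infinite_setOf_powers_eq (hR : ¬ IsField R) {f : R →+* ℂ} (hf : Function.Injective f)
    (hN : ∀ x, (Ideal.absNorm (Ideal.span {x}) : ℝ) = Complex.normSq (f x)) {α β : R}
    (hα : 1 < Complex.normSq (f α)) (hβ : 1 < Complex.normSq (f β)) :
    {P : Ideal R | P.IsMaximal ∧ Ideal.Quotient.mk P α ≠ 0 ∧ Ideal.Quotient.mk P β ≠ 0 ∧
      Submonoid.powers (Ideal.Quotient.mk P α) =
        Submonoid.powers (Ideal.Quotient.mk P β)}.Infinite := by
  intro hfin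
  have hβ0 : β ≠ 0 := by rintro rfl; norm_num at hβ
  set γ := 1 - α * β with hγ
  obtain ⟨y, hy, D₀, hD₀, hfrob⟩ := exists_conj_and_frobenius
    (N := fun x => (Ideal.absNorm (Ideal.span {x}) : ℤ)) hf (by simpa using hN) α
  have hlt : Ideal.absNorm (Ideal.span {y - β}) < Ideal.absNorm (Ideal.span {γ}) := by
    have := normSq_conj_sub_lt hα hβ
    rw [← hy, ← map_mul, ← map_sub, ← map_one f, ← map_sub, ← hN, ← hN] at this
    exact_mod_cast this
  have hγ0 : γ ≠ 0 := by
    intro h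
    simp [h] at hlt
  have hγα : IsCoprime γ α := ⟨1, β, by rw [hγ]; ring⟩
  set L : Ideal R := ∏ P ∈ hfin.toFinset, P
  have hLα : IsCoprime (Ideal.span {α}) L := by
    refine IsCoprime.prod_right fun P hP => ?_
    obtain ⟨hmax, hαP, -⟩ := hfin.mem_toFinset.1 hP
    rw [Ideal.isCoprime_iff_sup_eq, sup_comm]
    refine hmax.out.2 _ (left_lt_sup.2 ?_)
    rwa [Ideal.span_singleton_le_iff_mem, ← Ideal.Quotient.eq_zero_iff_mem]
  have hL0 : L ≠ ⊥ := Finset.prod_ne_zero_iff.2 fun P hP =>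
    Ring.ne_bot_of_isMaximal_of_not_isField (hfin.mem_toFinset.1 hP).1 hR
  obtain ⟨M, hM0, hM⟩ := exists_pow_sub_one_mem (α := α) (J := Ideal.span {γ} * L)
    (mul_ne_zero (by simpa using hγ0) hL0)
    (((Ideal.isCoprime_span_singleton_iff _ _).2 hγα.symm).mul_right hLα)
  obtain ⟨k, hk⟩ := exists_pow_mem_span_pow_succ α hβ0
  set D : Ideal R := Ideal.span {α ^ k, β}
  have hαD : α ^ k ∈ D := Ideal.subset_span (by simp)
  have hβD : β ∈ D := Ideal.subset_span (by simp)
  have hD0 : D ≠ ⊥ := fun h => hβ0 (by simpa [h] using hβD)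
  have hγD : IsCoprime (Ideal.span {γ}) D := by
    refine Ideal.isCoprime_iff_exists.2 ⟨γ, Ideal.mem_span_singleton_self γ, α * β,
      D.mul_mem_left _ hβD, ?_⟩
    rw [hγ]
    ring
  have hMD : 0 < M * D₀ := by positivity
  obtain ⟨q, hqlarge, hq, hqmod⟩ := Nat.forall_exists_prime_gt_and_modEq
    (Ideal.absNorm (Ideal.span {γ}) * Ideal.absNorm D + k + Ideal.absNorm (Ideal.span {β}))
    (q := M * D₀) (a := M * D₀ - 1) hMD.ne' (by
      rw [Nat.coprime_self_sub_left hMD]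
      exact Nat.coprime_one_left _)
  have hMDq : M * D₀ ∣ q + 1 := by
    have := hqmod.add_right 1
    rw [Nat.sub_add_cancel hMD] at this
    exact (Nat.modEq_zero_iff_dvd).1 (this.trans (by simp [Nat.ModEq]))
  obtain ⟨w, hw⟩ := hfrob q hq (dvd_of_mul_left_dvd hMDq)
  obtain ⟨x, hx⟩ : ∃ x, x = α ^ q - β := ⟨_, rfl⟩
  have hx0 : x ≠ 0 := by
    intro h
    have h1 : Complex.normSq (f α) ^ q = Complex.normSq (f β) := by
      rw [← map_pow, ← map_pow, sub_eq_zero.1 (hx.symm.trans h)]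
    rw [← hN, ← hN] at h1
    rw [← hN] at hα
    norm_cast at h1 hα
    have := Nat.lt_pow_self hα (n := q)
    omega
  obtain ⟨l, hl, hlx⟩ : ∃ l ∈ L, α * x = γ * (1 + l) := by
    obtain ⟨c, hc⟩ := dvd_of_mul_right_dvd hMDq
    have : α ^ (q + 1) - 1 ∈ Ideal.span {γ} * L := by
      rw [hc, pow_mul]
      exact Ideal.mem_of_dvd _ (sub_one_dvd_pow_sub_one _ _) hM
    obtain ⟨l, hl, hlγ⟩ := Ideal.mem_span_singleton_mul.1 this
    refine ⟨l, hl, ?_⟩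
    rw [mul_add, hlγ, hx, hγ]
    ring
  have hγx : γ ∣ x := hγα.dvd_of_dvd_mul_left ⟨_, hlx⟩
  have hxD : x ∈ D := by
    rw [hx]
    refine D.sub_mem ?_ hβD
    rw [← Nat.sub_add_cancel (show k ≤ q by omega), pow_add]
    exact D.mul_mem_left _ hαD
  obtain ⟨I, hI⟩ : Ideal.span {γ} * D ∣ Ideal.span {x} :=
    hγD.mul_dvd (Ideal.dvd_span_singleton.2 (Ideal.mem_span_singleton.2 hγx))
      (Ideal.dvd_span_singleton.2 hxD)
  have hI0 : I ≠ ⊥ := by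
    rintro rfl
    rw [Ideal.mul_bot] at hI
    exact hx0 (by simpa using hI)
  have hINorm : Ideal.absNorm I ≡ 1 [MOD q] := by
    refine absNorm_modEq_one q I hI0 fun P hP hP0 hIP => ?_
    have hmax : P.IsMaximal := hP.isMaximal hP0
    have hxmem : x ∈ Ideal.span {γ} * (D * P) := by
      have h := Ideal.mul_mono_right (I := Ideal.span {γ} * D) hIP
      rw [← hI, mul_assoc, Ideal.span_singleton_le_iff_mem] at h
      exact h
    have hxDP : x ∈ D * P := Ideal.mul_le_right hxmem
    have hxP : x ∈ P := Ideal.mul_le_right hxDP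
    have hxγP : x ∈ Ideal.span {γ} * P := Ideal.mul_mono_right Ideal.mul_le_right hxmem
    have hαP : α ∉ P := notMem_of_mem_span_mul hP hβ0 hk (by omega : k < q) (hx ▸ hxDP)
    refine (powers_eq_or_absNorm_modEq_one hq hmax hP0 hαP (hx ▸ hxP)).resolve_left fun hpow => ?_
    have hβP : β ∉ P := fun hβ => hαP (hP.mem_of_pow_mem q (by
      simpa [hx] using P.add_mem hxP hβ))
    have hPL : L ≤ P := by
      refine Ideal.le_of_dvd (Finset.dvd_prod_of_mem _ (hfin.mem_toFinset.2
        ⟨hmax, ?_, ?_, hpow⟩))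
      · rwa [Ne, Ideal.Quotient.eq_zero_iff_mem]
      · rwa [Ne, Ideal.Quotient.eq_zero_iff_mem]
    have hmem : γ * (1 + l) ∈ Ideal.span {γ} * P := by
      rw [← hlx]
      exact Ideal.mul_mem_left _ _ hxγP
    obtain ⟨z, hz, hzl⟩ := Ideal.mem_span_singleton_mul.1 hmem
    rw [mul_right_inj' hγ0] at hzl
    refine hP.ne_top ((Ideal.eq_top_iff_one P).2 ?_)
    simpa [hzl] using P.sub_mem hz (hPL hl)
  have hDpos : 0 < Ideal.absNorm D := Nat.pos_of_ne_zero (Ideal.absNorm_eq_zero_iff.not.2 hD0)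
  have h₁ : Ideal.absNorm (Ideal.span {x}) ≡
      Ideal.absNorm (Ideal.span {γ}) * Ideal.absNorm D [MOD q] := by
    rw [hI, map_mul, map_mul]
    simpa using hINorm.mul_left (Ideal.absNorm (Ideal.span {γ}) * Ideal.absNorm D)
  have h₂ : Ideal.absNorm (Ideal.span {x}) ≡ Ideal.absNorm (Ideal.span {y - β}) [MOD q] := by
    have := norm_add_natCast_mul_modEq (N := fun x => (Ideal.absNorm (Ideal.span {x}) : ℤ))
      (by simpa using hN) q (y - β) w
    rw [← hw, show y - β + (α ^ q - y) = x by rw [hx]; ring] at this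
    exact Int.natCast_modEq_iff.1 this
  have hle := Nat.le_mul_of_pos_right (Ideal.absNorm (Ideal.span {γ})) hDpos
  have := Nat.ModEq.eq_of_lt_of_lt (h₂.symm.trans h₁) (by omega) (by omega)
  omega

end Dedekind

section ImaginaryQuadratic

variable {K : Type*} [Field K] [NumberField K]

theorem subsingleton_infinitePlace (hdeg : Module.finrank ℚ K = 2)
    (himag : ∀ v : InfinitePlace K, v.IsComplex) : Subsingleton (InfinitePlace K) := by
  have : IsTotallyComplex K := ⟨himag⟩
  have h := IsTotallyComplex.finrank K
  have hreal := nrRealPlaces_eq_zero_iff.2 this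
  have hcard := InfinitePlace.card_eq_nrRealPlaces_add_nrComplexPlaces K
  rw [← Fintype.card_le_one_iff_subsingleton]
  omega

theorem absNorm_span_eq_normSq (hdeg : Module.finrank ℚ K = 2)
    (himag : ∀ v : InfinitePlace K, v.IsComplex) (v : InfinitePlace K) (x : 𝓞 K) :
    (Ideal.absNorm (Ideal.span {x}) : ℝ) = Complex.normSq (v.embedding x) := by
  have := subsingleton_infinitePlace hdeg himag
  have h := InfinitePlace.prod_eq_abs_norm (x : K)
  rw [Fintype.prod_subsingleton _ v, InfinitePlace.mult_isComplex ⟨v, himag v⟩,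
    ← Algebra.coe_norm_int] at h
  rw [Ideal.absNorm_span_singleton, Complex.normSq_eq_norm_sq, InfinitePlace.norm_embedding_eq, h,
    Nat.cast_natAbs]
  norm_cast

theorem one_lt_normSq (hdeg : Module.finrank ℚ K = 2)
    (himag : ∀ v : InfinitePlace K, v.IsComplex) (v : InfinitePlace K) {x : 𝓞 K} (hx : x ≠ 0)
    (hxu : ∀ n : ℕ, 0 < n → x ^ n ≠ 1) : 1 < Complex.normSq (v.embedding x) := by
  have hsub := subsingleton_infinitePlace hdeg himag
  have hpos : 0 < Ideal.absNorm (Ideal.span {x}) := Nat.pos_of_ne_zero (by simpa using hx)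
  refine lt_of_le_of_ne ?_ fun h => ?_
  · rw [← absNorm_span_eq_normSq hdeg himag]
    exact_mod_cast hpos
  · rw [Complex.normSq_eq_norm_sq, InfinitePlace.norm_embedding_eq, eq_comm,
      pow_eq_one_iff_of_nonneg (apply_nonneg v _) two_ne_zero] at h
    obtain ⟨n, hn, hxn⟩ := Embeddings.pow_eq_one_of_norm_eq_one K ℂ x.isIntegral_coe fun φ => by
      rw [← h, Subsingleton.elim v (InfinitePlace.mk φ), InfinitePlace.apply]
    exact hxu n hn (by exact_mod_cast hxn)

end ImaginaryQuadratic

/-- Theorem 1.4: let `K` be an imaginary quadratic field with ring of integers `O_K`.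
For nonzero `α, β ∈ O_K`, neither of which is a root of unity, there are infinitely many
maximal ideals `P` of `O_K` for which the images of `α` and `β` in the residue field
generate the same cyclic subgroup of `(O_K/P)ˣ`. -/
theorem schinzel_wojcik_imaginary_quadratic
    (K : Type*) [Field K] [NumberField K]
    (hdeg : Module.finrank ℚ K = 2)
    (himag : ∀ v : NumberField.InfinitePlace K, v.IsComplex)
    (α β : NumberField.RingOfIntegers K) (hα : α ≠ 0) (hβ : β ≠ 0)
    (hαu : ∀ n : ℕ, 0 < n → α ^ n ≠ 1) (hβu : ∀ n : ℕ, 0 < n → β ^ n ≠ 1) :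
    {P : Ideal (NumberField.RingOfIntegers K) | P.IsMaximal ∧
      Ideal.Quotient.mk P α ≠ 0 ∧ Ideal.Quotient.mk P β ≠ 0 ∧
      Submonoid.powers (Ideal.Quotient.mk P α) =
        Submonoid.powers (Ideal.Quotient.mk P β)}.Infinite := by
  obtain ⟨v⟩ := (inferInstance : Nonempty (NumberField.InfinitePlace K))
  exact infinite_setOf_powers_eq (NumberField.RingOfIntegers.not_isField K)
    (f := v.embedding.comp (algebraMap (𝓞 K) K))
    (v.embedding.injective.comp NumberField.RingOfIntegers.coe_injective)
    (absNorm_span_eq_normSq hdeg himag v) (one_lt_normSq hdeg himag v hα hαu)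
    (one_lt_normSq hdeg himag v hβ hβu)
end

section
/- Let F_n = 2^(2^n) + 1 denote the n-th Fermat number. Suppose A is a positive integer such that the Jacobi symbol (A / F_n) equals -1 for infinitely many positive integers n. Then there are infinitely many primes p, not dividing 2A, such that the multiplicative order of A modulo p is strictly greater than the multiplicative order of 2 modulo p. -/
/-- If `2 ^ k` divides `p - 1`, then it divides the order of every nonresidue modulo `p`. -/
lemma two_pow_dvd_orderOf_of_jacobiSym_eq_neg_one {p k : ℕ} (hp : p.Prime) {a : ℤ}
    (ha : jacobiSym a p = -1) (hk : 2 ^ k ∣ p - 1) : 2 ^ k ∣ orderOf (a : ZMod p) := by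
  have : Fact p.Prime := ⟨hp⟩
  rw [← jacobiSym.legendreSym.to_jacobiSym] at ha
  have ha0 : (a : ZMod p) ≠ 0 := fun h => by
    rw [(legendreSym.eq_zero_iff p a).mpr h] at ha
    norm_num at ha
  have hp2 : p ≠ 2 := by
    rintro rfl
    exact (legendreSym.eq_neg_one_iff 2).mp ha
      (FiniteField.isSquare_of_char_two (ZMod.ringChar_zmod_n 2) _)
  have hodd : p % 2 = 1 := hp.eq_two_or_odd.resolve_left hp2
  have hhalf : (a : ZMod p) ^ (p / 2) ≠ 1 := by
    rw [Ne, ← ZMod.euler_criterion p ha0]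
    exact (legendreSym.eq_neg_one_iff p).mp ha
  obtain ⟨j, m, hm, hj⟩ := Nat.exists_eq_two_pow_mul_odd (n := p - 1) (by have := hp.two_le; omega)
  obtain _ | j := j
  · obtain ⟨c, rfl⟩ := hm
    omega
  have hjm : p / 2 = m * 2 ^ j := by
    rw [pow_succ, mul_right_comm, mul_comm (2 ^ j)] at hj
    omega
  have hord : orderOf ((a : ZMod p) ^ m) = 2 ^ (j + 1) := by
    apply orderOf_eq_prime_pow
    · rwa [← pow_mul, ← hjm]
    · rw [← pow_mul, mul_comm, ← hj, ZMod.pow_card_sub_one_eq_one ha0]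
  have hkj : 2 ^ k ∣ 2 ^ (j + 1) := by
    refine Nat.Coprime.dvd_of_dvd_mul_right ?_ (hj ▸ hk)
    exact (Nat.coprime_two_left.mpr hm).pow_left k
  exact hkj.trans (hord ▸ orderOf_pow_dvd m)

/-- Lemma 3.1: if `A` is a positive integer such that the Jacobi symbol `(A / F_n) = -1`
for infinitely many positive integers `n` (where `F_n = 2^(2^n) + 1` is the `n`-th Fermat
number), then the pair `A, 2` is order-dominant. -/
theorem order_dominant_of_jacobi_fermat (A : ℕ) (hApos : 0 < A)
    (hJ : {n : ℕ | 0 < n ∧ jacobiSym (A : ℤ) (2 ^ 2 ^ n + 1) = -1}.Infinite) :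
    {p : ℕ | p.Prime ∧ ¬ p ∣ 2 * A ∧
      orderOf ((2 : ZMod p)) < orderOf ((A : ZMod p))}.Infinite := by
  refine Set.infinite_of_forall_exists_gt fun N => ?_
  obtain ⟨n, ⟨-, hn⟩, hNn⟩ := hJ.exists_gt (N + 1)
  obtain ⟨p, hp, hpdvd, hpA⟩ := jacobiSym.eq_neg_one_at_prime_divisor_of_eq_neg_one hn
  have : Fact p.Prime := ⟨hp⟩
  obtain ⟨k, hk⟩ := Nat.fermat_primeFactors_one_lt n p (by omega) hp hpdvd
  have hdvd : 2 ^ (n + 2) ∣ p - 1 := ⟨k, by rw [hk, Nat.add_sub_cancel, mul_comm]⟩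
  have hpn : 2 ^ (n + 2) ≤ p - 1 := Nat.le_of_dvd (by have := hp.two_le; omega) hdvd
  have hlt : n + 2 < 2 ^ (n + 2) := Nat.lt_two_pow_self
  have hA0 : (A : ZMod p) ≠ 0 := fun h => by
    rw [← jacobiSym.legendreSym.to_jacobiSym,
      (legendreSym.eq_zero_iff p A).mpr (by exact_mod_cast h)] at hpA
    norm_num at hpA
  have hAord : 2 ^ (n + 2) ∣ orderOf (A : ZMod p) := by
    simpa using two_pow_dvd_orderOf_of_jacobiSym_eq_neg_one hp hpA hdvd
  have hApos' : 0 < orderOf (A : ZMod p) :=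
    orderOf_pos_iff.mpr <| isOfFinOrder_iff_pow_eq_one.mpr
      ⟨p - 1, by omega, ZMod.pow_card_sub_one_eq_one hA0⟩
  have htwo : (2 : ZMod p) ^ 2 ^ n = -1 := by
    rw [eq_neg_iff_add_eq_zero]
    exact_mod_cast (ZMod.natCast_eq_zero_iff _ p).mpr hpdvd
  have h2ord : orderOf (2 : ZMod p) ≤ 2 ^ (n + 1) :=
    orderOf_le_of_pow_eq_one (by positivity) (by rw [pow_succ, pow_mul, htwo, neg_one_sq])
  refine ⟨p, ⟨hp, fun h => ?_, ?_⟩, by omega⟩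
  · rcases hp.dvd_mul.mp h with h | h
    · have := Nat.le_of_dvd two_pos h
      omega
    · exact hA0 ((ZMod.natCast_eq_zero_iff A p).mpr h)
  · calc orderOf (2 : ZMod p) ≤ 2 ^ (n + 1) := h2ord
      _ < 2 ^ (n + 2) := Nat.pow_lt_pow_right one_lt_two (by omega)
      _ ≤ orderOf (A : ZMod p) := Nat.le_of_dvd hApos' hAord
end
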